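/- arXiv:1705.04255 — 2 statements merged into one kernel-verified Lean document; each statement's English description precedes it below -/
import Mathlib

section
/- There exists a constant c > 0 such that for every prime p > 2 and every finite set A ⊆ F_p with |A| ≤ p^(5/8), max{ |A + A|, |A·A| } ≥ c·|A|^(6/5), where A·A = {a·b : a,b ∈ A}. -/
open Finset Pointwise

namespace SP
open MvPolynomial

/-- Uniqueness for a second-order linear ODE in polynomials of degree less than the characteristic. -/
lemma ode {R : Type*} [CommRing R] [IsDomain R] (p : ℕ) [Fact p.Prime] [CharP R p]
    (F B S T : Polynomial R) (hB : B.coeff 0 ≠ 0) (hdeg : F.natDegree < p)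
    (h : B * Polynomial.derivative (Polynomial.derivative F)
      = S * F + T * Polynomial.derivative F)
    (h0 : F.coeff 0 = 0) (h1 : F.coeff 1 = 0) : F = 0 := by
  have key : ∀ n, F.coeff n = 0 := by
    intro n
    induction n using Nat.strong_induction_on with
    | _ n ih =>
    match n, ih with
    | 0, _ => exact h0
    | 1, _ => exact h1
    | n+2, ih =>
      by_cases hn : p ≤ n + 2
      · exact Polynomial.coeff_eq_zero_of_natDegree_lt (by omega)
      have hc := congrArg (fun q => q.coeff n) h
      simp only [Polynomial.coeff_add, Polynomial.coeff_mul] at hc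
      rw [Finset.sum_eq_single (0, n), Finset.sum_eq_zero, Finset.sum_eq_zero] at hc
      · simp only [Polynomial.coeff_derivative, add_zero, mul_eq_zero, hB, false_or] at hc
        have e1 : ((n + 1 : ℕ) : R) ≠ 0 := by
          intro h'
          rw [CharP.cast_eq_zero_iff R p] at h'
          exact absurd (Nat.le_of_dvd (by omega) h') (by omega)
        have e2 : ((n + 1 + 1 : ℕ) : R) ≠ 0 := by
          intro h'
          rw [CharP.cast_eq_zero_iff R p] at h'
          exact absurd (Nat.le_of_dvd (by omega) h') (by omega)
        push_cast at e1 e2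
        push_cast at hc
        tauto
      · rintro ⟨i, j⟩ hij
        rw [HasAntidiagonal.mem_antidiagonal] at hij
        simp only at hij
        simp only [Polynomial.coeff_derivative]
        rw [ih (j+1) (by omega)]; simp
      · rintro ⟨i, j⟩ hij
        rw [HasAntidiagonal.mem_antidiagonal] at hij
        simp only at hij
        simp only
        rw [ih j (by omega)]; simp
      · rintro ⟨i, j⟩ hij hne
        rw [HasAntidiagonal.mem_antidiagonal] at hij
        simp only at hij
        simp only [Polynomial.coeff_derivative]
        have : j ≠ n := by
          rintro rfl
          apply hne; simp; omega
        rw [ih (j+1+1) (by omega)]; simp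
      · intro hh; simp at hh
  ext n; simp [key n]

variable {K : Type*} [Field K]

abbrev P3 (K : Type*) [Field K] := MvPolynomial (Fin 3) K

lemma chain {S : Type*} [CommRing S] [Algebra K S] (D : Derivation K S S) (v : Fin 3 → S)
    (g : P3 K) : D (aeval v g) = aeval v (pderiv 0 g) * D (v 0) + aeval v (pderiv 1 g) * D (v 1)
      + aeval v (pderiv 2 g) * D (v 2) := by
  induction g using MvPolynomial.induction_on with
  | C a => simp
  | add f g hf hg => simp only [map_add, hf, hg]; ring
  | mul_X f i hf =>
    simp only [map_mul, Derivation.leibniz, hf, smul_eq_mul, map_add, aeval_X, pderiv_X]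
    fin_cases i <;> simp <;> ring

lemma pderiv_comm' (i j : Fin 3) (g : P3 K) : pderiv i (pderiv j g) = pderiv j (pderiv i g) := by
  induction g using MvPolynomial.induction_on with
  | C a => simp
  | add f g hf hg => simp only [map_add, hf, hg]
  | mul_X f k hf =>
    have e : ∀ a b c : Fin 3, pderiv a (Pi.single (M := fun _ => P3 K) b 1 c) = 0 := by
      intro a b c
      rw [Pi.single_apply]; split_ifs <;> simp
    simp only [Derivation.leibniz, smul_eq_mul, map_add, pderiv_X, hf, e]
    ring

/-- the (one-directional) flecnode polynomial. -/
noncomputable def G (j : Fin 3) (g : P3 K) : P3 K :=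
  pderiv j (pderiv j g) * (pderiv 0 g)^2 - 2 * pderiv j g * pderiv 0 g * pderiv 0 (pderiv j g)
    + (pderiv j g)^2 * pderiv 0 (pderiv 0 g)

lemma G_chain {S : Type*} [CommRing S] [Algebra K S] (D : Derivation K S S) (v : Fin 3 → S)
    (g : P3 K) (j : Fin 3) (hj : (j = 1 ∧ D (v 1) = 1 ∧ D (v 2) = 0) ∨
      (j = 2 ∧ D (v 2) = 1 ∧ D (v 1) = 0)) (h0 : D (D (v 0)) = 0) :
    ∃ R, aeval v (G j g) = (aeval v (pderiv 0 g))^2 * D (D (aeval v g)) + R * D (aeval v g) := by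
  rcases hj with ⟨rfl, e1, e2⟩ | ⟨rfl, e1, e2⟩
  · have a1 := chain D v g
    have a2 := congrArg D a1
    simp only [e1, e2, mul_zero, add_zero, mul_one, map_add, Derivation.leibniz, h0, smul_eq_mul,
      chain D v (pderiv 0 g), chain D v (pderiv 1 g), pderiv_comm' 1 0] at a1 a2
    refine ⟨(D (aeval v g) - 2 * D (v 0) * aeval v (pderiv 0 g)) * aeval v (pderiv 0 (pderiv 0 g))
      - 2 * aeval v (pderiv 0 g) * aeval v (pderiv 0 (pderiv 1 g)), ?_⟩
    simp only [G, map_add, map_sub, map_mul, map_pow, map_ofNat]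
    rw [a2, a1]; ring
  · have a1 := chain D v g
    have a2 := congrArg D a1
    simp only [e1, e2, mul_zero, add_zero, mul_one, map_add, Derivation.leibniz, h0, smul_eq_mul,
      chain D v (pderiv 0 g), chain D v (pderiv 2 g), pderiv_comm' 2 0] at a1 a2
    refine ⟨(D (aeval v g) - 2 * D (v 0) * aeval v (pderiv 0 g)) * aeval v (pderiv 0 (pderiv 0 g))
      - 2 * aeval v (pderiv 0 g) * aeval v (pderiv 0 (pderiv 2 g)), ?_⟩
    simp only [G, map_add, map_sub, map_mul, map_pow, map_ofNat]
    rw [a2, a1]; ring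

/-- lines of the first kind; `l = (β, a, b)`: `y = β, t = a z + b`. -/
noncomputable def pl (l : K × K × K) : Fin 3 → Polynomial K :=
  ![Polynomial.C l.2.1 * Polynomial.X + Polynomial.C l.2.2, Polynomial.X, Polynomial.C l.1]
/-- lines of the second kind; `m = (ζ, a', b')`: `z = ζ, t = a' y + b'`. -/
noncomputable def pm (m : K × K × K) : Fin 3 → Polynomial K :=
  ![Polynomial.C m.2.1 * Polynomial.X + Polynomial.C m.2.2, Polynomial.C m.1, Polynomial.X]

lemma G1_line (g : P3 K) (l : K × K × K) (h : aeval (pl l) g = 0) : aeval (pl l) (G 1 g) = 0 := by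
  obtain ⟨R, hR⟩ := G_chain (Polynomial.derivative' (R := K)) (pl l) g 1
    (by left; simp [pl, Polynomial.derivative']) (by simp [pl, Polynomial.derivative'])
  rw [hR, h]; simp

lemma G2_line (g : P3 K) (m : K × K × K) (h : aeval (pm m) g = 0) : aeval (pm m) (G 2 g) = 0 := by
  obtain ⟨R, hR⟩ := G_chain (Polynomial.derivative' (R := K)) (pm m) g 2
    (by right; simp [pm, Polynomial.derivative']) (by simp [pm, Polynomial.derivative'])
  rw [hR, h]; simp

/-- coefficientwise derivative on `K[u][v]`. -/
noncomputable def Du (K : Type*) [Field K] :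
    Derivation K (Polynomial (Polynomial K)) (Polynomial (Polynomial K)) :=
  LinearMap.compDer (PolynomialModule.equivPolynomialSelf (R := Polynomial K)).toLinearMap
    (Polynomial.derivative' (R := K)).mapCoeffs

lemma Du_coeff (f : Polynomial (Polynomial K)) (n : ℕ) :
    (Du K f).coeff n = Polynomial.derivative (f.coeff n) := rfl

noncomputable def Dv (K : Type*) [Field K] :
    Derivation K (Polynomial (Polynomial K)) (Polynomial (Polynomial K)) :=
  (Polynomial.derivative' (R := Polynomial K)).restrictScalars K

lemma Dv_apply (f : Polynomial (Polynomial K)) : Dv K f = Polynomial.derivative f := rfl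

lemma Du_C (f : Polynomial K) :
    Du K (Polynomial.C f) = Polynomial.C (Polynomial.derivative f) := by
  ext n : 1
  rw [Du_coeff, Polynomial.coeff_C, Polynomial.coeff_C]
  split_ifs <;> simp

lemma Du_X : Du K (Polynomial.X) = 0 := by
  ext n : 1
  rw [Du_coeff, Polynomial.coeff_X]
  split_ifs <;> simp

lemma bilin_aux (p : ℕ) [Fact p.Prime] [CharP K p] (h B S T S' T' : Polynomial (Polynomial K))
    (hB : (B.coeff 0).coeff 0 ≠ 0) (hv : h.natDegree < p) (hu : ∀ n, (h.coeff n).natDegree < p)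
    (e1 : B * Dv K (Dv K h) = S * h + T * Dv K h)
    (e2 : B * Du K (Du K h) = S' * h + T' * Du K h)
    (h00 : (h.coeff 0).coeff 0 = 0) (h01 : (h.coeff 0).coeff 1 = 0)
    (h10 : (h.coeff 1).coeff 0 = 0) (h11 : (h.coeff 1).coeff 1 = 0) : h = 0 := by
  have c0 : h.coeff 0 = 0 := by
    refine ode p _ (B.coeff 0) (S'.coeff 0) (T'.coeff 0) hB (hu 0) ?_ h00 h01
    have := congrArg (fun q => q.coeff 0) e2
    simpa [Polynomial.mul_coeff_zero, Du_coeff] using this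
  have c1 : h.coeff 1 = 0 := by
    refine ode p _ (B.coeff 0) (S'.coeff 0) (T'.coeff 0) hB (hu 1) ?_ h10 h11
    have := congrArg (fun q => q.coeff 1) e2
    simpa [Polynomial.mul_coeff_one, Du_coeff, c0] using this
  have : CharP (Polynomial K) p := inferInstance
  refine ode p h B S T ?_ hv ?_ c0 c1
  · intro hh; apply hB; rw [hh]; simp
  · simpa [Dv_apply] using e1

/-- the bilinear polynomial `t - (c0 + c1 y + c2 z + c3 y z)`. -/
noncomputable def bil (c : Fin 4 → K) : P3 K :=
  X 0 - (C (c 0) + C (c 1) * X 2 + C (c 2) * X 1 + C (c 3) * X 1 * X 2)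

lemma degreeOf_pderiv_le (i j : Fin 3) (g : P3 K) : degreeOf i (pderiv j g) ≤ degreeOf i g := by
  rw [degreeOf_le_iff]
  intro m hm
  rw [mem_support_iff, coeff_pderiv] at hm
  have : m + Finsupp.single j 1 ∈ g.support := by
    rw [mem_support_iff]; intro h; simp [h] at hm
  have := monomial_le_degreeOf i this
  simp at this; omega

lemma natDegree_aeval_le {A : Type*} [CommRing A] [Algebra K A] (w : Fin 3 → Polynomial A)
    (d : Fin 3 → ℕ) (hw : ∀ i, (w i).natDegree ≤ d i) (g : P3 K) :
    (aeval w g).natDegree ≤ degreeOf 0 g * d 0 + degreeOf 1 g * d 1 + degreeOf 2 g * d 2 := by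
  rw [aeval_def, eval₂_eq']
  refine Polynomial.natDegree_sum_le_of_forall_le _ _ fun m hm => ?_
  refine (Polynomial.natDegree_mul_le).trans ?_
  have h1 : (algebraMap K (Polynomial A) (coeff m g)).natDegree = 0 := by
    rw [Polynomial.algebraMap_apply]; simp
  rw [h1, zero_add]
  refine (Polynomial.natDegree_prod_le _ _).trans ?_
  rw [Fin.sum_univ_three]
  have : ∀ i, ((w i)^(m i)).natDegree ≤ degreeOf i g * d i := fun i =>
    (Polynomial.natDegree_pow_le).trans (Nat.mul_le_mul (monomial_le_degreeOf i hm) (hw i))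
  exact add_le_add (add_le_add (this 0) (this 1)) (this 2)

lemma dvd_of_bil (c : Fin 4 → K) (g : P3 K)
    (h : aeval (![C (c 0) + C (c 1) * X 1 + C (c 2) * X 0 + C (c 3) * X 0 * X 1, X 0, X 1] :
      Fin 3 → MvPolynomial (Fin 2) K) g = 0) : bil c ∣ g := by
  have key : ∀ f : P3 K, Polynomial.eval (C (c 0) + C (c 1) * X 1 + C (c 2) * X 0 + C (c 3) * X 0 * X 1) (finSuccEquiv K 2 f) =
    aeval (![C (c 0) + C (c 1) * X 1 + C (c 2) * X 0 + C (c 3) * X 0 * X 1, X 0, X 1] :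
      Fin 3 → MvPolynomial (Fin 2) K) f := by
    intro f
    induction f using MvPolynomial.induction_on with
    | C a => simp [finSuccEquiv_apply]
    | add f g hf hg => simp only [map_add, Polynomial.eval_add, hf, hg]
    | mul_X f i hf =>
      simp only [map_mul, Polynomial.eval_mul, hf, aeval_X]
      congr 1
      fin_cases i
      · simp [finSuccEquiv_X_zero]
      · exact (congrArg _ (finSuccEquiv_X_succ (R := K) (n := 2) (j := 0))).trans (by simp)
      · exact (congrArg _ (finSuccEquiv_X_succ (R := K) (n := 2) (j := 1))).trans (by simp)
  rw [← key] at h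
  have := Polynomial.dvd_iff_isRoot.mpr h
  have h2 := map_dvd (finSuccEquiv K 2).symm this
  rw [AlgEquiv.symm_apply_apply] at h2
  convert h2 using 1
  rw [AlgEquiv.eq_symm_apply]
  have x1 := finSuccEquiv_X_succ (R := K) (n := 2) (j := 0)
  have x2 := finSuccEquiv_X_succ (R := K) (n := 2) (j := 1)
  have x0 := finSuccEquiv_X_zero (R := K) (n := 2)
  have xc : ∀ a, finSuccEquiv K 2 (C a) = Polynomial.C (C a) := by
    intro a; simp [finSuccEquiv_apply]
  simp only [Fin.succ_zero_eq_one, Fin.succ_one_eq_two] at x1 x2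
  simp only [bil, map_sub, map_add, map_mul, x0, x1, x2, xc]

end SP

namespace SP
open MvPolynomial
variable {K : Type*} [Field K]

lemma U_mul {f g : Polynomial (Polynomial K)} {d e : ℕ} (hf : ∀ n, (f.coeff n).natDegree ≤ d)
    (hg : ∀ n, (g.coeff n).natDegree ≤ e) : ∀ n, ((f * g).coeff n).natDegree ≤ d + e := by
  intro n
  rw [Polynomial.coeff_mul]
  exact Polynomial.natDegree_sum_le_of_forall_le _ _ fun x _ =>
    Polynomial.natDegree_mul_le.trans (add_le_add (hf _) (hg _))

lemma U_pow {f : Polynomial (Polynomial K)} {d : ℕ} (hf : ∀ n, (f.coeff n).natDegree ≤ d)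
    (k : ℕ) : ∀ n, ((f ^ k).coeff n).natDegree ≤ k * d := by
  induction k with
  | zero => intro n; rw [pow_zero, Polynomial.coeff_one]; split_ifs <;> simp
  | succ k ih => rw [pow_succ, Nat.succ_mul]; exact U_mul ih hf

lemma U_aeval (w : Fin 3 → Polynomial (Polynomial K))
    (d : Fin 3 → ℕ) (hw : ∀ i n, ((w i).coeff n).natDegree ≤ d i) (g : P3 K) (n : ℕ) :
    ((aeval w g).coeff n).natDegree
      ≤ degreeOf 0 g * d 0 + degreeOf 1 g * d 1 + degreeOf 2 g * d 2 := by
  rw [aeval_def, eval₂_eq', Polynomial.finsetSum_coeff]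
  refine Polynomial.natDegree_sum_le_of_forall_le _ _ fun m hm => ?_
  have h1 : ∀ n, ((algebraMap K (Polynomial (Polynomial K)) (coeff m g)).coeff n).natDegree ≤ 0 := by
    intro n
    rw [Polynomial.algebraMap_apply, Polynomial.coeff_C]; split_ifs <;> simp
  rw [Fin.prod_univ_three]
  have h2 := U_mul h1 (U_mul (U_mul (U_pow (hw 0) (m 0)) (U_pow (hw 1) (m 1)))
    (U_pow (hw 2) (m 2))) n
  refine h2.trans ?_
  rw [zero_add]
  exact add_le_add (add_le_add (Nat.mul_le_mul_right _ (monomial_le_degreeOf 0 hm))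
    (Nat.mul_le_mul_right _ (monomial_le_degreeOf 1 hm)))
    (Nat.mul_le_mul_right _ (monomial_le_degreeOf 2 hm))

lemma ringHom_aeval {A B : Type*} [CommRing A] [CommRing B] [Algebra K A] [Algebra K B]
    (f : A →+* B) (hf : ∀ a : K, f (algebraMap K A a) = algebraMap K B a) (w : Fin 3 → A)
    (g : P3 K) : f (aeval w g) = aeval (fun i => f (w i)) g := by
  induction g using MvPolynomial.induction_on with
  | C a => simp [hf]
  | add f g hf hg => simp only [map_add, hf, hg]
  | mul_X g i hg => simp only [map_mul, hg, aeval_X]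

/-- An irreducible surface ruled in both directions is bilinear. -/
lemma bilinear (p : ℕ) [Fact p.Prime] [CharP K p] (g : P3 K)
    (hd1 : degreeOf 0 g + degreeOf 1 g < p) (hd2 : degreeOf 0 g + degreeOf 2 g < p)
    (P : Fin 3 → K) (hg : aeval P g = 0) (hgt : aeval P (pderiv 0 g) ≠ 0)
    (h1 : g ∣ G 1 g) (h2 : g ∣ G 2 g) : ∃ c, bil c ∣ g := by
  set e : P3 K → K := fun f => aeval P f with he
  have hgt' : e (pderiv 0 g) ≠ 0 := hgt
  obtain ⟨qu, hqu⟩ : ∃ qu, e (pderiv 0 g) * qu + e (pderiv 2 g) = 0 :=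
    ⟨-e (pderiv 2 g) / e (pderiv 0 g), by field_simp; ring⟩
  obtain ⟨qv, hqv⟩ : ∃ qv, e (pderiv 0 g) * qv + e (pderiv 1 g) = 0 :=
    ⟨-e (pderiv 1 g) / e (pderiv 0 g), by field_simp; ring⟩
  obtain ⟨q3, hq3⟩ : ∃ q3, (e (pderiv 0 (pderiv 0 g)) * qu + e (pderiv 2 (pderiv 0 g))) * qv
      + e (pderiv 0 g) * q3 + (e (pderiv 0 (pderiv 1 g)) * qu + e (pderiv 2 (pderiv 1 g))) = 0 :=
    ⟨-((e (pderiv 0 (pderiv 0 g)) * qu + e (pderiv 2 (pderiv 0 g))) * qv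
      + (e (pderiv 0 (pderiv 1 g)) * qu + e (pderiv 2 (pderiv 1 g)))) / e (pderiv 0 g), by
      field_simp; ring⟩
  set w : Fin 3 → Polynomial (Polynomial K) :=
    ![Polynomial.C (Polynomial.C (P 0) + Polynomial.C qu * Polynomial.X)
      + Polynomial.C (Polynomial.C qv + Polynomial.C q3 * Polynomial.X) * Polynomial.X,
      Polynomial.C (Polynomial.C (P 1)) + Polynomial.X,
      Polynomial.C (Polynomial.C (P 2) + Polynomial.X)] with hw
  have dv0 : Dv K (w 0) = Polynomial.C (Polynomial.C qv + Polynomial.C q3 * Polynomial.X) := by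
    simp [hw, Dv_apply]
  have dv1 : Dv K (w 1) = 1 := by simp [hw, Dv_apply]
  have dv2 : Dv K (w 2) = 0 := by simp [hw, Dv_apply]
  have du0 : Du K (w 0) = Polynomial.C (Polynomial.C qu)
      + Polynomial.C (Polynomial.C q3) * Polynomial.X := by
    simp only [hw, Matrix.cons_val_zero, map_add, Derivation.leibniz, Du_C, Du_X, smul_eq_mul]
    simp
  have du1 : Du K (w 1) = 0 := by
    show Du K (Polynomial.C (Polynomial.C (P 1)) + Polynomial.X) = 0
    rw [map_add, Du_C, Du_X]; simp
  have du2 : Du K (w 2) = 1 := by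
    simp only [hw, Matrix.cons_val, Du_C]; simp
  have dvv : Dv K (Dv K (w 0)) = 0 := by rw [dv0]; simp [Dv_apply]
  have duu : Du K (Du K (w 0)) = 0 := by
    rw [du0]; simp only [map_add, Derivation.leibniz, Du_C, Du_X]; simp
  have duv : Du K (Dv K (w 0)) = Polynomial.C (Polynomial.C q3) := by
    rw [dv0, Du_C]; simp
  set ε : Polynomial (Polynomial K) →+* K :=
    (Polynomial.constantCoeff (R := K)).comp (Polynomial.constantCoeff (R := Polynomial K)) with hε
  have hεa : ∀ f : P3 K, ε (aeval w f) = e f := by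
    intro f
    rw [ringHom_aeval ε (by intro a; simp [hε, Polynomial.algebraMap_apply])]
    simp only [he]
    congr 2
    funext i
    fin_cases i <;> simp [hε, hw]
  have hεc : ∀ f, ε f = (f.coeff 0).coeff 0 := fun f => rfl
  set H := aeval w g with hH
  obtain ⟨s1, hs1⟩ := h1
  obtain ⟨s2, hs2⟩ := h2
  obtain ⟨R1, hR1⟩ := G_chain (Dv K) w g 1 (Or.inl ⟨rfl, dv1, dv2⟩) dvv
  obtain ⟨R2, hR2⟩ := G_chain (Du K) w g 2 (Or.inr ⟨rfl, du2, du1⟩) duu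
  rw [hs1, map_mul, ← hH] at hR1
  rw [hs2, map_mul, ← hH] at hR2
  have cv := chain (Dv K) w g
  have cu := chain (Du K) w g
  have hH0 : H = 0 := by
    refine bilin_aux p H ((aeval w (pderiv 0 g))^2) (aeval w s1) (-R1) (aeval w s2) (-R2)
      ?_ ?_ ?_ ?_ ?_ ?_ ?_ ?_ ?_
    · rw [← hεc, map_pow, hεa]; exact pow_ne_zero _ hgt
    · refine (natDegree_aeval_le w ![1, 1, 0] ?_ g).trans_lt (by simpa using hd1)
      intro i
      fin_cases i
      · simp only [hw]
        refine (Polynomial.natDegree_add_le _ _).trans (max_le ((Polynomial.natDegree_C _).le.trans (by simp)) ?_)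
        exact (Polynomial.natDegree_C_mul_le _ _).trans Polynomial.natDegree_X_le
      · simp only [hw]
        exact (Polynomial.natDegree_add_le _ _).trans (max_le (by simp) Polynomial.natDegree_X_le)
      · simp [hw]
    · intro n
      refine (U_aeval w ![1, 0, 1] ?_ g n).trans_lt (by simpa using hd2)
      intro i n
      have hlin : ∀ a b : K, (Polynomial.C a + Polynomial.C b * Polynomial.X).natDegree ≤ 1 := by
        intro a b; rw [add_comm]; exact Polynomial.natDegree_linear_le
      fin_cases i
      · simp only [hw, Fin.zero_eta, Matrix.cons_val_zero, Polynomial.coeff_add]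
        refine (Polynomial.natDegree_add_le _ _).trans (max_le ?_ ?_)
        · rw [Polynomial.coeff_C]; split_ifs
          · exact hlin _ _
          · simp
        · rw [Polynomial.coeff_C_mul, Polynomial.coeff_X]; split_ifs
          · rw [mul_one]; exact hlin _ _
          · simp
      · simp only [hw, Fin.mk_one, Matrix.cons_val_one, Matrix.cons_val_zero, Polynomial.coeff_add]
        refine (Polynomial.natDegree_add_le _ _).trans (max_le ?_ ?_)
        · rw [Polynomial.coeff_C]; split_ifs <;> simp
        · rw [Polynomial.coeff_X]; split_ifs <;> simp
      · simp only [hw, Fin.reduceFinMk, Matrix.cons_val, Polynomial.coeff_C]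
        split_ifs
        · simpa using hlin (P 2) 1
        · simp
    · linear_combination -hR1
    · linear_combination -hR2
    · rw [← hεc, hεa]; exact hg
    · have : ε (Du K H) = (H.coeff 0).coeff 1 := by
        rw [hεc, Du_coeff, Polynomial.coeff_derivative]; simp
      rw [← this, cu, du0, du1, du2]
      simp only [map_add, map_mul, hεa, mul_zero, map_zero, map_one, mul_one]
      simp [hε]
      linear_combination hqu
    · have : ε (Dv K H) = (H.coeff 1).coeff 0 := by
        rw [hεc, Dv_apply, Polynomial.coeff_derivative]; simp
      rw [← this, cv, dv0, dv1, dv2]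
      simp only [map_add, map_mul, hεa, mul_zero, map_zero, map_one, mul_one]
      simp [hε]
      linear_combination hqv
    · have : ε (Du K (Dv K H)) = (H.coeff 1).coeff 1 := by
        rw [hεc, Du_coeff, Dv_apply, Polynomial.coeff_derivative, Polynomial.coeff_derivative]
        simp
      rw [← this, cv, dv1, dv2]
      simp only [map_add, mul_zero, add_zero, mul_one, Derivation.leibniz, duv, chain (Du K) w,
        du1, du2, smul_eq_mul, map_mul, hεa]
      rw [dv0, du0]
      simp [hε]
      linear_combination hq3
  set ψ : Polynomial (Polynomial K) →+* MvPolynomial (Fin 2) K :=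
    Polynomial.eval₂RingHom (Polynomial.eval₂RingHom C (X 1 - C (P 2))) (X 0 - C (P 1)) with hψ
  have hfin := congrArg ψ hH0
  rw [hH, ringHom_aeval ψ (by intro a; simp [hψ, Polynomial.algebraMap_apply]), map_zero] at hfin
  refine ⟨![P 0 - qu * P 2 - qv * P 1 + q3 * P 2 * P 1, qu - q3 * P 1, qv - q3 * P 2, q3], ?_⟩
  apply dvd_of_bil
  rw [← hfin]
  congr 2
  funext i
  fin_cases i
  · simp [hψ, hw]; ring
  · simp [hψ, hw]
  · simp [hψ, hw]


end SP

namespace SP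
open MvPolynomial
variable {K : Type*} [Field K]

lemma aeval_cons {A : Type*} [CommRing A] [Algebra K A] {n : ℕ} (a : A) (b : Fin n → A)
    (f : MvPolynomial (Fin (n+1)) K) :
    aeval (Fin.cons a b : Fin (n+1) → A) f
      = Polynomial.eval₂ (aeval b : MvPolynomial (Fin n) K →ₐ[K] A).toRingHom a
        (MvPolynomial.finSuccEquiv K n f) := by
  induction f using MvPolynomial.induction_on with
  | C a => simp [MvPolynomial.finSuccEquiv_apply]
  | add f g hf hg => simp only [map_add, Polynomial.eval₂_add, hf, hg]
  | mul_X f i hf =>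
    simp only [map_mul, Polynomial.eval₂_mul, hf, aeval_X]
    congr 1
    refine Fin.cases ?_ (fun j => ?_) i
    · simp [MvPolynomial.finSuccEquiv_X_zero]
    · rw [MvPolynomial.finSuccEquiv_X_succ]; simp

lemma root_count (r : MvPolynomial (Fin 2) K) (hr : r ≠ 0) (S : Finset K)
    (h : ∀ ζ ∈ S, aeval (![Polynomial.C ζ, Polynomial.X] : Fin 2 → Polynomial K) r = 0) :
    S.card ≤ degreeOf 0 r := by
  set φ : MvPolynomial (Fin 1) K →ₐ[K] Polynomial K := aeval (fun _ => Polynomial.X) with hφ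
  have hinj : Function.Injective φ := by
    have : φ = (MvPolynomial.uniqueAlgEquiv K (Fin 1)).toAlgHom := by
      ext i; simp [hφ]
    rw [this]; exact (MvPolynomial.uniqueAlgEquiv K (Fin 1)).injective
  set q := (MvPolynomial.finSuccEquiv K 1 r).map φ.toRingHom with hq
  have hq0 : q ≠ 0 := by
    rw [hq, Polynomial.map_ne_zero_iff hinj]
    exact (map_ne_zero_iff _ (MvPolynomial.finSuccEquiv K 1).injective).2 hr
  have hdeg : q.natDegree ≤ degreeOf 0 r := by
    rw [← natDegree_finSuccEquiv]; exact Polynomial.natDegree_map_le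
  refine le_trans ?_ hdeg
  classical
  rw [← Finset.card_image_of_injective S (Polynomial.C_injective (R := K))]
  apply Polynomial.card_le_degree_of_subset_roots
  intro x hx
  rw [Finset.mem_val, Finset.mem_image] at hx
  obtain ⟨ζ, hζ, rfl⟩ := hx
  rw [Polynomial.mem_roots hq0, Polynomial.IsRoot, hq, Polynomial.eval_map]
  have := h ζ hζ
  have e : (![Polynomial.C ζ, Polynomial.X] : Fin 2 → Polynomial K)
    = Fin.cons (Polynomial.C ζ) (fun _ => Polynomial.X) := by
    funext i; fin_cases i <;> rfl
  rw [e, aeval_cons] at this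
  exact this

lemma pm_cons (m : K × K × K) : pm m = Fin.cons
    (Polynomial.C m.2.1 * Polynomial.X + Polynomial.C m.2.2) ![Polynomial.C m.1, Polynomial.X] := by
  funext i; fin_cases i <;> rfl

lemma resultant_deg (f g : Polynomial (MvPolynomial (Fin 2) K)) (d m n : ℕ)
    (hf : ∀ i, degreeOf 0 (f.coeff i) ≤ d) (hg : ∀ i, degreeOf 0 (g.coeff i) ≤ d) :
    degreeOf 0 (f.resultant g m n) ≤ (m + n) * d := by
  have hent : ∀ i j, degreeOf 0 (f.sylvester g m n i j) ≤ d := by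
    intro i j
    rw [Polynomial.sylvester, Matrix.of_apply]
    refine j.addCases (fun j => ?_) (fun j => ?_)
    · rw [Fin.addCases_left]; split_ifs
      · exact hg _
      · simp
    · rw [Fin.addCases_right]; split_ifs
      · exact hf _
      · simp
  rw [Polynomial.resultant, Matrix.det_apply]
  refine (degreeOf_sum_le _ _ _).trans (Finset.sup_le fun σ _ => ?_)
  have : degreeOf 0 (∏ i, f.sylvester g m n (σ i) i) ≤ (m + n) * d := by
    refine (degreeOf_prod_le _ _ _).trans ((Finset.sum_le_card_nsmul _ _ d fun i _ => hent _ _).trans ?_)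
    simp
  rcases Int.units_eq_one_or (Equiv.Perm.sign σ) with h | h
  · rw [h, one_smul]; exact this
  · rw [h]; simpa [degreeOf_neg] using this

lemma bezout (g h : P3 K) (hirr : Irreducible g) (hdvd : ¬ g ∣ h) (h0 : degreeOf 0 g ≠ 0)
    (W : Finset (K × K × K)) (hW : Set.InjOn Prod.fst (W : Set (K × K × K)))
    (hWg : ∀ m ∈ W, aeval (pm m) g = 0) (hWh : ∀ m ∈ W, aeval (pm m) h = 0) :
    W.card ≤ (degreeOf 0 g + degreeOf 0 h) * max (degreeOf 1 g) (degreeOf 1 h) := by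
  set g' := MvPolynomial.finSuccEquiv K 2 g with hg'
  set h' := MvPolynomial.finSuccEquiv K 2 h with hh'
  have i1 : Irreducible g' := (MulEquiv.irreducible_iff (MvPolynomial.finSuccEquiv K 2)).2 hirr
  have n1 : g'.natDegree ≠ 0 := by rw [hg', natDegree_finSuccEquiv]; exact h0
  have pr : g'.IsPrimitive := i1.isPrimitive n1
  have nd : ¬ g' ∣ h' := fun hh => hdvd (by
    have := map_dvd (MvPolynomial.finSuccEquiv K 2).symm hh
    simpa [hg', hh'] using this)
  set F := FractionRing (MvPolynomial (Fin 2) K) with hF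
  have i2 := (pr.irreducible_iff_irreducible_map_fraction_map (K := F)).1 i1
  have nd2 := fun hh => nd ((pr.dvd_iff_fraction_map_dvd_fraction_map F (q := h')).2 hh)
  have cop : IsCoprime (g'.map (algebraMap _ F)) (h'.map (algebraMap _ F)) :=
    (i2.coprime_iff_not_dvd).2 nd2
  have inj : Function.Injective (algebraMap (MvPolynomial (Fin 2) K) F) :=
    IsFractionRing.injective _ _
  have r0 : g'.resultant h' ≠ 0 := by
    intro h0
    have := congrArg (algebraMap _ F) h0
    rw [← Polynomial.resultant_map_map, map_zero,
      ← Polynomial.natDegree_map_eq_of_injective inj g',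
      ← Polynomial.natDegree_map_eq_of_injective inj h',
      Polynomial.resultant_eq_zero_iff] at this
    exact this.2 cop
  obtain ⟨u, v, -, -, huv⟩ := Polynomial.exists_mul_add_mul_eq_C_resultant g' h' le_rfl le_rfl
    (Or.inl n1)
  have hd := resultant_deg g' h' (max (degreeOf 1 g) (degreeOf 1 h)) g'.natDegree h'.natDegree
    (fun i => (degreeOf_coeff_finSuccEquiv g 0 i).trans (le_max_left _ _))
    (fun i => (degreeOf_coeff_finSuccEquiv h 0 i).trans (le_max_right _ _))
  have dg : g'.natDegree = degreeOf 0 g := by rw [hg', natDegree_finSuccEquiv]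
  have dh : h'.natDegree = degreeOf 0 h := by rw [hh', natDegree_finSuccEquiv]
  rw [← dg, ← dh]
  refine le_trans ?_ hd
  classical
  rw [← Finset.card_image_of_injOn hW]
  apply root_count _ r0
  intro ζ hζ
  obtain ⟨m, hm, rfl⟩ := Finset.mem_image.1 hζ
  have e1 := hWg m hm
  have e2 := hWh m hm
  rw [pm_cons, aeval_cons] at e1 e2
  have := congrArg (Polynomial.eval₂ (aeval (![Polynomial.C m.1, Polynomial.X] : Fin 2 → Polynomial K) : MvPolynomial (Fin 2) K →ₐ[K] Polynomial K).toRingHom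
    (Polynomial.C m.2.1 * Polynomial.X + Polynomial.C m.2.2)) huv
  rw [Polynomial.eval₂_add, Polynomial.eval₂_mul, Polynomial.eval₂_mul, e1, e2, Polynomial.eval₂_C] at this
  simpa using this.symm

lemma bezout0 (g : P3 K) (hg : g ≠ 0) (h0 : degreeOf 0 g = 0)
    (W : Finset (K × K × K)) (hW : Set.InjOn Prod.fst (W : Set (K × K × K)))
    (hWg : ∀ m ∈ W, aeval (pm m) g = 0) : W.card ≤ degreeOf 1 g := by
  set g' := MvPolynomial.finSuccEquiv K 2 g with hg'
  have hc : g' = Polynomial.C (g'.coeff 0) :=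
    Polynomial.eq_C_of_natDegree_eq_zero (by rw [hg', natDegree_finSuccEquiv, h0])
  refine le_trans ?_ (degreeOf_coeff_finSuccEquiv g 0 0)
  classical
  rw [← Finset.card_image_of_injOn hW]
  apply root_count
  · intro hh
    rw [hh, map_zero] at hc
    exact hg ((map_eq_zero_iff _ (MvPolynomial.finSuccEquiv K 2).injective).1 hc)
  intro ζ hζ
  obtain ⟨m, hm, rfl⟩ := Finset.mem_image.1 hζ
  have e1 := hWg m hm
  rw [pm_cons, aeval_cons, ← hg', hc, Polynomial.eval₂_C] at e1
  exact e1

end SP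

namespace SP
open MvPolynomial
variable {K : Type*} [Field K]

lemma exist_poly (L : Finset (K × K × K)) (D : ℕ) (h : L.card * (2 * D + 1) < (D + 1)^3) :
    ∃ f : P3 K, f ≠ 0 ∧ (∀ i, degreeOf i f ≤ D) ∧ ∀ l ∈ L, aeval (pl l) f = 0 := by
  classical
  set ex : (Fin 3 → Fin (D+1)) → (Fin 3 →₀ ℕ) := fun m =>
    Finsupp.equivFunOnFinite.symm (fun i => (m i : ℕ)) with hex
  have hexi : Function.Injective ex := by
    intro a b hab
    funext i
    have := DFunLike.congr_fun hab i
    simp [hex] at this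
    exact Fin.ext this
  set Φ : ((Fin 3 → Fin (D+1)) → K) →ₗ[K] P3 K :=
    Fintype.linearCombination K (fun m => monomial (ex m) (1 : K)) with hΦ
  have hΦc : ∀ c m, coeff (ex m) (Φ c) = c m := by
    intro c m
    rw [hΦ, Fintype.linearCombination_apply, coeff_sum]
    rw [Finset.sum_eq_single m]
    · simp
    · intro b _ hb
      rw [coeff_smul, coeff_monomial, if_neg (fun h => hb (hexi h))]; simp
    · simp
  have hdeg : ∀ c i, degreeOf i (Φ c) ≤ D := by
    intro c i
    rw [hΦ, Fintype.linearCombination_apply]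
    refine (degreeOf_sum_le _ _ _).trans (Finset.sup_le fun m _ => ?_)
    rw [degreeOf_le_iff]
    intro s hs
    rw [mem_support_iff, coeff_smul, coeff_monomial] at hs
    have : ex m = s := by
      by_contra hne; simp [hne] at hs
    rw [← this]
    simp only [hex, Finsupp.equivFunOnFinite_symm_apply_apply]
    have := (m i).2; omega
  set Ψ : P3 K →ₗ[K] (L × Fin (2*D+1) → K) :=
    LinearMap.pi fun x => (Polynomial.lcoeff K (x.2 : ℕ)).comp (aeval (pl (x.1 : K × K × K))).toLinearMap with hΨ
  have hk : LinearMap.ker (Ψ.comp Φ) ≠ ⊥ := by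
    apply LinearMap.ker_ne_bot_of_finrank_lt
    rw [Module.finrank_fintype_fun_eq_card, Module.finrank_fintype_fun_eq_card]
    simpa using h
  obtain ⟨c, hc, hc0⟩ := (Submodule.ne_bot_iff _).1 hk
  refine ⟨Φ c, ?_, hdeg c, ?_⟩
  · intro h0
    apply hc0
    funext m
    have := hΦc c m
    rw [h0] at this; simpa using this.symm
  · intro l hl
    ext k
    by_cases hk : k < 2 * D + 1
    · have := congrFun (LinearMap.mem_ker.1 hc) (⟨l, hl⟩, ⟨k, hk⟩)
      simpa [hΨ] using this
    · rw [Polynomial.coeff_zero]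
      apply Polynomial.coeff_eq_zero_of_natDegree_lt
      refine (natDegree_aeval_le (pl l) ![1, 1, 0] ?_ _).trans_lt ?_
      · intro i
        fin_cases i
        · simp only [pl]; exact Polynomial.natDegree_linear_le
        · simp [pl]
        · simp [pl]
      · have h0 := hdeg c 0
        have h1 := hdeg c 1
        simp; omega

end SP

namespace SP
open MvPolynomial
variable {K : Type*} [Field K]

lemma factors (f : P3 K) (hf : f ≠ 0) : ∃ S : Finset (P3 K), (∀ g ∈ S, Irreducible g) ∧
    (∀ g ∈ S, ∀ g' ∈ S, Associated g g' → g = g') ∧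
    (∀ i, ∑ g ∈ S, degreeOf i g ≤ degreeOf i f) ∧
    ∀ w : Fin 3 → Polynomial K, aeval w f = 0 → ∃ g ∈ S, aeval w g = 0 := by
  classical
  let _ : StrongNormalizationMonoid (P3 K) := UniqueFactorizationMonoid.strongNormalizationMonoid
  set M := UniqueFactorizationMonoid.normalizedFactors f with hM
  have hirr : ∀ g ∈ M, Irreducible g := UniqueFactorizationMonoid.irreducible_of_normalized_factor
  have hass : Associated M.prod f := UniqueFactorizationMonoid.prod_normalizedFactors hf
  refine ⟨M.toFinset, fun g hg => hirr g (Multiset.mem_toFinset.1 hg), ?_, ?_, ?_⟩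
  · intro g hg g' hg' h
    have e1 := UniqueFactorizationMonoid.normalize_normalized_factor g (Multiset.mem_toFinset.1 hg)
    have e2 := UniqueFactorizationMonoid.normalize_normalized_factor g' (Multiset.mem_toFinset.1 hg')
    rw [← e1, ← e2]
    exact normalize_eq_normalize h.dvd h.symm.dvd
  · intro i
    have hd : ∏ g ∈ M.toFinset, g ∣ f := by
      refine dvd_trans ?_ hass.dvd
      have : ∏ g ∈ M.toFinset, g = M.dedup.prod := by
        rw [Finset.prod_eq_multiset_prod]; simp
      rw [this]
      exact Multiset.prod_dvd_prod_of_le (Multiset.dedup_le M)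
    obtain ⟨u, hu⟩ := hd
    have h1 : ∏ g ∈ M.toFinset, g ≠ 0 := by rintro h; rw [h, zero_mul] at hu; exact hf hu
    have h2 : u ≠ 0 := by rintro h; rw [h, mul_zero] at hu; exact hf hu
    rw [hu, degreeOf_mul_eq h1 h2, degreeOf_prod_eq]
    · omega
    · intro g hg; exact (hirr g (Multiset.mem_toFinset.1 hg)).ne_zero
  · intro w hw
    have h0 : aeval w M.prod = 0 := by
      have := hass.map (aeval w : P3 K →ₐ[K] Polynomial K)
      rw [hw] at this; simpa using this
    rw [map_multiset_prod, Multiset.prod_eq_zero_iff, Multiset.mem_map] at h0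
    obtain ⟨g, hg, h⟩ := h0
    exact ⟨g, Multiset.mem_toFinset.2 hg, h⟩

def inc (l m : K × K × K) : Prop := l.2.1 * m.1 + l.2.2 = m.2.1 * l.1 + m.2.2

lemma eval_aeval (β : K) (w : Fin 3 → Polynomial K) (f : P3 K) :
    Polynomial.eval β (aeval w f) = aeval (fun i => Polynomial.eval β (w i)) f :=
  ringHom_aeval (Polynomial.evalRingHom β) (by intro a; simp [Polynomial.algebraMap_apply]) w f

lemma not_contained (f : P3 K) (m : K × K × K) (hm : aeval (pm m) f ≠ 0) (L : Finset (K × K × K))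
    (hL : Set.InjOn Prod.fst (L : Set (K × K × K))) (hLf : ∀ l ∈ L, aeval (pl l) f = 0)
    (hinc : ∀ l ∈ L, inc l m) : L.card ≤ degreeOf 0 f + degreeOf 2 f := by
  classical
  rw [← Finset.card_image_of_injOn hL]
  refine (Polynomial.card_le_degree_of_subset_roots (p := aeval (pm m) f) ?_).trans ?_
  · intro x hx
    rw [Finset.mem_val, Finset.mem_image] at hx
    obtain ⟨l, hl, rfl⟩ := hx
    rw [Polynomial.mem_roots hm, Polynomial.IsRoot, eval_aeval]
    have h1 := congrArg (Polynomial.eval m.1) (hLf l hl)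
    rw [eval_aeval, Polynomial.eval_zero] at h1
    rw [← h1]
    congr 2
    funext i
    have := hinc l hl
    unfold inc at this
    fin_cases i
    · simp [pm, pl, this]
    · simp [pm, pl]
    · simp [pm, pl]
  · refine (natDegree_aeval_le (pm m) ![1, 0, 1] ?_ f).trans (by simp)
    intro i
    fin_cases i
    · simp only [pm]; exact Polynomial.natDegree_linear_le
    · simp [pm]
    · simp [pm]

lemma degreeOf_G (i j : Fin 3) (g : P3 K) : degreeOf i (G j g) ≤ 3 * degreeOf i g := by
  have d1 : ∀ j, degreeOf i (pderiv j g) ≤ degreeOf i g := fun j => degreeOf_pderiv_le i j g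
  have d2 : ∀ j k, degreeOf i (pderiv k (pderiv j g)) ≤ degreeOf i g := fun j k =>
    (degreeOf_pderiv_le i k _).trans (d1 j)
  have c2 : degreeOf i (2 : P3 K) = 0 := by
    have : (2 : P3 K) = C 2 := (map_ofNat (C : K →+* P3 K) 2).symm
    rw [this, degreeOf_C]
  unfold G
  refine (degreeOf_add_le _ _ _).trans (max_le ((degreeOf_sub_le _ _ _).trans (max_le ?_ ?_)) ?_)
  · have := degreeOf_mul_le i (pderiv j (pderiv j g)) ((pderiv 0 g)^2)
    have := degreeOf_pow_le i (pderiv 0 g) 2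
    have := d1 0; have := d2 j j; omega
  · have := degreeOf_mul_le i (2 * pderiv j g * pderiv 0 g) (pderiv 0 (pderiv j g))
    have := degreeOf_mul_le i (2 * pderiv j g) (pderiv 0 g)
    have := degreeOf_mul_le i 2 (pderiv j g)
    have := d1 0; have := d1 j; have := d2 j 0; omega
  · have := degreeOf_mul_le i ((pderiv j g)^2) (pderiv 0 (pderiv 0 g))
    have := degreeOf_pow_le i (pderiv j g) 2
    have := d1 j; have := d2 0 0; omega

lemma not_dvd_pderiv (p : ℕ) [CharP K p] (g : P3 K) (h0 : degreeOf 0 g ≠ 0)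
    (hp : degreeOf 0 g < p) : ¬ g ∣ pderiv 0 g := by
  have hne : pderiv 0 g ≠ 0 := by
    obtain ⟨s, hs, hs0⟩ : ∃ s ∈ g.support, s 0 = degreeOf 0 g := by
      have hg : g.support.Nonempty := by
        rw [Finset.nonempty_iff_ne_empty, Ne, support_eq_empty]; rintro rfl; simp at h0
      obtain ⟨s, hs, h⟩ := Finset.exists_mem_eq_sup g.support hg (fun m => m 0)
      exact ⟨s, hs, by rw [degreeOf_eq_sup, h]⟩
    intro hz
    have hc := congrArg (coeff (s - Finsupp.single 0 1)) hz
    have hle : Finsupp.single 0 1 ≤ s := by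
      rw [Finsupp.single_le_iff]; omega
    rw [coeff_pderiv, tsub_add_cancel_of_le hle, coeff_zero, mul_eq_zero] at hc
    rcases hc with hc | hc
    · exact (mem_support_iff.1 hs) hc
    · have : ((s 0 : ℕ) : K) = 0 := by
        have e : s 0 = (s - Finsupp.single 0 1 : Fin 3 →₀ ℕ) 0 + 1 := by
          rw [Finsupp.tsub_apply]; simp; omega
        rw [e]; push_cast; exact hc
      rw [CharP.cast_eq_zero_iff K p] at this
      exact absurd (Nat.le_of_dvd (by omega) this) (by omega)
  rintro ⟨u, hu⟩
  have hu0 : u ≠ 0 := by rintro rfl; simp at hu; exact hne hu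
  have hg0 : g ≠ 0 := by rintro rfl; simp at h0
  have h1 : degreeOf 0 g ≤ degreeOf 0 (pderiv 0 g) := by
    rw [hu, degreeOf_mul_eq hg0 hu0]; omega
  have h2 : degreeOf 0 (pderiv 0 g) ≤ degreeOf 0 g - 1 := by
    rw [degreeOf_le_iff]
    intro m hm
    rw [mem_support_iff, coeff_pderiv] at hm
    have : m + Finsupp.single 0 1 ∈ g.support := by
      rw [mem_support_iff]; intro h; simp [h] at hm
    have := monomial_le_degreeOf 0 this
    simp at this; omega
  omega

lemma bil_assoc (c : Fin 4 → K) (g : P3 K) (hg : Irreducible g) (h : bil c ∣ g) :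
    Associated (bil c) g := by
  obtain ⟨u, hu⟩ := h
  rcases hg.isUnit_or_isUnit hu with h | h
  · exfalso
    have := h.map (aeval (![c 0, 0, 0] : Fin 3 → K))
    simp [bil] at this
  · rw [hu]; exact (associated_mul_unit_right _ _ h)

lemma aeval_assoc {A : Type*} [CommRing A] [IsDomain A] [Algebra K A] (w : Fin 3 → A) (f g : P3 K)
    (h : Associated f g) : aeval w f = 0 ↔ aeval w g = 0 := by
  exact (h.map (aeval w : P3 K →ₐ[K] A)).eq_zero_iff

lemma bil_pm (c : Fin 4 → K) (m : K × K × K) (h : aeval (pm m) (bil c) = 0) :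
    m.2.1 = c 1 + c 3 * m.1 ∧ m.2.2 = c 0 + c 2 * m.1 := by
  simp [bil, pm, Polynomial.algebraMap_apply] at h
  have h0 := congrArg (fun q => q.coeff 0) h
  have h1 := congrArg (fun q => q.coeff 1) h
  simp [Polynomial.coeff_X, Polynomial.coeff_C, mul_assoc] at h0 h1
  constructor
  · linear_combination h1
  · linear_combination h0

lemma bil_pl (c : Fin 4 → K) (l : K × K × K) (h : aeval (pl l) (bil c) = 0) :
    l.2.1 = c 2 + c 3 * l.1 ∧ l.2.2 = c 0 + c 1 * l.1 := by
  simp [bil, pl, Polynomial.algebraMap_apply] at h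
  have h0 := congrArg (fun q => q.coeff 0) h
  have h1 := congrArg (fun q => q.coeff 1) h
  simp [Polynomial.coeff_X, Polynomial.coeff_C, mul_assoc] at h0 h1
  constructor
  · linear_combination h1
  · linear_combination h0

lemma bil_inc (c : Fin 4 → K) (l m : K × K × K) (hl : aeval (pl l) (bil c) = 0)
    (hm : aeval (pm m) (bil c) = 0) : inc l m := by
  obtain ⟨h1, h2⟩ := bil_pm c m hm
  obtain ⟨h3, h4⟩ := bil_pl c l hl
  unfold inc; rw [h1, h2, h3, h4]; ring

lemma bil_unique (c c' : Fin 4 → K) (m m' : K × K × K) (hne : m.1 ≠ m'.1)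
    (h1 : aeval (pm m) (bil c) = 0) (h2 : aeval (pm m') (bil c) = 0)
    (h3 : aeval (pm m) (bil c') = 0) (h4 : aeval (pm m') (bil c') = 0) : c = c' := by
  obtain ⟨a1, b1⟩ := bil_pm _ _ h1
  obtain ⟨a2, b2⟩ := bil_pm _ _ h2
  obtain ⟨a3, b3⟩ := bil_pm _ _ h3
  obtain ⟨a4, b4⟩ := bil_pm _ _ h4
  have e : m.1 - m'.1 ≠ 0 := sub_ne_zero.2 hne
  have c3 : c 3 = c' 3 := by
    apply mul_left_cancel₀ e; linear_combination -a1 + a2 + a3 - a4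
  have c2 : c 2 = c' 2 := by
    apply mul_left_cancel₀ e; linear_combination -b1 + b2 + b3 - b4
  have c1 : c 1 = c' 1 := by linear_combination -a1 + a3 - m.1 * c3
  have c0 : c 0 = c' 0 := by linear_combination -b1 + b3 - m.1 * c2
  funext i
  fin_cases i <;> assumption

end SP

namespace SP
open MvPolynomial
variable {K : Type*} [Field K]

open Classical in
lemma per_factor (p : ℕ) [Fact p.Prime] [CharP K p] [Infinite K] (L W : Finset (K × K × K)) (k : ℕ)
    (hL : Set.InjOn Prod.fst (L : Set (K × K × K)))
    (hW : Set.InjOn Prod.fst (W : Set (K × K × K)))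
    (hk : ∀ m1 ∈ W, ∀ m2 ∈ W, m1 ≠ m2 → #{l ∈ L | inc l m1 ∧ inc l m2} ≤ k)
    (g : P3 K) (hg : Irreducible g) (hd1 : degreeOf 0 g + degreeOf 1 g < p)
    (hd2 : degreeOf 0 g + degreeOf 2 g < p) :
    ∃ Bad : Finset (K × K × K), Bad ⊆ W ∧
      Bad.card ≤ 12 * (degreeOf 0 g * degreeOf 1 g) + degreeOf 1 g + degreeOf 0 g ∧
      ∀ m ∈ W, m ∉ Bad → #{l ∈ L | aeval (pl l) g = 0 ∧ inc l m} ≤ 3 * (degreeOf 0 g + degreeOf 2 g)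
        ∨ ((degreeOf 0 g ≠ 0 ∧ ∃ c, bil c ∣ g) ∧ aeval (pm m) g = 0 ∧ #{l ∈ L | aeval (pl l) g = 0} ≤ k) := by
  set Wg := W.filter (fun m => aeval (pm m) g = 0) with hWg
  have hWgW : Wg ⊆ W := Finset.filter_subset _ _
  have hWgi : ∀ V ⊆ Wg, Set.InjOn Prod.fst (V : Set (K × K × K)) := fun V hV =>
    hW.mono (fun x hx => hWgW (hV hx))
  have hVg : ∀ V ⊆ Wg, ∀ m ∈ V, aeval (pm m) g = 0 := fun V hV m hm =>
    (Finset.mem_filter.1 (hV hm)).2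
  have sub : ∀ V ⊆ L, Set.InjOn Prod.fst (V : Set (K × K × K)) :=
    fun V hV => hL.mono (fun x hx => hV hx)
  have caseA : ∀ m ∈ W, m ∉ Wg → #{l ∈ L | aeval (pl l) g = 0 ∧ inc l m} ≤
      3 * (degreeOf 0 g + degreeOf 2 g) := by
    intro m hm hmg
    have : aeval (pm m) g ≠ 0 := fun h => hmg (Finset.mem_filter.2 ⟨hm, h⟩)
    refine (not_contained g m this _ (sub _ (Finset.filter_subset _ _)) ?_ ?_).trans (by omega)
    · intro l hl; exact (Finset.mem_filter.1 hl).2.1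
    · intro l hl; exact (Finset.mem_filter.1 hl).2.2
  by_cases h0 : degreeOf 0 g = 0
  · refine ⟨Wg, hWgW, ?_, fun m hm hmg => Or.inl (caseA m hm hmg)⟩
    have := bezout0 g hg.ne_zero h0 Wg (hWgi _ subset_rfl) (hVg _ subset_rfl)
    omega
  have bz : ∀ h : P3 K, ¬ g ∣ h → degreeOf 0 h ≤ 3 * degreeOf 0 g → degreeOf 1 h ≤ 3 * degreeOf 1 g →
      ∀ V ⊆ Wg, (∀ m ∈ V, aeval (pm m) h = 0) →
      V.card ≤ 12 * (degreeOf 0 g * degreeOf 1 g) + degreeOf 1 g + degreeOf 0 g := by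
    intro h hd e0 e1 V hV hVh
    have := bezout g h hg hd h0 V (hWgi V hV) (hVg V hV) hVh
    have h3 : max (degreeOf 1 g) (degreeOf 1 h) ≤ 3 * degreeOf 1 g := max_le (by omega) e1
    have h4 : degreeOf 0 g + degreeOf 0 h ≤ 4 * degreeOf 0 g := by omega
    have := this.trans (Nat.mul_le_mul h4 h3)
    nlinarith
  by_cases g2 : g ∣ G 2 g
  swap
  · refine ⟨Wg, hWgW, bz _ g2 (degreeOf_G _ _ _) (degreeOf_G _ _ _) Wg subset_rfl ?_,
      fun m hm hmg => Or.inl (caseA m hm hmg)⟩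
    intro m hm
    exact G2_line g m (hVg _ subset_rfl m hm)
  by_cases g1 : g ∣ G 1 g
  swap
  · refine ⟨Wg.filter (fun m => aeval (pm m) (G 1 g) = 0), (Finset.filter_subset _ _).trans hWgW,
      bz _ g1 (degreeOf_G _ _ _) (degreeOf_G _ _ _) _ (Finset.filter_subset _ _) ?_, ?_⟩
    · intro m hm
      exact (Finset.mem_filter.1 hm).2
    · intro m hm hmb
      left
      by_cases hmg : m ∈ Wg
      · have : aeval (pm m) (G 1 g) ≠ 0 := fun h => hmb (Finset.mem_filter.2 ⟨hmg, h⟩)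
        refine (not_contained (G 1 g) m this _ (sub _ (Finset.filter_subset _ _)) ?_ ?_).trans ?_
        · intro l hl; exact G1_line g l (Finset.mem_filter.1 hl).2.1
        · intro l hl; exact (Finset.mem_filter.1 hl).2.2
        · have := degreeOf_G 0 1 g
          have := degreeOf_G 2 1 g
          omega
      · exact caseA m hm hmg
  by_cases hb : ∃ c, bil c ∣ g
  · by_cases hr : #{l ∈ L | aeval (pl l) g = 0} ≤ k
    · refine ⟨∅, by simp, by simp, fun m hm _ => ?_⟩
      by_cases hmg : m ∈ Wg
      · exact Or.inr ⟨⟨h0, hb⟩, hVg _ subset_rfl m hmg, hr⟩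
      · exact Or.inl (caseA m hm hmg)
    · refine ⟨Wg, hWgW, ?_, fun m hm hmg => Or.inl (caseA m hm hmg)⟩
      have : Wg.card ≤ 1 := by
        rw [Finset.card_le_one]
        intro m1 hm1 m2 hm2
        by_contra hne
        apply hr
        refine le_trans (Finset.card_le_card ?_) (hk m1 (hWgW hm1) m2 (hWgW hm2) hne)
        intro l hl
        rw [Finset.mem_filter] at hl ⊢
        obtain ⟨c, hc⟩ := hb
        have ha := bil_assoc c g hg hc
        have hl' := (aeval_assoc (pl l) _ _ ha).2 hl.2
        exact ⟨hl.1, bil_inc c l m1 hl' ((aeval_assoc _ _ _ ha).2 (hVg _ subset_rfl m1 hm1)),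
          bil_inc c l m2 hl' ((aeval_assoc _ _ _ ha).2 (hVg _ subset_rfl m2 hm2))⟩
      omega
  · refine ⟨Wg.filter (fun m => aeval (pm m) (pderiv 0 g) = 0), (Finset.filter_subset _ _).trans hWgW,
      bz _ (not_dvd_pderiv p g h0 (by omega)) ((degreeOf_pderiv_le _ _ _).trans (by omega))
        ((degreeOf_pderiv_le _ _ _).trans (by omega)) _ (Finset.filter_subset _ _) ?_, ?_⟩
    · intro m hm
      exact (Finset.mem_filter.1 hm).2
    · intro m hm hmb
      by_cases hmg : m ∈ Wg
      · exfalso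
        apply hb
        have hne : aeval (pm m) (pderiv 0 g) ≠ 0 := fun h => hmb (Finset.mem_filter.2 ⟨hmg, h⟩)
        obtain ⟨y, hy⟩ : ∃ y, Polynomial.eval y (aeval (pm m) (pderiv 0 g)) ≠ 0 := by
          by_contra hcon
          push Not at hcon
          exact hne (Polynomial.funext fun y => by rw [hcon y]; simp)
        rw [eval_aeval] at hy
        refine bilinear p g hd1 hd2 _ ?_ hy g1 g2
        rw [← eval_aeval, hVg _ subset_rfl m hmg]; simp
      · exact Or.inl (caseA m hm hmg)

end SP

namespace SP
open MvPolynomial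
variable {K : Type*} [Field K]

open Classical in
lemma core (p : ℕ) [Fact p.Prime] [CharP K p] [Infinite K] (L W : Finset (K × K × K)) (k : ℕ)
    (hL : Set.InjOn Prod.fst (L : Set (K × K × K)))
    (hW : Set.InjOn Prod.fst (W : Set (K × K × K)))
    (hk : ∀ m1 ∈ W, ∀ m2 ∈ W, m1 ≠ m2 → #{l ∈ L | inc l m1 ∧ inc l m2} ≤ k)
    (D : ℕ) (hD : L.card * (2 * D + 1) < (D + 1)^3) (hp : 2 * D < p) :
    ∃ Bad : Finset (K × K × K), Bad ⊆ W ∧ Bad.card ≤ 15 * D^2 ∧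
      ∀ m ∈ W, m ∉ Bad → #{l ∈ L | inc l m} ≤ 6 * D + k := by
  obtain ⟨f, hf, hfd, hfL⟩ := exist_poly L D hD
  obtain ⟨S, Sirr, Sass, Sdeg, Sz⟩ := factors f hf
  have Sdeg' : ∀ i, ∑ g ∈ S, degreeOf i g ≤ D := fun i => (Sdeg i).trans (hfd i)
  have gdeg : ∀ i, ∀ g ∈ S, degreeOf i g ≤ D := fun i g hg =>
    (Finset.single_le_sum (f := fun g => degreeOf i g) (fun _ _ => Nat.zero_le _) hg).trans (Sdeg' i)
  have hper := fun g (hg : g ∈ S) => per_factor p L W k hL hW hk g (Sirr g hg)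
    (by have := gdeg 0 g hg; have := gdeg 1 g hg; omega)
    (by have := gdeg 0 g hg; have := gdeg 2 g hg; omega)
  choose! B hBW hBc hBm using hper
  set Sb := S.filter (fun g => degreeOf 0 g ≠ 0 ∧ ∃ c, bil c ∣ g) with hSb
  have hSbc : Sb.card ≤ D := by
    refine le_trans ?_ (Sdeg' 0)
    refine le_trans ?_ (Finset.sum_le_sum_of_subset (Finset.filter_subset _ _ : Sb ⊆ S))
    rw [Finset.card_eq_sum_ones]
    refine Finset.sum_le_sum fun g hg => ?_
    have := (Finset.mem_filter.1 hg).2.1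
    omega
  set Pb : P3 K × P3 K → Finset (K × K × K) := fun x =>
    W.filter (fun m => aeval (pm m) x.1 = 0 ∧ aeval (pm m) x.2 = 0) with hPb
  have hPbc : ∀ x ∈ Sb.offDiag, (Pb x).card ≤ 1 := by
    rintro ⟨g, g'⟩ hx
    rw [Finset.mem_offDiag] at hx
    obtain ⟨hg, hg', hne⟩ := hx
    obtain ⟨hgS, -, c, hc⟩ := Finset.mem_filter.1 hg
    obtain ⟨hgS', -, c', hc'⟩ := Finset.mem_filter.1 hg'
    have a1 := bil_assoc c g (Sirr g hgS) hc
    have a2 := bil_assoc c' g' (Sirr g' hgS') hc'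
    rw [Finset.card_le_one]
    intro m1 hm1 m2 hm2
    rw [hPb, Finset.mem_filter] at hm1 hm2
    by_contra hcon
    have hne1 : m1.1 ≠ m2.1 := fun h => hcon (hW hm1.1 hm2.1 h)
    have := bil_unique c c' m1 m2 hne1 ((aeval_assoc _ _ _ a1).2 hm1.2.1)
      ((aeval_assoc _ _ _ a1).2 hm2.2.1) ((aeval_assoc _ _ _ a2).2 hm1.2.2)
      ((aeval_assoc _ _ _ a2).2 hm2.2.2)
    rw [this] at a1
    exact hne (Sass g hgS g' hgS' (a1.symm.trans a2))
  refine ⟨S.biUnion B ∪ Sb.offDiag.biUnion Pb, ?_, ?_, ?_⟩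
  · apply Finset.union_subset
    · exact Finset.biUnion_subset.2 fun g hg => hBW g hg
    · exact Finset.biUnion_subset.2 fun g _ => Finset.filter_subset _ _
  · refine (Finset.card_union_le _ _).trans ?_
    have h1 : (S.biUnion B).card ≤ 12 * (D * D) + D + D := by
      refine Finset.card_biUnion_le.trans ((Finset.sum_le_sum hBc).trans ?_)
      rw [Finset.sum_add_distrib, Finset.sum_add_distrib, ← Finset.mul_sum]
      have : ∑ g ∈ S, degreeOf 0 g * degreeOf 1 g ≤ D * D := by
        calc ∑ g ∈ S, degreeOf 0 g * degreeOf 1 g ≤ ∑ g ∈ S, degreeOf 0 g * D :=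
              Finset.sum_le_sum fun g hg => Nat.mul_le_mul_left _ (gdeg 1 g hg)
          _ = (∑ g ∈ S, degreeOf 0 g) * D := by rw [Finset.sum_mul]
          _ ≤ D * D := Nat.mul_le_mul_right _ (Sdeg' 0)
      have := Sdeg' 0
      have := Sdeg' 1
      omega
    have h2 : (Sb.offDiag.biUnion Pb).card ≤ D * D := by
      refine Finset.card_biUnion_le.trans ((Finset.sum_le_sum hPbc).trans ?_)
      rw [← Finset.card_eq_sum_ones, Finset.offDiag_card]
      exact (Nat.sub_le _ _).trans (Nat.mul_le_mul hSbc hSbc)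
    have h3 : D ≤ D * D := Nat.le_mul_self D
    rw [pow_two]; omega
  · intro m hm hmB
    rw [Finset.mem_union, not_or, Finset.mem_biUnion, Finset.mem_biUnion] at hmB
    obtain ⟨hm1, hm2⟩ := hmB
    push Not at hm1 hm2
    set S2 := S.filter (fun g => (degreeOf 0 g ≠ 0 ∧ ∃ c, bil c ∣ g) ∧ aeval (pm m) g = 0 ∧
      #{l ∈ L | aeval (pl l) g = 0} ≤ k) with hS2
    have hS2c : S2.card ≤ 1 := by
      rw [Finset.card_le_one]
      intro g hg g' hg'
      obtain ⟨i1, i2, i3, -⟩ := Finset.mem_filter.1 hg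
      obtain ⟨j1, j2, j3, -⟩ := Finset.mem_filter.1 hg'
      by_contra hne
      refine hm2 (g, g') ?_ ?_
      · exact Finset.mem_offDiag.2 ⟨Finset.mem_filter.2 ⟨i1, i2⟩, Finset.mem_filter.2 ⟨j1, j2⟩, hne⟩
      · exact Finset.mem_filter.2 ⟨hm, i3, j3⟩
    have hcov : #{l ∈ L | inc l m} ≤ ∑ g ∈ S, #{l ∈ L | aeval (pl l) g = 0 ∧ inc l m} := by
      refine le_trans (Finset.card_le_card ?_) Finset.card_biUnion_le
      intro l hl
      obtain ⟨hlL, hlm⟩ := Finset.mem_filter.1 hl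
      obtain ⟨g, hg, hgl⟩ := Sz _ (hfL l hlL)
      exact Finset.mem_biUnion.2 ⟨g, hg, Finset.mem_filter.2 ⟨hlL, hgl, hlm⟩⟩
    refine hcov.trans ?_
    have hpt : ∀ g ∈ S, #{l ∈ L | aeval (pl l) g = 0 ∧ inc l m} ≤
        3 * (degreeOf 0 g + degreeOf 2 g) + if g ∈ S2 then k else 0 := by
      intro g hg
      rcases hBm g hg m hm (hm1 g hg) with h | h
      · exact h.trans (Nat.le_add_right _ _)
      · rw [if_pos (Finset.mem_filter.2 ⟨hg, h⟩)]
        refine le_trans (le_trans (Finset.card_le_card ?_) h.2.2) (Nat.le_add_left _ _)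
        intro l hl
        rw [Finset.mem_filter] at hl ⊢
        exact ⟨hl.1, hl.2.1⟩
    refine (Finset.sum_le_sum hpt).trans ?_
    rw [Finset.sum_add_distrib, ← Finset.mul_sum, Finset.sum_add_distrib, ← Finset.sum_filter,
      Finset.sum_const, smul_eq_mul]
    have hc : ∀ T ⊆ S2, T.card * k ≤ k := fun T hT => by
      have := Nat.mul_le_mul_right k ((Finset.card_le_card hT).trans hS2c)
      omega
    refine (Nat.add_le_add_left (hc _ (fun g hg => (Finset.mem_filter.1 hg).2)) _).trans ?_
    have := Sdeg' 0
    have := Sdeg' 2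
    omega

end SP

namespace SP
open MvPolynomial
variable {K : Type*} [Field K]

open Classical in
/-- number of incidences -/
noncomputable def nI (L W : Finset (K × K × K)) : ℕ := ∑ m ∈ W, #{l ∈ L | inc l m}

open Classical in
lemma nI_le_mul (L W : Finset (K × K × K)) (B : ℕ) (h : ∀ m ∈ W, #{l ∈ L | inc l m} ≤ B) :
    nI L W ≤ W.card * B := by
  unfold nI
  refine (Finset.sum_le_card_nsmul _ _ B h).trans (by simp)

open Classical in
lemma nI_le (L W : Finset (K × K × K)) : nI L W ≤ W.card * L.card :=
  nI_le_mul L W _ fun _ _ => Finset.card_filter_le _ _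

open Classical in
lemma nI_split_W (L W V : Finset (K × K × K)) (hV : V ⊆ W) :
    nI L W = nI L (W \ V) + nI L V := by
  unfold nI
  rw [Finset.sum_sdiff hV]

open Classical in
lemma nI_split_L (L W V : Finset (K × K × K)) (hV : V ⊆ L) :
    nI L W = nI (L \ V) W + nI V W := by
  unfold nI
  rw [← Finset.sum_add_distrib]
  refine Finset.sum_congr rfl fun m _ => ?_
  rw [← Finset.card_union_of_disjoint, ← Finset.filter_union, Finset.sdiff_union_of_subset hV]
  exact Finset.disjoint_filter_filter (Finset.sdiff_disjoint)

lemma pieces (W : Finset (K × K × K)) (n B : ℕ) (s : ℕ) : ∀ L : Finset (K × K × K),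
    L.card ≤ s * n → (∀ L' ⊆ L, L'.card ≤ n → nI L' W ≤ B) → nI L W ≤ s * B := by
  classical
  induction s with
  | zero =>
    intro L hL _
    have : L = ∅ := by rw [← Finset.card_eq_zero]; omega
    subst this
    simp [nI]
  | succ s ih =>
    intro L hL h
    obtain ⟨V, hV, hVc⟩ := Finset.exists_subset_card_eq (Nat.min_le_right n L.card)
    rw [nI_split_L L W V hV, Nat.succ_mul]
    refine Nat.add_le_add (ih _ ?_ fun L' hL' => h L' (hL'.trans Finset.sdiff_subset))
      (h V hV (by omega))
    rw [Finset.card_sdiff_of_subset hV, hVc]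
    rw [Nat.succ_mul] at hL
    omega

open Classical in
lemma recursion (p : ℕ) [Fact p.Prime] [CharP K p] [Infinite K] (k Q : ℕ) (hkQ : k ≤ Q) (i : ℕ) :
    ∀ L W : Finset (K × K × K),
    Set.InjOn Prod.fst (L : Set (K × K × K)) → Set.InjOn Prod.fst (W : Set (K × K × K)) →
    (∀ m1 ∈ W, ∀ m2 ∈ W, m1 ≠ m2 → #{l ∈ L | inc l m1 ∧ inc l m2} ≤ k) →
    L.card ≤ 2^(48*(i+1)) → W.card ≤ 2^(48*(i+1)) → 2^(24*i) ≤ p → 2^(18*(i+1)) ≤ Q →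
    nI L W ≤ 2^97 * 2^(54*i) * Q := by
  induction i with
  | zero =>
    intro L W _ _ _ hL hW _ hQ
    refine (nI_le L W).trans ((Nat.mul_le_mul hW hL).trans ?_)
    have : 1 ≤ Q := le_trans Nat.one_le_two_pow hQ
    calc 2^(48*(0+1)) * 2^(48*(0+1)) ≤ 2^97 * 2^(54*0) * 1 := by norm_num
      _ ≤ _ := Nat.mul_le_mul_left _ this
  | succ i ih =>
    intro L W hL hW hk hLc hWc hp hQ
    have key : ∀ L' ⊆ L, L'.card ≤ 2^(48*i+43) →
        nI L' W ≤ 2^(48*(i+1+1)) * (6 * 2^(24*i+22) + k) + 2^97 * 2^(54*i) * Q := by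
      intro L' hL' hc
      have hL1 : Set.InjOn Prod.fst (L' : Set (K × K × K)) := hL.mono fun x hx => hL' hx
      have hk1 : ∀ m1 ∈ W, ∀ m2 ∈ W, m1 ≠ m2 → #{l ∈ L' | inc l m1 ∧ inc l m2} ≤ k :=
        fun m1 h1 m2 h2 hne =>
          (Finset.card_le_card (Finset.filter_subset_filter _ hL')).trans (hk m1 h1 m2 h2 hne)
      have hpp : 2 * 2^(24*i+22) < p := by
        refine lt_of_lt_of_le ?_ hp
        rw [← pow_succ']
        exact Nat.pow_lt_pow_right (by norm_num) (by omega)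
      obtain ⟨Bad, hBW, hBc, hBm⟩ := core p L' W k hL1 hW hk1 (2^(24*i+22)) (by
        have e : (2:ℕ)^(48*i+43) * 2 = (2^(24*i+22))^2 := by rw [← pow_succ, ← pow_mul]; congr 1; ring
        set D := (2:ℕ)^(24*i+22)
        have : L'.card * 2 ≤ D^2 := by omega
        nlinarith) hpp
      rw [nI_split_W L' W Bad hBW]
      refine Nat.add_le_add ?_ ?_
      · refine (nI_le_mul L' (W \ Bad) (6 * 2^(24*i+22) + k) ?_).trans ?_
        · intro m hm
          rw [Finset.mem_sdiff] at hm
          exact hBm m hm.1 hm.2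
        · exact Nat.mul_le_mul_right _ ((Finset.card_le_card Finset.sdiff_subset).trans hWc)
      · refine ih L' Bad hL1 (hW.mono fun x hx => hBW hx)
          (fun m1 h1 m2 h2 => hk1 m1 (hBW h1) m2 (hBW h2)) ?_ ?_ ?_ ?_
        · exact hc.trans (Nat.pow_le_pow_right (by norm_num) (by omega))
        · refine hBc.trans ?_
          have e : (2:ℕ)^(48*(i+1)) = 16 * (2^(24*i+22))^2 := by
            rw [← pow_mul, show (16:ℕ) = 2^4 by norm_num, ← pow_add]; congr 1; ring
          rw [e]; exact Nat.mul_le_mul_right _ (by norm_num)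
        · exact (Nat.pow_le_pow_right (by norm_num) (by omega)).trans hp
        · exact (Nat.pow_le_pow_right (by norm_num) (by omega)).trans hQ
    have h1 := pieces W _ _ (2^53) L (by
      refine hLc.trans (le_of_eq ?_)
      rw [← pow_add]; congr 1; ring) key
    refine h1.trans ?_
    have h2 : 6 * 2^(24*i+22) + k ≤ 2 * 2^(6*i) * Q := by
      have a1 : 6 * 2^(24*i+22) ≤ 2^(6*i) * Q := by
        calc 6 * 2^(24*i+22) ≤ 2^(6*i) * 2^(18*(i+1+1)) := by
              have e : (2:ℕ)^(6*i) * 2^(18*(i+1+1)) = 2^14 * 2^(24*i+22) := by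
                rw [← pow_add, ← pow_add]; congr 1; ring
              rw [e]; exact Nat.mul_le_mul_right _ (by norm_num)
          _ ≤ _ := Nat.mul_le_mul_left _ hQ
      have a2 : k ≤ 2^(6*i) * Q := hkQ.trans (Nat.le_mul_of_pos_left _ (by positivity))
      rw [mul_assoc]; omega
    calc 2^53 * (2^(48*(i+1+1)) * (6 * 2^(24*i+22) + k) + 2^97 * 2^(54*i) * Q)
        ≤ 2^53 * (2^(48*(i+1+1)) * (2 * 2^(6*i) * Q) + 2^97 * 2^(54*i) * Q) := by gcongr
      _ = 2^97 * 2^(54*(i+1)) * Q := by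
        ring

open Classical in
lemma inc_bound (p : ℕ) [Fact p.Prime] [CharP K p] [Infinite K] (k N : ℕ) (hN : N ≠ 0)
    (hNp : N ≤ p^2) (hkN : k^8 ≤ N^3)
    (L W : Finset (K × K × K))
    (hL : Set.InjOn Prod.fst (L : Set (K × K × K))) (hW : Set.InjOn Prod.fst (W : Set (K × K × K)))
    (hk : ∀ m1 ∈ W, ∀ m2 ∈ W, m1 ≠ m2 → #{l ∈ L | inc l m1 ∧ inc l m2} ≤ k)
    (hLc : L.card ≤ N) (hWc : W.card ≤ N) : (nI L W)^2 ≤ 2^230 * N^3 := by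
  set i := Nat.log 2 N / 48 with hi
  have h1 : 2^(48*i) ≤ N :=
    (Nat.pow_le_pow_right (by norm_num) (by omega)).trans (Nat.pow_log_le_self 2 hN)
  have h2 : N ≤ 2^(48*(i+1)) :=
    (Nat.lt_pow_succ_log_self (by norm_num) N).le.trans
      (Nat.pow_le_pow_right (by norm_num) (by omega))
  have h3 : 2^(24*i) ≤ p := by
    have : (2^(24*i))^2 ≤ p^2 := by
      rw [← pow_mul, show 24*i*2 = 48*i by ring]; exact h1.trans hNp
    exact (Nat.pow_le_pow_iff_left (by norm_num)).1 this
  have h4 : k ≤ 2^(18*(i+1)) := by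
    have : k^8 ≤ (2^(18*(i+1)))^8 := by
      refine hkN.trans ((Nat.pow_le_pow_left h2 3).trans (le_of_eq ?_))
      rw [← pow_mul, ← pow_mul]; congr 1; ring
    exact (Nat.pow_le_pow_iff_left (by norm_num)).1 this
  have h5 := recursion p k _ h4 i L W hL hW hk (hLc.trans h2) (hWc.trans h2) h3 le_rfl
  refine (Nat.pow_le_pow_left h5 2).trans ?_
  have e : (2^97 * 2^(54*i) * 2^(18*(i+1)))^2 = 2^230 * (2^(48*i))^3 := by
    rw [← pow_add, ← pow_add, ← pow_mul, ← pow_mul, ← pow_add]; congr 1; ring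
  rw [e]
  exact Nat.mul_le_mul_left _ (Nat.pow_le_pow_left h1 3)

end SP

namespace SP
open MvPolynomial
variable {K : Type*} [Field K]

section config
variable {p : ℕ} [Fact p.Prime]

/-- constants -/
noncomputable def kc (a : ZMod p) : RatFunc (ZMod p) :=
  algebraMap (Polynomial (ZMod p)) (RatFunc (ZMod p)) (Polynomial.C a)
/-- the transcendental element -/
noncomputable def ks (p : ℕ) [Fact p.Prime] : RatFunc (ZMod p) :=
  algebraMap (Polynomial (ZMod p)) (RatFunc (ZMod p)) Polynomial.X

lemma amap_inj : Function.Injective (algebraMap (Polynomial (ZMod p)) (RatFunc (ZMod p))) :=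
  IsFractionRing.injective _ _

/-- line of the first kind attached to a point -/
noncomputable def mapL (t : ZMod p × ZMod p × ZMod p) :
    RatFunc (ZMod p) × RatFunc (ZMod p) × RatFunc (ZMod p) :=
  ((kc t.1 + ks p * kc t.2.2 + ks p ^ 4) / (kc t.2.1 + ks p ^ 2), 1 / (kc t.2.1 + ks p ^ 2),
    kc t.2.2 / (kc t.2.1 + ks p ^ 2))
/-- line of the second kind attached to a plane -/
noncomputable def mapM (t : ZMod p × ZMod p × ZMod p) :
    RatFunc (ZMod p) × RatFunc (ZMod p) × RatFunc (ZMod p) :=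
  ((ks p ^ 4 * kc t.2.1 - ks p ^ 2 * kc t.1 - kc t.2.2) / (ks p * kc t.2.1 + 1),
    kc t.2.1 / (ks p * kc t.2.1 + 1), - kc t.1 / (ks p * kc t.2.1 + 1))

lemma den1 (x : ZMod p) : kc x + ks p ^ 2 ≠ 0 := by
  unfold kc ks
  rw [← map_pow, ← map_add]
  intro h
  have := (map_eq_zero_iff _ amap_inj).1 h
  have := congrArg (fun q => Polynomial.coeff q 2) this
  simp [Polynomial.coeff_C] at this

lemma den2 (x : ZMod p) : ks p * kc x + 1 ≠ 0 := by
  unfold kc ks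
  rw [← map_mul, ← map_one (algebraMap (Polynomial (ZMod p)) (RatFunc (ZMod p))), ← map_add]
  intro h
  have := (map_eq_zero_iff _ amap_inj).1 h
  have := congrArg (fun q => Polynomial.coeff q 0) this
  simp at this

lemma mapL_inj {t t' : ZMod p × ZMod p × ZMod p} (h : (mapL t).1 = (mapL t').1) : t = t' := by
  obtain ⟨b, x, c⟩ := t
  obtain ⟨b', x', c'⟩ := t'
  simp only [mapL] at h
  rw [div_eq_div_iff (den1 _) (den1 _)] at h
  unfold kc ks at h
  simp only [← map_pow, ← map_add, ← map_mul] at h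
  have h := amap_inj h
  have h2 : Polynomial.C (b * x') + Polynomial.C (c * x') * Polynomial.X
      + Polynomial.C b * Polynomial.X ^ 2 + Polynomial.C c * Polynomial.X ^ 3
      + Polynomial.C x' * Polynomial.X ^ 4 = Polynomial.C (b' * x) + Polynomial.C (c' * x) * Polynomial.X
      + Polynomial.C b' * Polynomial.X ^ 2 + Polynomial.C c' * Polynomial.X ^ 3
      + Polynomial.C x * Polynomial.X ^ 4 := by
    simp only [Polynomial.C_mul]
    linear_combination h
  have e2 := congrArg (fun q => Polynomial.coeff q 2) h2
  have e3 := congrArg (fun q => Polynomial.coeff q 3) h2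
  have e4 := congrArg (fun q => Polynomial.coeff q 4) h2
  simp only [Polynomial.coeff_add, Polynomial.coeff_C_mul, Polynomial.coeff_X_pow,
    Polynomial.coeff_X, Polynomial.coeff_C] at e2 e3 e4
  norm_num at e2 e3 e4
  rw [e2, e3, e4]

lemma mapM_inj {t t' : ZMod p × ZMod p × ZMod p} (h : (mapM t).1 = (mapM t').1) : t = t' := by
  obtain ⟨b, x, c⟩ := t
  obtain ⟨b', x', c'⟩ := t'
  simp only [mapM] at h
  rw [div_eq_div_iff (den2 _) (den2 _)] at h
  unfold kc ks at h
  rw [← map_one (algebraMap (Polynomial (ZMod p)) (RatFunc (ZMod p)))] at h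
  simp only [← map_pow, ← map_add, ← map_mul, ← map_sub] at h
  have h := amap_inj h
  have h2 : Polynomial.C (-c) + Polynomial.C (-(c * x')) * Polynomial.X
      + Polynomial.C (-b) * Polynomial.X ^ 2 + Polynomial.C (-(b * x')) * Polynomial.X ^ 3
      + Polynomial.C x * Polynomial.X ^ 4 = Polynomial.C (-c') + Polynomial.C (-(c' * x)) * Polynomial.X
      + Polynomial.C (-b') * Polynomial.X ^ 2 + Polynomial.C (-(b' * x)) * Polynomial.X ^ 3
      + Polynomial.C x' * Polynomial.X ^ 4 := by
    simp only [Polynomial.C_mul, Polynomial.C_neg]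
    linear_combination h
  have e2 := congrArg (fun q => Polynomial.coeff q 2) h2
  have e3 := congrArg (fun q => Polynomial.coeff q 0) h2
  have e4 := congrArg (fun q => Polynomial.coeff q 4) h2
  simp only [Polynomial.coeff_add, Polynomial.coeff_C_mul, Polynomial.coeff_X_pow,
    Polynomial.coeff_X, Polynomial.coeff_C] at e2 e3 e4
  norm_num at e2 e3 e4
  rw [e2, e3, e4]

/-- the incidence relation downstairs -/
def rel (t r : ZMod p × ZMod p × ZMod p) : Prop := t.2.1 * r.1 + t.2.2 = r.2.1 * t.1 + r.2.2

lemma inc_iff (t r : ZMod p × ZMod p × ZMod p) : inc (mapL t) (mapM r) ↔ rel t r := by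
  obtain ⟨b', x, c⟩ := t
  obtain ⟨b, x', c'⟩ := r
  have h1 := den1 x
  have h2 := den2 x'
  have h3 : rel (b', x, c) (b, x', c') ↔ kc x * kc b + kc c = kc x' * kc b' + kc c' := by
    unfold rel kc
    simp only [← map_mul, ← map_add]
    rw [amap_inj.eq_iff, Polynomial.C_injective.eq_iff]
  rw [h3]
  unfold inc mapL mapM
  simp only
  rw [← sub_eq_zero, ← sub_eq_zero (a := kc x * kc b + kc c)]
  have key : 1 / (kc x + ks p ^ 2) * ((ks p ^ 4 * kc x' - ks p ^ 2 * kc b - kc c') / (ks p * kc x' + 1)) +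
      kc c / (kc x + ks p ^ 2) -
    (kc x' / (ks p * kc x' + 1) * ((kc b' + ks p * kc c + ks p ^ 4) / (kc x + ks p ^ 2)) +
      -kc b / (ks p * kc x' + 1)) = (kc x * kc b + kc c - (kc x' * kc b' + kc c')) /
        ((kc x + ks p ^ 2) * (ks p * kc x' + 1)) := by
    field_simp
    ring
  rw [key, div_eq_zero_iff]
  simp [h1, h2]

open Classical in
lemma codeg (B X C : Finset (ZMod p)) (k : ℕ) (hB : B.card ≤ k) (hX : X.card ≤ k)
    (r1 r2 : ZMod p × ZMod p × ZMod p) (hne : r1 ≠ r2) :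
    #{t ∈ B ×ˢ X ×ˢ C | rel t r1 ∧ rel t r2} ≤ k := by
  obtain ⟨b1, x1, c1⟩ := r1
  obtain ⟨b2, x2, c2⟩ := r2
  by_cases hb : b1 = b2
  · subst hb
    by_cases hx : x1 = x2
    · subst hx
      have hc : c1 ≠ c2 := by rintro rfl; exact hne rfl
      rw [Finset.card_eq_zero.2]
      · exact Nat.zero_le _
      rw [Finset.filter_eq_empty_iff]
      rintro ⟨b, x, c⟩ _ ⟨h1, h2⟩
      unfold rel at h1 h2
      apply hc
      linear_combination h2 - h1
    · refine le_trans (Finset.card_le_card_of_injOn (fun t => t.2.1) ?_ ?_) hX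
      · rintro ⟨b, x, c⟩ ht
        simp at ht; exact ht.1.2.1
      · rintro ⟨b, x, c⟩ ht ⟨b', x', c'⟩ ht' h
        obtain ⟨h1, h2⟩ := (Finset.mem_filter.1 (Finset.mem_coe.1 ht)).2
        obtain ⟨h3, h4⟩ := (Finset.mem_filter.1 (Finset.mem_coe.1 ht')).2
        unfold rel at h1 h2 h3 h4
        simp only at h h1 h2 h3 h4
        subst h
        have hx' : x1 - x2 ≠ 0 := sub_ne_zero.2 hx
        have e1 : b = b' := by
          apply mul_left_cancel₀ hx'
          linear_combination -h1 + h2 + h3 - h4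
        subst e1
        have e2 : c = c' := by linear_combination h1 - h3
        rw [e2]
  · refine le_trans (Finset.card_le_card_of_injOn (fun t => t.1) ?_ ?_) hB
    · rintro ⟨b, x, c⟩ ht
      simp at ht; exact ht.1.1
    · rintro ⟨b, x, c⟩ ht ⟨b', x', c'⟩ ht' h
      obtain ⟨h1, h2⟩ := (Finset.mem_filter.1 (Finset.mem_coe.1 ht)).2
      obtain ⟨h3, h4⟩ := (Finset.mem_filter.1 (Finset.mem_coe.1 ht')).2
      unfold rel at h1 h2 h3 h4
      simp only at h h1 h2 h3 h4
      subst h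
      have hx' : b1 - b2 ≠ 0 := sub_ne_zero.2 hb
      have e1 : x = x' := by
        apply mul_left_cancel₀ hx'
        linear_combination h1 - h2 - h3 + h4
      subst e1
      have e2 : c = c' := by linear_combination h1 - h3
      rw [e2]

open Classical in
lemma energy_bound (B X C : Finset (ZMod p)) (k N : ℕ) (hN : N ≠ 0) (hNp : N ≤ p^2)
    (hkN : k^8 ≤ N^3) (hB : B.card ≤ k) (hX : X.card ≤ k) (hc : B.card * (X.card * C.card) ≤ N) :
    (∑ r ∈ B ×ˢ X ×ˢ C, #{t ∈ B ×ˢ X ×ˢ C | rel t r})^2 ≤ 2^230 * N^3 := by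
  set T := B ×ˢ X ×ˢ C with hT
  have hTc : T.card ≤ N := by rw [hT, Finset.card_product, Finset.card_product]; exact hc
  haveI : CharP (RatFunc (ZMod p)) p :=
    charP_of_injective_algebraMap (FaithfulSMul.algebraMap_injective (ZMod p) (RatFunc (ZMod p))) p
  haveI : Infinite (RatFunc (ZMod p)) := Infinite.of_injective _ (amap_inj (p := p))
  have iL : Function.Injective (mapL (p := p)) := fun a b h => mapL_inj (congrArg Prod.fst h)
  have iM : Function.Injective (mapM (p := p)) := fun a b h => mapM_inj (congrArg Prod.fst h)
  have cnt : ∀ q : RatFunc (ZMod p) × RatFunc (ZMod p) × RatFunc (ZMod p) → Prop,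
      #{l ∈ T.image mapL | q l} = #{t ∈ T | q (mapL t)} := by
    intro q
    rw [Finset.filter_image, Finset.card_image_of_injective _ iL]
  have key := inc_bound (K := RatFunc (ZMod p)) p k N hN hNp hkN (T.image mapL) (T.image mapM)
    ?_ ?_ ?_ (Finset.card_image_le.trans hTc) (Finset.card_image_le.trans hTc)
  · have e : nI (T.image mapL) (T.image mapM) = ∑ r ∈ T, #{t ∈ T | rel t r} := by
      unfold nI
      rw [Finset.sum_image (fun a _ b _ h => iM h)]
      refine Finset.sum_congr rfl fun r _ => ?_
      rw [cnt]
      simp only [inc_iff]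
    rw [← e]; exact key
  · intro a ha b hb h
    simp only [Finset.coe_image, Set.mem_image] at ha hb
    obtain ⟨a, -, rfl⟩ := ha
    obtain ⟨b, -, rfl⟩ := hb
    rw [mapL_inj h]
  · intro a ha b hb h
    simp only [Finset.coe_image, Set.mem_image] at ha hb
    obtain ⟨a, -, rfl⟩ := ha
    obtain ⟨b, -, rfl⟩ := hb
    rw [mapM_inj h]
  · intro m1 h1 m2 h2 hne
    obtain ⟨r1, -, rfl⟩ := Finset.mem_image.1 h1
    obtain ⟨r2, -, rfl⟩ := Finset.mem_image.1 h2
    have := codeg B X C k hB hX r1 r2 (fun h => hne (by rw [h]))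
    refine le_trans (le_of_eq ?_) this
    have := cnt (fun l => inc l (mapM r1) ∧ inc l (mapM r2))
    simp only [inc_iff] at this
    convert this
end config

end SP

namespace SP
open MvPolynomial
variable {K : Type*} [Field K]

section app
variable {p : ℕ} [Fact p.Prime]

open Classical in
lemma cs_step (A : Finset (ZMod p)) :
    (A.card * ((A.erase 0).card * A.card))^2 ≤ (A + A).card *
      ∑ r ∈ ((A.erase 0).image (·⁻¹)) ×ˢ (A * A) ×ˢ A,
        #{t ∈ ((A.erase 0).image (·⁻¹)) ×ˢ (A * A) ×ˢ A | rel t r} := by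
  set T := ((A.erase 0).image (·⁻¹)) ×ˢ (A * A) ×ˢ A with hT
  set G := A ×ˢ (A.erase 0) ×ˢ A with hG
  have hGc : G.card = A.card * ((A.erase 0).card * A.card) := by
    rw [hG, Finset.card_product, Finset.card_product]
  let f : ZMod p × ZMod p × ZMod p → ZMod p := fun g => g.1 + g.2.2
  have hf : ∀ g ∈ G, f g ∈ A + A := by
    rintro ⟨a, d, c⟩ hg
    simp only [hG, Finset.mem_product] at hg
    exact Finset.add_mem_add hg.1 hg.2.2
  have e1 : G.card = ∑ s ∈ A + A, #{g ∈ G | f g = s} :=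
    Finset.card_eq_sum_card_fiberwise hf
  set P := (G ×ˢ G).filter (fun q => f q.1 = f q.2) with hP
  have e2 : P.card = ∑ s ∈ A + A, #{q ∈ P | f q.1 = s} := by
    apply Finset.card_eq_sum_card_fiberwise
    intro q hq
    exact hf _ (Finset.mem_product.1 (Finset.mem_filter.1 (Finset.mem_coe.1 hq)).1).1
  have e3 : ∀ s ∈ A + A, #{q ∈ P | f q.1 = s} = #{g ∈ G | f g = s} ^ 2 := by
    intro s _
    rw [sq, ← Finset.card_product]
    congr 1
    ext q
    simp only [hP, Finset.mem_filter, Finset.mem_product]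
    constructor
    · rintro ⟨⟨⟨h1, h2⟩, h3⟩, h4⟩
      exact ⟨⟨h1, h4⟩, h2, h3 ▸ h4⟩
    · rintro ⟨⟨h1, h4⟩, h2, h3⟩
      exact ⟨⟨⟨h1, h2⟩, h4.trans h3.symm⟩, h4⟩
  have e4 : P.card ≤ ∑ r ∈ T, #{t ∈ T | rel t r} := by
    have e5 : ∑ r ∈ T, #{t ∈ T | rel t r} = #((T ×ˢ T).filter (fun q => rel q.2 q.1)) := by
      simp only [Finset.card_filter, Finset.sum_product]
    rw [e5]
    refine Finset.card_le_card_of_injOn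
      (fun q => ((q.1.2.1⁻¹, q.2.1 * q.2.2.1, q.2.2.2), (q.2.2.1⁻¹, q.1.1 * q.1.2.1, q.1.2.2))) ?_ ?_
    · rintro ⟨⟨a, d, c⟩, ⟨a', d', c'⟩⟩ hq
      have hq := Finset.mem_filter.1 (Finset.mem_coe.1 hq)
      obtain ⟨hq, h⟩ := hq
      simp only [hG, Finset.mem_product] at hq
      obtain ⟨⟨ha, hd, hc⟩, ha', hd', hc'⟩ := hq
      have hd0 := Finset.ne_of_mem_erase hd
      have hd0' := Finset.ne_of_mem_erase hd'
      have hdA := Finset.mem_of_mem_erase hd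
      have hdA' := Finset.mem_of_mem_erase hd'
      refine Finset.mem_coe.2 (Finset.mem_filter.2 ⟨?_, ?_⟩)
      · simp only [hT, Finset.mem_product]
        exact ⟨⟨Finset.mem_image_of_mem _ hd, Finset.mul_mem_mul ha' hdA', hc'⟩,
          Finset.mem_image_of_mem _ hd', Finset.mul_mem_mul ha hdA, hc⟩
      · unfold rel
        simp only [f] at h ⊢
        rw [mul_inv_cancel_right₀ hd0, mul_inv_cancel_right₀ hd0', h]
    · rintro ⟨⟨a, d, c⟩, ⟨a', d', c'⟩⟩ hq ⟨⟨a2, d2, c2⟩, ⟨a2', d2', c2'⟩⟩ hq2 h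
      have hq := (Finset.mem_filter.1 (Finset.mem_coe.1 hq)).1
      simp only [hG, Finset.mem_product] at hq
      obtain ⟨⟨ha, hd, hc⟩, ha', hd', hc'⟩ := hq
      have hd0 := Finset.ne_of_mem_erase hd
      have hd0' := Finset.ne_of_mem_erase hd'
      simp only [Prod.mk.injEq, inv_inj] at h
      obtain ⟨⟨rfl, h1, rfl⟩, rfl, h2, rfl⟩ := h
      rw [mul_right_cancel₀ hd0 h2, mul_right_cancel₀ hd0' h1]
  calc (A.card * ((A.erase 0).card * A.card))^2 = (∑ s ∈ A + A, #{g ∈ G | f g = s})^2 := by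
        rw [← hGc, ← e1]
    _ ≤ (A + A).card * ∑ s ∈ A + A, #{g ∈ G | f g = s} ^ 2 := sq_sum_le_card_mul_sum_sq
    _ = (A + A).card * P.card := by rw [e2, Finset.sum_congr rfl e3]
    _ ≤ _ := Nat.mul_le_mul_left _ e4

/-- the main inequality in integers, for sets with few products -/
lemma app_main (A : Finset (ZMod p)) (h2 : 2 ≤ A.card) (hk : (A * A).card ^ 5 ≤ A.card ^ 6)
    (hp : (A * A).card * A.card ^ 2 ≤ p ^ 2) :
    A.card ^ 6 ≤ 2 ^ 234 * ((A + A).card ^ 2 * (A * A).card ^ 3) := by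
  classical
  set n := A.card with hn
  set m := (A.erase 0).card with hm
  set k := (A * A).card with hkdef
  have hmn : n ≤ 2 * m := by
    have : n - 1 ≤ m := Finset.pred_card_le_card_erase
    omega
  have hmn' : m ≤ n := Finset.card_erase_le
  have hmpos : 0 < m := by omega
  obtain ⟨d, hd⟩ := Finset.card_pos.1 hmpos
  have hnk : n ≤ k := by
    have hd0 := Finset.ne_of_mem_erase hd
    refine Finset.card_le_card_of_injOn (fun a => a * d) ?_ ?_
    · intro a ha
      exact Finset.mul_mem_mul ha (Finset.mem_of_mem_erase hd)
    · intro a _ b _ h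
      exact mul_right_cancel₀ hd0 h
  have hn0 : 0 < n := by omega
  have hk0 : 0 < k := by omega
  have hBc : ((A.erase 0).image (·⁻¹)).card ≤ m := Finset.card_image_le
  have cs := cs_step A
  have eb := energy_bound ((A.erase 0).image (·⁻¹)) (A * A) A k (k * n^2)
    (by positivity) hp ?_ (hBc.trans (hmn'.trans hnk)) le_rfl ?_
  · generalize (∑ r ∈ ((A.erase 0).image (·⁻¹)) ×ˢ (A * A) ×ˢ A,
        #{t ∈ ((A.erase 0).image (·⁻¹)) ×ˢ (A * A) ×ˢ A | rel t r}) = E at cs eb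
    rw [← hn, ← hm] at cs
    set s := (A + A).card
    have c1 : (n * (m * n))^4 ≤ s^2 * (2^230 * (k*n^2)^3) := by
      calc (n * (m * n))^4 = ((n * (m * n))^2)^2 := by ring
        _ ≤ (s * E)^2 := Nat.pow_le_pow_left cs 2
        _ = s^2 * E^2 := by ring
        _ ≤ _ := Nat.mul_le_mul_left _ eb
    have c2 : n^6 * n^6 ≤ n^6 * (2^234 * (s^2 * k^3)) := by
      calc n^6 * n^6 = n^8 * n^4 := by ring
        _ ≤ n^8 * (2*m)^4 := by gcongr
        _ = 16 * (n * (m * n))^4 := by ring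
        _ ≤ 16 * (s^2 * (2^230 * (k*n^2)^3)) := by gcongr
        _ = _ := by ring
    exact Nat.le_of_mul_le_mul_left c2 (by positivity)
  · calc k^8 = k^3 * k^5 := by ring
      _ ≤ k^3 * n^6 := by gcongr
      _ = _ := by ring
  · rw [← hkdef, ← hn]
    calc _ ≤ n * (k * n) := by gcongr; exact hBc.trans hmn'
      _ = _ := by ring
end app

end SP

theorem stmt_14 :
    ∃ c : ℝ, 0 < c ∧ ∀ (p : ℕ), p.Prime → 2 < p →
      ∀ A : Finset (ZMod p), (A.card : ℝ) ≤ (p : ℝ) ^ ((5 : ℝ) / 8) →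
      c * (A.card : ℝ) ^ ((6 : ℝ) / 5) ≤ max ((A + A).card : ℝ) ((A * A).card : ℝ) := by
  refine ⟨1 / 2 ^ 47, by positivity, ?_⟩
  intro p hp _ A hA
  haveI : Fact p.Prime := ⟨hp⟩
  set n : ℝ := (A.card : ℝ) with hn
  have hn0 : 0 ≤ n := Nat.cast_nonneg _
  set y : ℝ := n ^ ((6 : ℝ) / 5) with hy
  have hy0 : 0 ≤ y := Real.rpow_nonneg hn0 _
  have hy5 : y ^ 5 = n ^ 6 := by
    rw [hy, ← Real.rpow_natCast, ← Real.rpow_mul hn0, ← Real.rpow_natCast]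
    norm_num
  set M : ℝ := max ((A + A).card : ℝ) ((A * A).card : ℝ) with hM
  have hM0 : 0 ≤ M := le_max_of_le_left (Nat.cast_nonneg _)
  have hS : ((A + A).card : ℝ) ≤ M := le_max_left _ _
  have hX : ((A * A).card : ℝ) ≤ M := le_max_right _ _
  suffices h : n ^ 6 ≤ 2 ^ 234 * M ^ 5 by
    have : (1 / 2 ^ 47 * y) ^ 5 ≤ M ^ 5 := by
      rw [mul_pow, hy5]
      have h5 : (0 : ℝ) ≤ M ^ 5 := by positivity
      calc (1 / 2 ^ 47 : ℝ) ^ 5 * n ^ 6 ≤ (1 / 2 ^ 47 : ℝ) ^ 5 * (2 ^ 234 * M ^ 5) := by gcongr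
        _ = (1 / 2) * M ^ 5 := by ring
        _ ≤ M ^ 5 := by linarith
    exact le_of_pow_le_pow_left₀ (by norm_num) hM0 this
  rcases Nat.lt_or_ge A.card 2 with h1 | h2
  · rcases A.eq_empty_or_nonempty with rfl | hne
    · have : n = 0 := by simp [hn]
      rw [this, zero_pow (by norm_num)]; positivity
    · have e : n ≤ 1 := by rw [hn]; exact_mod_cast (by omega : A.card ≤ 1)
      have : 1 ≤ M := by
        refine le_trans ?_ hS
        exact_mod_cast Finset.card_pos.2 (hne.add hne)
      calc n ^ 6 ≤ 1 := pow_le_one₀ hn0 e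
        _ ≤ 2 ^ 234 * 1 := by norm_num
        _ ≤ 2 ^ 234 * M ^ 5 := by gcongr; exact one_le_pow₀ this
  rcases Nat.lt_or_ge (A.card ^ 6) ((A * A).card ^ 5) with h3 | h3
  · have h4 : n ^ 6 ≤ ((A * A).card : ℝ) ^ 5 := by rw [hn]; exact_mod_cast h3.le
    calc n ^ 6 ≤ ((A * A).card : ℝ) ^ 5 := h4
      _ ≤ M ^ 5 := by gcongr
      _ ≤ 2 ^ 234 * M ^ 5 := le_mul_of_one_le_left (by positivity) (by norm_num)
  have hp8 : A.card ^ 8 ≤ p ^ 5 := by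
    have : n ^ 8 ≤ (p : ℝ) ^ 5 := by
      calc n ^ 8 ≤ ((p : ℝ) ^ ((5 : ℝ) / 8)) ^ 8 := by gcongr
        _ = (p : ℝ) ^ 5 := by
          rw [← Real.rpow_natCast, ← Real.rpow_mul (Nat.cast_nonneg _), ← Real.rpow_natCast]
          norm_num
    rw [hn] at this
    exact_mod_cast this
  have hN : (A * A).card * A.card ^ 2 ≤ p ^ 2 := by
    apply le_of_pow_le_pow_left₀ (n := 5) (by norm_num) (Nat.zero_le _)
    calc ((A * A).card * A.card ^ 2) ^ 5 = (A * A).card ^ 5 * A.card ^ 10 := by ring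
      _ ≤ A.card ^ 6 * A.card ^ 10 := by gcongr
      _ = (A.card ^ 8) ^ 2 := by ring
      _ ≤ (p ^ 5) ^ 2 := by gcongr
      _ = _ := by ring
  have key := SP.app_main A h2 h3 hN
  have key' : n ^ 6 ≤ 2 ^ 234 * (((A + A).card : ℝ) ^ 2 * ((A * A).card : ℝ) ^ 3) := by
    rw [hn]; exact_mod_cast key
  calc n ^ 6 ≤ 2 ^ 234 * (((A + A).card : ℝ) ^ 2 * ((A * A).card : ℝ) ^ 3) := key'
    _ ≤ 2 ^ 234 * (M ^ 2 * M ^ 3) := by gcongr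
    _ = _ := by ring
end

section
/- There exists a constant c > 0 such that for every prime p > 2 and every finite set A ⊆ F_p with |A| ≤ p^(5/8), max{ |A + A|, |A^2 + A^2| } ≥ c·|A|^(6/5), where A^2 + A^2 = {a^2 + b^2 : a,b ∈ A}. -/
open Finset Pointwise

namespace Stmt15
open Polynomial

section biv
variable {R : Type*} [CommRing R]

lemma swap_coeff (P : R[X][X]) (i j : ℕ) :
    ((Bivariate.swap P).coeff i).coeff j = (P.coeff j).coeff i := by
  induction P using Polynomial.induction_on' with
  | add p q hp hq => simp [hp, hq]
  | monomial n a =>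
    induction a using Polynomial.induction_on' with
    | add p q hp hq => simp only [map_add, coeff_add, hp, hq]
    | monomial m r =>
      rw [Bivariate.swap_monomial_monomial]
      simp only [coeff_monomial]
      split_ifs <;> simp_all [coeff_monomial]

/-- partial derivative in the inner variable -/
noncomputable def dZ (P : R[X][X]) : R[X][X] := Bivariate.swap (derivative (Bivariate.swap P))

lemma dZ_coeff (P : R[X][X]) (i : ℕ) : (dZ P).coeff i = derivative (P.coeff i) := by
  ext j
  rw [dZ, swap_coeff, coeff_derivative, coeff_derivative]
  have : ((j : R[X]) + 1) = C ((j : R) + 1) := by simp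
  rw [this, coeff_mul_C, swap_coeff]

lemma dZ_add (P Q : R[X][X]) : dZ (P + Q) = dZ P + dZ Q := by simp [dZ]

lemma dZ_mul (P Q : R[X][X]) : dZ (P * Q) = dZ P * Q + P * dZ Q := by
  simp only [dZ, map_mul, derivative_mul, map_add, Bivariate.swap_swap_apply]

/-- substitution hom -/
noncomputable def sub {S : Type*} [CommRing S] (f : R →+* S) (ζ η : S) : R[X][X] →+* S :=
  eval₂RingHom (eval₂RingHom f ζ) η

lemma sub_C {S : Type*} [CommRing S] (f : R →+* S) (ζ η : S) (r : R[X]) :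
    sub f ζ η (C r) = eval₂ f ζ r := by simp [sub]

lemma sub_X {S : Type*} [CommRing S] (f : R →+* S) (ζ η : S) :
    sub f ζ η X = η := by simp [sub]

lemma dZ_C (a : R[X]) : dZ (C a) = C (derivative a) := by
  ext1 i
  rw [dZ_coeff, coeff_C, coeff_C]
  split_ifs <;> simp

lemma dZ_X_pow (n : ℕ) : dZ (X ^ n : R[X][X]) = 0 := by
  ext1 i
  rw [dZ_coeff, coeff_X_pow]
  split_ifs <;> simp

lemma sub_comp {S T : Type*} [CommRing S] [CommRing T] (f : R →+* S) (g : S →+* T) (ζ η : S)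
    (P : R[X][X]) : g (sub f ζ η P) = sub (g.comp f) (g ζ) (g η) P := by
  induction P using Polynomial.induction_on' with
  | add p q hp hq => simp [hp, hq]
  | monomial n a => simp [sub, eval₂_monomial, hom_eval₂]

lemma chain_inner {S : Type*} [CommRing S] (f : R →+* S[X]) (hf : ∀ r, derivative (f r) = 0)
    (ζ : S[X]) (a : R[X]) :
    derivative (eval₂ f ζ a) = eval₂ f ζ (derivative a) * derivative ζ := by
  induction a using Polynomial.induction_on' with
  | add p q hp hq => simp [hp, hq, add_mul]
  | monomial n r =>
    simp [eval₂_monomial, derivative_monomial, hf, derivative_pow, mul_assoc]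

lemma chain {S : Type*} [CommRing S] (f : R →+* S[X]) (hf : ∀ r, derivative (f r) = 0)
    (ζ η : S[X]) (P : R[X][X]) :
    derivative (sub f ζ η P) =
      sub f ζ η (derivative P) * derivative η + sub f ζ η (dZ P) * derivative ζ := by
  induction P using Polynomial.induction_on' with
  | add p q hp hq => simp only [map_add, hp, hq, dZ_add]; ring
  | monomial n a =>
    rw [← C_mul_X_pow_eq_monomial, dZ_mul, dZ_X_pow, dZ_C]
    simp only [map_mul, map_pow, sub_X, sub_C, derivative_mul, map_add, derivative_C, map_zero,
      chain_inner f hf, derivative_pow, derivative_X, map_natCast, zero_mul, zero_add, mul_zero,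
      add_zero, mul_one]
    ring

/-- the inflection polynomial -/
noncomputable def RR (P : R[X][X]) : R[X][X] :=
  derivative (derivative P) * dZ P ^ 2
    - (dZ (derivative P) + derivative (dZ P)) * derivative P * dZ P
    + dZ (dZ P) * derivative P ^ 2

lemma RR_mul {S : Type*} [CommRing S] (ψ : R[X][X] →+* S) (A B : R[X][X]) (h : ψ A = 0) :
    ψ (RR (A * B)) = ψ B ^ 3 * ψ (RR A) := by
  simp only [RR, derivative_mul, dZ_mul, dZ_add, map_add, map_sub, map_mul, map_pow, h]
  ring

/-- degree in the inner variable -/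
noncomputable def degZ (P : R[X][X]) : ℕ := (Bivariate.swap P).natDegree

lemma degZ_le_iff (P : R[X][X]) (d : ℕ) : degZ P ≤ d ↔ ∀ i, (P.coeff i).natDegree ≤ d := by
  rw [degZ, natDegree_le_iff_coeff_eq_zero]
  simp only [natDegree_le_iff_coeff_eq_zero]
  constructor
  · intro h i N hN
    rw [← swap_coeff, h N hN, coeff_zero]
  · intro h N hN
    ext i
    rw [swap_coeff, h i N hN, coeff_zero]

lemma degZ_derivative (P : R[X][X]) : degZ (derivative P) ≤ degZ P := by
  rw [degZ_le_iff]
  intro i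
  rw [coeff_derivative]
  have : ((i : R[X]) + 1) = C ((i : R) + 1) := by simp
  rw [this]
  exact (natDegree_mul_C_le _ _).trans ((degZ_le_iff P _).1 le_rfl _)

lemma degZ_dZ (P : R[X][X]) : degZ (dZ P) ≤ degZ P := by
  rw [degZ_le_iff]
  intro i
  rw [dZ_coeff]
  exact (natDegree_derivative_le _).trans ((Nat.sub_le _ _).trans ((degZ_le_iff P _).1 le_rfl _))

lemma natDegree_dZ (P : R[X][X]) : (dZ P).natDegree ≤ P.natDegree := by
  rw [natDegree_le_iff_coeff_eq_zero]
  intro N hN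
  rw [dZ_coeff, coeff_eq_zero_of_natDegree_lt hN, derivative_zero]

lemma natDegree_der (P : R[X][X]) : (derivative P).natDegree ≤ P.natDegree :=
  (natDegree_derivative_le _).trans (Nat.sub_le _ _)

/-- a generic degree estimate for RR -/
lemma natDegree_combo {S : Type*} [CommRing S] (a b c d e : S[X]) (n : ℕ)
    (ha : a.natDegree ≤ n) (hb : b.natDegree ≤ n) (hc : c.natDegree ≤ n)
    (hd : d.natDegree ≤ n) (he : e.natDegree ≤ n) (f : S[X]) (hf : f.natDegree ≤ n) :
    (a * b ^ 2 - (c + d) * e * b + f * e ^ 2).natDegree ≤ 3 * n := by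
  refine (natDegree_add_le _ _).trans (max_le ((natDegree_sub_le _ _).trans (max_le ?_ ?_)) ?_)
  · refine natDegree_mul_le.trans ?_
    have := natDegree_pow_le (p := b) (n := 2); omega
  · refine natDegree_mul_le.trans ?_
    have := natDegree_mul_le (p := c + d) (q := e)
    have := natDegree_add_le c d
    have : max c.natDegree d.natDegree ≤ n := max_le hc hd
    omega
  · refine natDegree_mul_le.trans ?_
    have := natDegree_pow_le (p := e) (n := 2); omega

lemma natDegree_RR (P : R[X][X]) : (RR P).natDegree ≤ 3 * P.natDegree := by
  have h1 := natDegree_der P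
  have h2 := natDegree_dZ P
  exact natDegree_combo _ _ _ _ _ _ ((natDegree_der _).trans h1) h2
    ((natDegree_dZ _).trans h1) ((natDegree_der _).trans h2) h1 _ ((natDegree_dZ _).trans h2)

lemma degZ_RR (P : R[X][X]) : degZ (RR P) ≤ 3 * degZ P := by
  have h1 := degZ_derivative P
  have h2 := degZ_dZ P
  have := natDegree_combo (Bivariate.swap (derivative (derivative P))) (Bivariate.swap (dZ P))
    (Bivariate.swap (dZ (derivative P))) (Bivariate.swap (derivative (dZ P)))
    (Bivariate.swap (derivative P)) _
    ((degZ_derivative _).trans h1) h2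
    ((degZ_dZ _).trans h1) ((degZ_derivative _).trans h2) h1 (Bivariate.swap (dZ (dZ P)))
    ((degZ_dZ _).trans h2)
  simpa only [degZ, RR, map_add, map_sub, map_mul, map_pow] using this

lemma degZ_resultant (f g : R[X][X]) (m n : ℕ) :
    (resultant f g m n).natDegree ≤ n * degZ f + m * degZ g := by
  have hf := (degZ_le_iff f _).1 le_rfl
  have hg := (degZ_le_iff g _).1 le_rfl
  rw [resultant, Matrix.det_apply]
  refine natDegree_sum_le_of_forall_le _ _ ?_
  intro σ _
  refine (natDegree_smul_le _ _).trans ?_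
  refine (natDegree_prod_le _ _).trans ?_
  rw [Fin.sum_univ_add, add_comm]
  refine add_le_add ?_ ?_
  · refine (Finset.sum_le_card_nsmul _ _ (degZ f) ?_).trans (by simp)
    intro i _
    simp only [sylvester, Matrix.of_apply, Fin.addCases_right]
    split_ifs
    · exact hf _
    · simp
  · refine (Finset.sum_le_card_nsmul _ _ (degZ g) ?_).trans (by simp)
    intro i _
    simp only [sylvester, Matrix.of_apply, Fin.addCases_left]
    split_ifs
    · exact hg _
    · simp

end biv
end Stmt15

open Finset Pointwise

namespace Stmt15
open Polynomial

lemma dvd_of_map {D : Type*} [CommRing D] [IsDomain D] (π B : D[X]) (hπ : Prime π)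
    (hd : π.natDegree ≠ 0)
    (h : π.map (algebraMap D (FractionRing D)) ∣ B.map (algebraMap D (FractionRing D))) :
    π ∣ B := by
  obtain ⟨h, hh⟩ := h
  obtain ⟨c, hcm, hc⟩ := IsLocalization.integerNormalization_spec (nonZeroDivisors D) h
  set H := IsLocalization.integerNormalization (nonZeroDivisors D) h
  have hinj : Function.Injective (algebraMap D (FractionRing D)) := IsFractionRing.injective _ _
  have key : C c * B = π * H := by
    apply Polynomial.map_injective _ hinj
    rw [Polynomial.map_mul, Polynomial.map_mul, hh, hc, map_C]
    have : c • h = C (algebraMap D (FractionRing D) c) * h := by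
      ext i
      simp [Algebra.smul_def]
    rw [this]
    ring
  have : π ∣ C c * B := ⟨H, key⟩
  rcases hπ.dvd_or_dvd this with h1 | h1
  · exfalso
    have hc0 : c ≠ 0 := nonZeroDivisors.ne_zero hcm
    have := natDegree_le_of_dvd h1 (by simp [hc0])
    simp at this
    exact hd this
  · exact h1

lemma bezout {R : Type*} [CommRing R] [IsDomain R] [UniqueFactorizationMonoid R] (π B : R[X][X])
    (hπ : Prime π) (hd : π.natDegree ≠ 0) (hB : ¬ π ∣ B) :
    ∃ r : R[X], r ≠ 0 ∧ r.natDegree ≤ B.natDegree * degZ π + π.natDegree * degZ B ∧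
      ∃ p q, π * p + B * q = C r := by
  refine ⟨π.resultant B π.natDegree B.natDegree, ?_, degZ_resultant _ _ _ _, ?_⟩
  · have hinj : Function.Injective (algebraMap R[X] (FractionRing R[X])) :=
      IsFractionRing.injective _ _
    have hprim : π.IsPrimitive := Irreducible.isPrimitive hπ.irreducible hd
    have hirr := (IsPrimitive.irreducible_iff_irreducible_map_fraction_map
      (K := FractionRing R[X]) hprim).1 hπ.irreducible
    have hco : IsCoprime (π.map (algebraMap R[X] (FractionRing R[X])))
        (B.map (algebraMap R[X] (FractionRing R[X]))) := by
      rw [hirr.coprime_iff_not_dvd]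
      exact fun h => hB (dvd_of_map π B hπ hd h)
    have h0 := resultant_ne_zero _ _ hco
    rw [natDegree_map_eq_of_injective hinj, natDegree_map_eq_of_injective hinj,
      resultant_map_map] at h0
    intro h
    rw [h, map_zero] at h0
    exact h0 rfl
  · obtain ⟨p, q, _, _, h⟩ := exists_mul_add_mul_eq_C_resultant π B (m := π.natDegree)
      (n := B.natDegree) le_rfl le_rfl (Or.inl hd)
    exact ⟨p, q, h⟩

variable {R : Type*} [CommRing R]

/-- evaluation at a point -/
noncomputable def ev (Q : R × R) : R[X][X] →+* R := sub (RingHom.id R) Q.1 Q.2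

lemma ev_C (Q : R × R) (r : R[X]) : ev Q (C r) = r.eval Q.1 := by
  simp [ev, sub_C, eval₂_id]

lemma card_roots_le [IsDomain R] (T : Finset (R × R)) (hT : Set.InjOn Prod.fst (T : Set (R × R)))
    (r : R[X]) (hr : r ≠ 0) (h : ∀ Q ∈ T, r.eval Q.1 = 0) : T.card ≤ r.natDegree := by
  classical
  rw [← Finset.card_image_of_injOn hT]
  refine le_trans (Finset.card_le_card (t := r.roots.toFinset) ?_)
    ((Multiset.toFinset_card_le _).trans (card_roots' r))
  intro a ha
  obtain ⟨Q, hQ, rfl⟩ := Finset.mem_image.1 ha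
  simp [hr, h Q hQ]

lemma bezout_card [IsDomain R] [UniqueFactorizationMonoid R] (π B : R[X][X])
    (hπ : Prime π) (hd : π.natDegree ≠ 0) (hB : ¬ π ∣ B)
    (T : Finset (R × R)) (hT : Set.InjOn Prod.fst (T : Set (R × R)))
    (h : ∀ Q ∈ T, ev Q π = 0 ∧ ev Q B = 0) :
    T.card ≤ B.natDegree * degZ π + π.natDegree * degZ B := by
  obtain ⟨r, hr, hdr, p, q, hpq⟩ := bezout π B hπ hd hB
  refine (card_roots_le T hT r hr ?_).trans hdr
  intro Q hQ
  rw [← ev_C, ← hpq, map_add, map_mul, map_mul, (h Q hQ).1, (h Q hQ).2]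
  ring

end Stmt15

open Finset Pointwise

namespace Stmt15
open Polynomial

lemma natDegree_sub_le' {R S : Type*} [CommRing R] [CommRing S] (f : R →+* S[X]) (ζ η : S[X])
    (P : R[X][X]) (a b c : ℕ) (ha : ∀ i j, (f ((P.coeff i).coeff j)).natDegree ≤ a)
    (hb : ζ.natDegree ≤ b) (hc : η.natDegree ≤ c) :
    (sub f ζ η P).natDegree ≤ a + degZ P * b + P.natDegree * c := by
  have h1 : sub f ζ η P = ∑ i ∈ range (P.natDegree + 1), (∑ j ∈ range (degZ P + 1),
      f ((P.coeff i).coeff j) * ζ ^ j) * η ^ i := by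
    simp only [sub, coe_eval₂RingHom]
    rw [eval₂_eq_sum_range]
    simp only [coe_eval₂RingHom]
    refine Finset.sum_congr rfl fun i _ => ?_
    congr 1
    rw [eval₂_eq_sum_range' f (Nat.lt_succ_of_le ((degZ_le_iff P _).1 le_rfl i))]
  rw [h1]
  refine natDegree_sum_le_of_forall_le _ _ fun i hi => ?_
  refine natDegree_mul_le.trans (add_le_add (natDegree_sum_le_of_forall_le _ _ fun j hj => ?_) ?_)
  · refine natDegree_mul_le.trans (add_le_add (ha i j) (natDegree_pow_le.trans ?_))
    exact Nat.mul_le_mul (Nat.lt_succ_iff.1 (Finset.mem_range.1 hj)) hb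
  · exact natDegree_pow_le.trans (Nat.mul_le_mul (Nat.lt_succ_iff.1 (Finset.mem_range.1 hi)) hc)

section
variable {R : Type*} [CommRing R] [IsDomain R]

lemma line_case (p : ℕ) (hp : ∀ e : ℕ, 0 < e → e < p → (e : R) ≠ 0)
    (P M : R[X][X]) (hdeg : P.natDegree + degZ P < p) (hM : RR P = P * M)
    (u y α β : R) (h0 : ev (u, y) P = 0) (hβ : ev (u, y) (derivative P) = β)
    (hα : ev (u, y) (dZ P) = -α) (hβ0 : β ≠ 0) :
    sub C (C u + C β * X) (C y + C α * X) P = 0 := by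
  set ζ : R[X] := C u + C β * X with hζ
  set η : R[X] := C y + C α * X with hη
  have hdζ : derivative ζ = C β := by simp [hζ]
  have hdη : derivative η = C α := by simp [hη]
  have hC : ∀ r : R, derivative (C r) = 0 := fun r => derivative_C
  set ψ := sub C ζ η with hψ
  have hψ0 : ∀ F, (ψ F).coeff 0 = ev (u, y) F := by
    intro F
    rw [coeff_zero_eq_eval_zero, ← coe_evalRingHom, hψ, sub_comp, ev]
    congr 1
    · simp only [hζ, hη]
      congr 1
      · ext; simp
      · simp
      · simp
  have e1 : derivative (ψ P) = ψ (derivative P) * C α + ψ (dZ P) * C β := by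
    rw [hψ, chain _ hC, hdζ, hdη]
  have e2 : derivative (derivative (ψ P)) =
      (ψ (derivative (derivative P)) * C α + ψ (dZ (derivative P)) * C β) * C α
      + (ψ (derivative (dZ P)) * C α + ψ (dZ (dZ P)) * C β) * C β := by
    rw [e1, derivative_add, derivative_mul, derivative_mul, hψ, chain _ hC, chain _ hC, hdζ, hdη]
    simp
  have hdg : (ψ P).natDegree < p := by
    have := natDegree_sub_le' C ζ η P 0 1 1 (by simp) (by rw [hζ]; compute_degree)
      (by rw [hη]; compute_degree)
    rw [← hψ] at this
    omega
  set g := ψ P with hg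
  by_contra hne
  have hc0 : g.coeff 0 = 0 := by rw [hψ0, h0]
  have hc1 : g.coeff 1 = 0 := by
    have : (derivative g).coeff 0 = 0 := by
      rw [e1, coeff_add, coeff_mul_C, coeff_mul_C, hψ0, hψ0, hβ, hα]; ring
    simpa [coeff_derivative] using this
  obtain ⟨f, hf⟩ : ∃ f, g.natTrailingDegree = f + 2 := by
    have : g.coeff g.natTrailingDegree ≠ 0 := by
      simpa [Polynomial.trailingCoeff] using (trailingCoeff_nonzero_iff_nonzero.2 hne)
    rcases hh : g.natTrailingDegree with _ | _ | f
    · rw [hh] at this; exact absurd hc0 this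
    · rw [hh] at this; exact absurd hc1 this
    · exact ⟨f, rfl⟩
  have hcf : g.coeff (f + 2) ≠ 0 := by
    have := (trailingCoeff_nonzero_iff_nonzero.2 hne)
    rwa [Polynomial.trailingCoeff, hf] at this
  have hlow : ∀ d, d < f + 2 → g.coeff d = 0 := fun d hd =>
    coeff_eq_zero_of_lt_natTrailingDegree (by rw [hf]; exact hd)
  have hfp : f + 2 < p := by
    have : f + 2 ≤ g.natDegree := le_natDegree_of_ne_zero hcf
    omega
  have d1 : X ^ (f + 1) ∣ g := X_pow_dvd_iff.2 fun d hd => hlow d (by omega)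
  have d2 : X ^ (f + 1) ∣ derivative g := X_pow_dvd_iff.2 fun d hd => by
    rw [coeff_derivative, hlow (d + 1) (by omega), zero_mul]
  have hR : ψ (RR P) = g * ψ M := by rw [hM, map_mul]
  have hid : ψ (derivative P) ^ 2 * derivative (derivative g) =
      g * (C β ^ 2 * ψ M) + derivative g * (-(ψ (derivative (derivative P)) * derivative g
        - 2 * C α * ψ (derivative (derivative P)) * ψ (derivative P)
        - C β * (ψ (dZ (derivative P)) + ψ (derivative (dZ P))) * ψ (derivative P))) := by
    rw [e2, e1]
    rw [RR] at hR
    simp only [map_add, map_sub, map_mul, map_pow] at hR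
    linear_combination (C β ^ 2) * hR
  have d3 : X ^ (f + 1) ∣ ψ (derivative P) ^ 2 * derivative (derivative g) := by
    rw [hid]
    exact dvd_add (d1.mul_right _) (d2.mul_right _)
  have d4 : X ^ (f + 1) ∣ derivative (derivative g) := by
    refine prime_X.pow_dvd_of_dvd_mul_left _ ?_ d3
    intro h
    have := prime_X.dvd_of_dvd_pow h
    rw [X_dvd_iff, hψ0, hβ] at this
    exact hβ0 this
  have d5 := X_pow_dvd_iff.1 d4 f (by omega)
  rw [coeff_derivative, coeff_derivative] at d5
  have n1 := hp (f + 1) (by omega) (by omega)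
  have n2 := hp (f + 2) (by omega) (by omega)
  push_cast at d5 n1 n2
  rw [add_assoc (f : R) 1 1, one_add_one_eq_two] at d5
  exact (mul_ne_zero (mul_ne_zero hcf n2) n1) d5

lemma degZ_mul (A B : R[X][X]) (hA : A ≠ 0) (hB : B ≠ 0) :
    degZ (A * B) = degZ A + degZ B := by
  rw [degZ, map_mul, natDegree_mul]
  · rfl
  · simpa using hA
  · simpa using hB

variable [UniqueFactorizationMonoid R]

open Classical in
lemma prime_case (p : ℕ) (hp : ∀ e : ℕ, 0 < e → e < p → (e : R) ≠ 0)
    (T : Finset (R × R)) (hT : Set.InjOn Prod.fst (T : Set (R × R))) (k : ℕ) (hk1 : 1 ≤ k)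
    (hk : ∀ Q0 ∈ T, ∀ α β : R, β ≠ 0 →
      (T.filter (fun Q => β * (Q.2 - Q0.2) = α * (Q.1 - Q0.1))).card ≤ k)
    (π : R[X][X]) (hπ : Prime π) (hdeg : π.natDegree + degZ π < p) :
    (T.filter (fun Q => ev Q π = 0 ∧ ev Q (RR π) = 0)).card ≤
      6 * (π.natDegree * degZ π) + k * (π.natDegree + degZ π) := by
  set G := T.filter (fun Q => ev Q π = 0 ∧ ev Q (RR π) = 0) with hG
  have hGT : G ⊆ T := Finset.filter_subset _ _
  have hGi : Set.InjOn Prod.fst (G : Set (R × R)) := hT.mono (by exact_mod_cast hGT)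
  by_cases hd : π.natDegree = 0
  · obtain ⟨a, ha⟩ : ∃ a, π = C a := ⟨_, eq_C_of_natDegree_eq_zero hd⟩
    have ha0 : a ≠ 0 := by rintro rfl; exact hπ.ne_zero (by simpa using ha)
    have h1 : G.card ≤ a.natDegree := card_roots_le G hGi a ha0 fun Q hQ => by
      rw [← ev_C, ← ha]; exact (Finset.mem_filter.1 hQ).2.1
    have h2 : a.natDegree ≤ degZ π := by
      have := (degZ_le_iff π _).1 le_rfl 0
      rwa [ha, coeff_C_zero, ← ha] at this
    have h3 : degZ π ≤ k * (π.natDegree + degZ π) := by nlinarith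
    omega
  by_cases hRR : π ∣ RR π
  swap
  · have := bezout_card π _ hπ hd hRR G hGi fun Q hQ => (Finset.mem_filter.1 hQ).2
    have h1 := natDegree_RR π
    have h2 := degZ_RR π
    nlinarith [Nat.mul_le_mul_right (degZ π) h1, Nat.mul_le_mul_left π.natDegree h2]
  by_cases hall : ∀ Q ∈ G, ev Q (derivative π) = 0
  · have hnd : ¬ π ∣ derivative π := by
      intro h
      have hne : derivative π ≠ 0 := by
        intro h0
        have h1 : (derivative π).coeff (π.natDegree - 1) = 0 := by rw [h0, coeff_zero]
        rw [coeff_derivative, Nat.sub_add_cancel (by omega)] at h1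
        have h2 : π.leadingCoeff ≠ 0 := by simpa using hπ.ne_zero
        have h3 := hp π.natDegree (by omega) (by omega)
        have h4 : ((π.natDegree - 1 : ℕ) : R[X]) + 1 = C (π.natDegree : R) := by
          rw [← Nat.cast_succ, Nat.succ_eq_add_one, Nat.sub_add_cancel (by omega)]; simp
        rw [h4] at h1
        exact mul_ne_zero h2 (by rw [Ne, C_eq_zero]; exact h3) h1
      have h1 := natDegree_le_of_dvd h hne
      have h2 := natDegree_derivative_lt hd
      omega
    have := bezout_card π _ hπ hd hnd G hGi fun Q hQ => ⟨(Finset.mem_filter.1 hQ).2.1, hall Q hQ⟩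
    have h1 := natDegree_der π
    have h2 := degZ_derivative π
    nlinarith [Nat.mul_le_mul_right (degZ π) h1, Nat.mul_le_mul_left π.natDegree h2]
  · push Not at hall
    obtain ⟨⟨u, y⟩, hQ, hβ0⟩ := hall
    obtain ⟨M, hM⟩ := hRR
    set β := ev (u, y) (derivative π) with hβ
    obtain ⟨α, hα⟩ : ∃ α, ev (u, y) (dZ π) = -α := ⟨- ev (u, y) (dZ π), by simp⟩
    have hline := line_case p hp π M hdeg hM u y α β (Finset.mem_filter.1 hQ).2.1 hβ.symm hα hβ0
    set ℓ : R[X][X] := C (C β) * (X - C (C y)) - C (C α * (X - C u)) with hℓ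
    have hdvd : π ∣ ℓ := by
      by_contra hnd
      obtain ⟨r, hr, -, s, t, hst⟩ := bezout π ℓ hπ hd hnd
      have h1 := congrArg (sub C (C u + C β * X) (C y + C α * X)) hst
      rw [map_add, map_mul, map_mul, hline, sub_C] at h1
      have h2 : sub C (C u + C β * X) (C y + C α * X) ℓ = 0 := by
        simp only [hℓ, map_sub, map_mul, sub_C, sub_X, eval₂_C, eval₂_sub, eval₂_mul, eval₂_X]
        ring
      rw [h2, zero_mul, zero_mul, zero_add] at h1
      have h3 : r.comp (C u + C β * X) = 0 := h1.symm
      rw [comp_eq_zero_iff] at h3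
      rcases h3 with h3 | ⟨_, h3⟩
      · exact hr h3
      · have := congrArg (fun q => q.coeff 1) h3
        simp at this
        exact hβ0 this
    have hsub : G ⊆ T.filter (fun Q => β * (Q.2 - y) = α * (Q.1 - u)) := by
      intro Q hQ'
      rw [Finset.mem_filter]
      refine ⟨hGT hQ', ?_⟩
      obtain ⟨s, hs⟩ := hdvd
      have h1 := congrArg (ev Q) hs
      rw [map_mul, (Finset.mem_filter.1 hQ').2.1, zero_mul] at h1
      simp only [hℓ, ev, map_sub, map_mul, sub_C, sub_X, eval₂_C, eval₂_sub, eval₂_mul,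
        eval₂_X, RingHom.id_apply] at h1
      exact sub_eq_zero.1 h1
    have h1 := (Finset.card_le_card hsub).trans (hk (u, y) (hGT hQ) α β hβ0)
    have h3 : k ≤ k * (π.natDegree + degZ π) := Nat.le_mul_of_pos_right _ (by omega)
    omega

open Classical in
lemma plane_curve (p : ℕ) (hp : ∀ e : ℕ, 0 < e → e < p → (e : R) ≠ 0)
    (T : Finset (R × R)) (hT : Set.InjOn Prod.fst (T : Set (R × R))) (k : ℕ) (hk1 : 1 ≤ k)
    (hk : ∀ Q0 ∈ T, ∀ α β : R, β ≠ 0 →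
      (T.filter (fun Q => β * (Q.2 - Q0.2) = α * (Q.1 - Q0.1))).card ≤ k)
    (P : R[X][X]) : Squarefree P → P.natDegree + degZ P < p →
    (T.filter (fun Q => ev Q P = 0 ∧ ev Q (RR P) = 0)).card ≤
      6 * (P.natDegree * degZ P) + k * (P.natDegree + degZ P) := by
  induction P using UniqueFactorizationMonoid.induction_on_prime with
  | h₁ => intro h; exact absurd h not_squarefree_zero
  | h₂ x hx =>
    intro _ _
    rw [Finset.filter_false_of_mem]
    · simp
    · intro Q _ h
      exact (hx.map (ev Q)).ne_zero h.1
  | h₃ B π hB hπ ih =>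
    intro hsq hdeg
    have hnd : ¬ π ∣ B := by
      rintro ⟨c, rfl⟩
      exact hπ.not_isUnit (hsq π ⟨c, by ring⟩)
    have hsqB : Squarefree B := hsq.squarefree_of_dvd (dvd_mul_left _ _)
    have hdm := degZ_mul π B hπ.ne_zero hB
    have hnm := natDegree_mul hπ.ne_zero hB
    rw [hdm, hnm] at hdeg ⊢
    have ihB := ih hsqB (by omega)
    have ihπ := prime_case p hp T hT k hk1 hk π hπ (by omega)
    by_cases hd : π.natDegree = 0
    · obtain ⟨a, ha⟩ : ∃ a, π = C a := ⟨_, eq_C_of_natDegree_eq_zero hd⟩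
      have ha0 : a ≠ 0 := by rintro rfl; exact hπ.ne_zero (by simpa using ha)
      set I := T.filter (fun Q => ev Q π = 0) with hI
      have hIi : Set.InjOn Prod.fst (I : Set (R × R)) :=
        hT.mono (by exact_mod_cast Finset.filter_subset _ _)
      have h1 : I.card ≤ a.natDegree := card_roots_le I hIi a ha0 fun Q hQ => by
        rw [← ev_C, ← ha]; exact (Finset.mem_filter.1 hQ).2
      have h2 : a.natDegree ≤ degZ π := by
        have := (degZ_le_iff π _).1 le_rfl 0
        rwa [ha, coeff_C_zero, ← ha] at this
      have hsub : (T.filter (fun Q => ev Q (π * B) = 0 ∧ ev Q (RR (π * B)) = 0)) ⊆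
          I ∪ (T.filter (fun Q => ev Q B = 0 ∧ ev Q (RR B) = 0)) := by
        intro Q hQ
        simp only [hI, Finset.mem_union, Finset.mem_filter] at hQ ⊢
        obtain ⟨hQT, h1, h2⟩ := hQ
        rw [map_mul, mul_eq_zero] at h1
        by_cases a1 : ev Q π = 0
        · exact Or.inl ⟨hQT, a1⟩
        · have a2 : ev Q B = 0 := by tauto
          rw [mul_comm, RR_mul _ _ _ a2, mul_eq_zero] at h2
          rcases h2 with h2 | h2
          · exact absurd (pow_eq_zero_iff (by norm_num) |>.1 h2) a1
          · exact Or.inr ⟨hQT, a2, h2⟩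
      have h4 := (Finset.card_le_card hsub).trans (Finset.card_union_le _ _)
      rw [hd]
      nlinarith
    set I := T.filter (fun Q => ev Q π = 0 ∧ ev Q B = 0) with hI
    have hIc : I.card ≤ B.natDegree * degZ π + π.natDegree * degZ B := by
      have hIi : Set.InjOn Prod.fst (I : Set (R × R)) :=
        hT.mono (by exact_mod_cast Finset.filter_subset _ _)
      exact bezout_card π B hπ hd hnd I hIi fun Q hQ => (Finset.mem_filter.1 hQ).2
    have hsub : (T.filter (fun Q => ev Q (π * B) = 0 ∧ ev Q (RR (π * B)) = 0)) ⊆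
        (T.filter (fun Q => ev Q π = 0 ∧ ev Q (RR π) = 0)) ∪
        (T.filter (fun Q => ev Q B = 0 ∧ ev Q (RR B) = 0)) ∪ I := by
      intro Q hQ
      simp only [hI, Finset.mem_union, Finset.mem_filter] at hQ ⊢
      obtain ⟨hQT, h1, h2⟩ := hQ
      rw [map_mul, mul_eq_zero] at h1
      by_cases a1 : ev Q π = 0 <;> by_cases a2 : ev Q B = 0
      · exact Or.inr ⟨hQT, a1, a2⟩
      · rw [RR_mul _ _ _ a1, mul_eq_zero] at h2
        rcases h2 with h2 | h2
        · exact absurd (pow_eq_zero_iff (by norm_num) |>.1 h2) a2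
        · exact Or.inl (Or.inl ⟨hQT, a1, h2⟩)
      · rw [mul_comm, RR_mul _ _ _ a2, mul_eq_zero] at h2
        rcases h2 with h2 | h2
        · exact absurd (pow_eq_zero_iff (by norm_num) |>.1 h2) a1
        · exact Or.inl (Or.inr ⟨hQT, a2, h2⟩)
      · tauto
    have h4 := Finset.card_le_card hsub
    have h5 := Finset.card_union_le ((T.filter (fun Q => ev Q π = 0 ∧ ev Q (RR π) = 0)) ∪
        (T.filter (fun Q => ev Q B = 0 ∧ ev Q (RR B) = 0))) I
    have h6 := Finset.card_union_le (T.filter (fun Q => ev Q π = 0 ∧ ev Q (RR π) = 0))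
        (T.filter (fun Q => ev Q B = 0 ∧ ev Q (RR B) = 0))
    nlinarith
end
end Stmt15

open Finset Pointwise

namespace Stmt15
open Polynomial

lemma map_RR {R S : Type*} [CommRing R] [CommRing S] (ψ : R[X][X] →+* S) (P : R[X][X]) :
    ψ (RR P) = ψ (derivative (derivative P)) * ψ (dZ P) ^ 2
    - (ψ (dZ (derivative P)) + ψ (derivative (dZ P))) * ψ (derivative P) * ψ (dZ P)
    + ψ (dZ (dZ P)) * ψ (derivative P) ^ 2 := by
  simp only [RR, map_add, map_sub, map_mul, map_pow]

open Classical in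
lemma plane_curve_all {R : Type*} [CommRing R] [IsDomain R] [UniqueFactorizationMonoid R]
    (p : ℕ) (hp : ∀ e : ℕ, 0 < e → e < p → (e : R) ≠ 0)
    (T : Finset (R × R)) (hT : Set.InjOn Prod.fst (T : Set (R × R))) (k : ℕ) (hk1 : 1 ≤ k)
    (hk : ∀ Q0 ∈ T, ∀ α β : R, β ≠ 0 →
      (T.filter (fun Q => β * (Q.2 - Q0.2) = α * (Q.1 - Q0.1))).card ≤ k)
    (P : R[X][X]) (hsq : Squarefree P) (hd : P.natDegree + degZ P < p)
    (hall : ∀ Q ∈ T, ev Q P = 0 ∧ ev Q (RR P) = 0) :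
    T.card ≤ 6 * (P.natDegree * degZ P) + k * (P.natDegree + degZ P) := by
  have := plane_curve p hp T hT k hk1 hk P hsq hd
  rwa [Finset.filter_true_of_mem hall] at this

lemma exists_rad {M : Type*} [CommRing M] [IsDomain M] [UniqueFactorizationMonoid M] (a : M)
    (ha : a ≠ 0) : ∃ P, Squarefree P ∧ P ∣ a ∧ ∃ n, a ∣ P ^ n := by
  obtain ⟨inst⟩ : Nonempty (NormalizationMonoid M) := inferInstance
  exact ⟨UniqueFactorizationMonoid.radical a, UniqueFactorizationMonoid.squarefree_radical,
    UniqueFactorizationMonoid.radical_dvd_self,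
    UniqueFactorizationMonoid.exists_dvd_radical_self_pow ha⟩

section
variable {K : Type*} [Field K]

/-- degree in the innermost variable -/
noncomputable def degX (P : K[X][X][X]) : ℕ :=
  degZ (P.map (Bivariate.swap (R := K) : K[X][X] ≃ₐ[K] K[X][X]).toRingEquiv.toRingHom)

lemma degX_le_iff (P : K[X][X][X]) (d : ℕ) :
    degX P ≤ d ↔ ∀ i j, ((P.coeff i).coeff j).natDegree ≤ d := by
  rw [degX, degZ_le_iff]
  refine forall_congr' fun i => ?_
  rw [coeff_map, ← degZ_le_iff]
  rfl

lemma degX_mul (P Q : K[X][X][X]) (hP : P ≠ 0) (hQ : Q ≠ 0) :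
    degX (P * Q) = degX P + degX Q := by
  have hinj : Function.Injective
    (Bivariate.swap (R := K) : K[X][X] ≃ₐ[K] K[X][X]).toRingEquiv.toRingHom :=
    (Bivariate.swap (R := K)).injective
  rw [degX, Polynomial.map_mul, degZ_mul]
  · rfl
  · rwa [Ne, Polynomial.map_eq_zero_iff hinj]
  · rwa [Ne, Polynomial.map_eq_zero_iff hinj]

/-- bounded degrees -/
def Box (a b : ℕ) (P : K[X][X][X]) : Prop :=
  P.natDegree ≤ b ∧ degZ P ≤ b ∧ degX P ≤ a

lemma Box.of_dvd {a b : ℕ} {P Q : K[X][X][X]} (hQ : Box a b Q) (hQ0 : Q ≠ 0) (h : P ∣ Q) :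
    Box a b P := by
  obtain ⟨c, rfl⟩ := h
  have hP := left_ne_zero_of_mul hQ0
  have hc := right_ne_zero_of_mul hQ0
  obtain ⟨h1, h2, h3⟩ := hQ
  rw [natDegree_mul hP hc] at h1
  rw [degZ_mul _ _ hP hc] at h2
  rw [degX_mul _ _ hP hc] at h3
  exact ⟨by omega, by omega, by omega⟩

lemma Box.derivative {a b : ℕ} {P : K[X][X][X]} (h : Box a b P) : Box a b (derivative P) := by
  refine ⟨(natDegree_der P).trans h.1, (degZ_derivative P).trans h.2.1, ?_⟩
  rw [degX_le_iff]
  intro i j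
  rw [coeff_derivative]
  have : ((i : K[X][X]) + 1) = C (C ((i : K) + 1)) := by simp
  rw [this, coeff_mul_C]
  exact (natDegree_mul_C_le _ _).trans ((degX_le_iff P a).1 h.2.2 _ _)

lemma Box.dZ {a b : ℕ} {P : K[X][X][X]} (h : Box a b P) : Box a b (dZ P) := by
  refine ⟨(natDegree_dZ P).trans h.1, (degZ_dZ P).trans h.2.1, ?_⟩
  rw [degX_le_iff]
  intro i j
  rw [dZ_coeff, coeff_derivative]
  have : ((j : K[X]) + 1) = (C ((j : K) + 1)) := by simp
  rw [this]
  exact (natDegree_mul_C_le _ _).trans ((degX_le_iff P a).1 h.2.2 _ _)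

/-- the point of K[X]^2 attached to a plane -/
noncomputable def pt (h : K × K × K) : K[X] × K[X] := (C h.1, - C h.2.1 * X - C h.2.2)

lemma natDegree_ev {a b : ℕ} {P : K[X][X][X]} (hP : Box a b P) (h : K × K × K) :
    (ev (pt h) P).natDegree ≤ a + b := by
  have := natDegree_sub_le' (RingHom.id K[X]) (pt h).1 (pt h).2 P a 0 1
    (fun i j => (degX_le_iff P a).1 hP.2.2 i j) (by simp [pt]) (by
      simp only [pt]; rw [← C_neg]; compute_degree)
  have h1 := hP.1
  rw [ev]
  omega

lemma natDegree_ev_RR {a b : ℕ} {P : K[X][X][X]} (hP : Box a b P) (h : K × K × K) :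
    (ev (pt h) (RR P)).natDegree ≤ 3 * (a + b) := by
  simp only [RR, map_add, map_sub, map_mul, map_pow]
  exact natDegree_combo _ _ _ _ _ _ (natDegree_ev hP.derivative.derivative h)
    (natDegree_ev hP.dZ h) (natDegree_ev hP.derivative.dZ h) (natDegree_ev hP.dZ.derivative h)
    (natDegree_ev hP.derivative h) _ (natDegree_ev hP.dZ.dZ h)

/-- incidence; q = (y, x, z), h = (u, v, w) -/
def inc (h q : K × K × K) : Prop := h.1 * q.2.1 + h.2.1 * q.1 + q.2.2 + h.2.2 = 0

/-- restriction to the line of q -/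
noncomputable def lin (q : K × K × K) : K[X][X][X] →+* K[X] :=
  sub (C.comp (evalRingHom q.1)) X (C q.2.1 * X + C q.2.2)

lemma lin_RR (q : K × K × K) (P : K[X][X][X]) (h : lin q P = 0) : lin q (RR P) = 0 := by
  have hC : ∀ r : K[X], derivative ((C.comp (evalRingHom q.1)) r) = 0 := fun r => by simp
  have ch : ∀ F, derivative (lin q F) = lin q (derivative F) * C q.2.1 + lin q (dZ F) := by
    intro F
    rw [lin, chain _ hC]
    simp
  have e1 := ch P
  have e2 := congrArg derivative e1
  simp only [derivative_add, derivative_mul, ch, derivative_C, mul_zero, add_zero, h,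
    derivative_zero] at e1 e2
  have e3 : lin q (dZ P) = - (lin q (derivative P) * C q.2.1) := by linear_combination -e1
  rw [map_RR, e3]
  linear_combination -(lin q (derivative P)) ^ 2 * e2

lemma eval_ev_of_inc (h q : K × K × K) (hi : inc h q) (F : K[X][X][X]) :
    (ev (pt h) F).eval q.1 = (lin q F).eval h.1 := by
  rw [← coe_evalRingHom, ← coe_evalRingHom, ev, lin, sub_comp, sub_comp]
  have h1 : (evalRingHom q.1) (pt h).2 = (evalRingHom h.1) (C q.2.1 * X + C q.2.2) := by
    simp [pt]
    rw [inc] at hi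
    linear_combination -hi
  have h2 : (evalRingHom q.1) (pt h).1 = (evalRingHom h.1) X := by simp [pt]
  rw [h1, h2]
  congr 1
  congr 1
  ext <;> simp

open Classical in
/-- assembling a polynomial from coefficients -/
noncomputable def asm (a b : ℕ) (v : Fin (b + 1) × Fin (b + 1) × Fin (a + 1) → K) : K[X][X][X] :=
  ofFn (b + 1) (fun l => ofFn (b + 1) (fun j => ofFn (a + 1) (fun i => v (l, j, i))))

open Classical in
lemma asm_coeff (a b : ℕ) (v : Fin (b + 1) × Fin (b + 1) × Fin (a + 1) → K) (l j i : ℕ) :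
    (((asm a b v).coeff l).coeff j).coeff i =
      if h : l < b + 1 ∧ j < b + 1 ∧ i < a + 1 then v (⟨l, h.1⟩, ⟨j, h.2.1⟩, ⟨i, h.2.2⟩) else 0 := by
  rw [asm]
  by_cases hl : l < b + 1
  swap
  · rw [ofFn_coeff_eq_zero_of_ge _ (by omega)]; simp [hl]
  by_cases hj : j < b + 1
  swap
  · rw [ofFn_coeff_eq_val_of_lt _ hl, ofFn_coeff_eq_zero_of_ge _ (by omega)]; simp [hj]
  by_cases hi : i < a + 1
  swap
  · rw [ofFn_coeff_eq_val_of_lt _ hl, ofFn_coeff_eq_val_of_lt _ hj,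
      ofFn_coeff_eq_zero_of_ge _ (by omega)]; simp [hi]
  rw [ofFn_coeff_eq_val_of_lt _ hl, ofFn_coeff_eq_val_of_lt _ hj, ofFn_coeff_eq_val_of_lt _ hi]
  simp [hl, hj, hi]

lemma asm_add (a b : ℕ) (v w : Fin (b + 1) × Fin (b + 1) × Fin (a + 1) → K) :
    asm a b (v + w) = asm a b v + asm a b w := by
  ext l j i
  simp only [coeff_add, asm_coeff]
  split_ifs <;> simp

lemma asm_smul (a b : ℕ) (c : K) (v : Fin (b + 1) × Fin (b + 1) × Fin (a + 1) → K) :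
    asm a b (c • v) = C (C (C c)) * asm a b v := by
  ext l j i
  simp only [coeff_C_mul, asm_coeff]
  split_ifs <;> simp

lemma asm_box (a b : ℕ) (v : Fin (b + 1) × Fin (b + 1) × Fin (a + 1) → K) :
    Box a b (asm a b v) := by
  refine ⟨?_, ?_, ?_⟩
  · rw [natDegree_le_iff_coeff_eq_zero]
    intro N hN
    ext j i
    rw [asm_coeff, dif_neg (by omega)]; simp
  · rw [degZ_le_iff]
    intro l
    rw [natDegree_le_iff_coeff_eq_zero]
    intro N hN
    ext i
    rw [asm_coeff, dif_neg (by omega)]; simp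
  · rw [degX_le_iff]
    intro l j
    rw [natDegree_le_iff_coeff_eq_zero]
    intro N hN
    rw [asm_coeff, dif_neg (by omega)]

lemma exists_vanishing (a b : ℕ) (L : Finset (K × K × K))
    (hL : L.card * (2 * b + 1) < (b + 1) * ((b + 1) * (a + 1))) :
    ∃ P : K[X][X][X], P ≠ 0 ∧ Box a b P ∧ ∀ q ∈ L, lin q P = 0 := by
  let Ψ : (Fin (b + 1) × Fin (b + 1) × Fin (a + 1) → K) →ₗ[K] (L × Fin (2 * b + 1) → K) :=
    { toFun := fun v s => (lin s.1.1 (asm a b v)).coeff s.2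
      map_add' := by
        intro v w
        ext s
        simp [asm_add]
      map_smul' := by
        intro c v
        ext s
        have : lin s.1.1 (C (C (C c))) = C c := by simp [lin, sub_C]
        simp [asm_smul, this] }
  have hk : LinearMap.ker Ψ ≠ ⊥ := by
    apply LinearMap.ker_ne_bot_of_finrank_lt
    simpa [Module.finrank_fintype_fun_eq_card] using hL
  obtain ⟨v, hv, hv0⟩ := Submodule.exists_mem_ne_zero_of_ne_bot hk
  refine ⟨asm a b v, ?_, asm_box a b v, ?_⟩
  · intro h
    apply hv0
    ext ⟨l, j, i⟩
    have := asm_coeff a b v l j i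
    rw [h, dif_pos ⟨l.2, j.2, i.2⟩] at this
    simpa using this.symm
  · intro q hq
    ext t
    rw [coeff_zero]
    by_cases ht : t < 2 * b + 1
    · exact congrFun (LinearMap.mem_ker.1 hv) (⟨q, hq⟩, ⟨t, ht⟩)
    · apply coeff_eq_zero_of_natDegree_lt
      have hb := asm_box a b v
      have := natDegree_sub_le' (C.comp (evalRingHom q.1)) X (C q.2.1 * X + C q.2.2) (asm a b v)
        0 1 1 (by simp) natDegree_X_le (by compute_degree)
      rw [← lin] at this
      have h1 := hb.1
      have h2 := hb.2.1
      omega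

open Classical in
/-- collinearity bound -/
def Col (M : ℕ) (L : Finset (K × K × K)) : Prop :=
  ∀ h0 ∈ L, ∀ h1 ∈ L, h0 ≠ h1 →
    (L.filter (fun h => (h.2.1 - h0.2.1) * (h1.1 - h0.1) = (h1.2.1 - h0.2.1) * (h.1 - h0.1) ∧
      (h.2.2 - h0.2.2) * (h1.1 - h0.1) = (h1.2.2 - h0.2.2) * (h.1 - h0.1))).card ≤ M

lemma pt_inj (L : Finset (K × K × K)) (hL : Set.InjOn Prod.fst (L : Set (K × K × K))) :
    Set.InjOn pt (L : Set (K × K × K)) := by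
  intro h hh h' hh' e
  apply hL hh hh'
  simpa [pt] using congrArg Prod.fst e

open Classical in
lemma core (p M : ℕ) (hp : ∀ e : ℕ, 0 < e → e < p → (e : K) ≠ 0) (hM1 : 1 ≤ M) (hMp : M ≤ p)
    (L1 L2 : Finset (K × K × K))
    (i1 : Set.InjOn Prod.fst (L1 : Set (K × K × K)))
    (i2 : Set.InjOn Prod.fst (L2 : Set (K × K × K)))
    (h12 : L1.card ≤ L2.card) (hm : L1.card ≤ M ^ 2) (hcol : Col M L2) (hne : L2.Nonempty)
    (hrich : ∀ h ∈ L2, 49 * M < (L1.filter (fun q => inc h q)).card) : False := by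
  set m := L1.card with hmdef
  set B := m / (8 * M) with hB
  have hB1 : 8 * M * B ≤ m := Nat.mul_div_le _ _
  have hB2 : m < 8 * M * (B + 1) := by
    have := Nat.lt_mul_div_succ m (show 0 < 8 * M by omega)
    simpa [hB] using this
  have hB3 : 8 * B ≤ M := by
    have : 8 * M * B ≤ M * M := by nlinarith
    have : M * (8 * B) ≤ M * M := by nlinarith
    exact Nat.le_of_mul_le_mul_left this (by omega)
  have hdim : L1.card * (2 * B + 1) < (B + 1) * ((B + 1) * (16 * M + 1)) := by
    rw [← hmdef]
    have : m * (2 * (B + 1)) < 8 * M * (B + 1) * (2 * (B + 1)) :=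
      Nat.mul_lt_mul_of_pos_right hB2 (by omega)
    nlinarith
  obtain ⟨P0, hP0, hbox0, hvan0⟩ := exists_vanishing (16 * M) B L1 hdim
  obtain ⟨P, hsq, hdvd, n, hn⟩ := exists_rad P0 hP0
  have hbox := hbox0.of_dvd hP0 hdvd
  have hvan : ∀ q ∈ L1, lin q P = 0 := by
    intro q hq
    have h1 : lin q P ^ n = 0 := by
      obtain ⟨c, hc⟩ := hn
      rw [← map_pow, hc, map_mul, hvan0 q hq, zero_mul]
    by_contra h2
    exact pow_ne_zero n h2 h1
  have key : ∀ h ∈ L2, ∀ F : K[X][X][X], (∀ q ∈ L1, lin q F = 0) →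
      (ev (pt h) F).natDegree ≤ 49 * M → ev (pt h) F = 0 := by
    intro h hh F hF hdeg
    by_contra hne0
    have hr := hrich h hh
    have hinj : Set.InjOn Prod.fst ((L1.filter (fun q => inc h q) : Finset _) : Set (K × K × K)) :=
      i1.mono (by exact_mod_cast Finset.filter_subset _ _)
    rw [← Finset.card_image_of_injOn hinj] at hr
    have : ((L1.filter (fun q => inc h q)).image Prod.fst) ⊆ (ev (pt h) F).roots.toFinset := by
      intro y hy
      obtain ⟨q, hq, rfl⟩ := Finset.mem_image.1 hy
      obtain ⟨hq1, hq2⟩ := Finset.mem_filter.1 hq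
      simp only [Multiset.mem_toFinset, mem_roots', IsRoot.def]
      refine ⟨hne0, ?_⟩
      rw [eval_ev_of_inc h q hq2, hF q hq1, eval_zero]
    have h2 := (Finset.card_le_card this).trans ((Multiset.toFinset_card_le _).trans (card_roots' _))
    omega
  set T := L2.image pt with hT
  have hTcard : T.card = L2.card := Finset.card_image_of_injOn (pt_inj L2 i2)
  have hTi : Set.InjOn Prod.fst (T : Set (K[X] × K[X])) := by
    intro Q hQ Q' hQ' e
    simp only [hT, Finset.coe_image] at hQ hQ'
    obtain ⟨h, hh, rfl⟩ := hQ
    obtain ⟨h', hh', rfl⟩ := hQ'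
    rw [i2 hh hh' (by simpa [pt] using e)]
  have hk : ∀ Q0 ∈ T, ∀ α β : K[X], β ≠ 0 →
      (T.filter (fun Q => β * (Q.2 - Q0.2) = α * (Q.1 - Q0.1))).card ≤ M := by
    intro Q0 hQ0 α β hβ
    obtain ⟨h0, hh0, rfl⟩ := Finset.mem_image.1 hQ0
    by_cases hsmall : (T.filter (fun Q => β * (Q.2 - (pt h0).2) = α * (Q.1 - (pt h0).1))).card ≤ 1
    · omega
    push Not at hsmall
    obtain ⟨Q1, hQ1, hne1⟩ := Finset.exists_mem_ne hsmall (pt h0)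
    rw [Finset.mem_filter] at hQ1
    obtain ⟨hQ1T, hQ1⟩ := hQ1
    obtain ⟨h1, hh1, rfl⟩ := Finset.mem_image.1 hQ1T
    have hne01 : h0 ≠ h1 := fun e => hne1 (by rw [e])
    refine le_trans ?_ (hcol h0 hh0 h1 hh1 hne01)
    refine le_trans (Finset.card_le_card ?_) (Finset.card_image_le (f := pt))
    intro Q hQ
    obtain ⟨hQT, hQe⟩ := Finset.mem_filter.1 hQ
    obtain ⟨h, hh, rfl⟩ := Finset.mem_image.1 hQT
    refine Finset.mem_image_of_mem _ (Finset.mem_filter.2 ⟨hh, ?_⟩)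
    have e : ((pt h).2 - (pt h0).2) * ((pt h1).1 - (pt h0).1) =
        ((pt h1).2 - (pt h0).2) * ((pt h).1 - (pt h0).1) := by
      apply mul_left_cancel₀ hβ
      linear_combination ((pt h1).1 - (pt h0).1) * hQe - ((pt h).1 - (pt h0).1) * hQ1
    simp only [pt, ← C_sub] at e
    have c0 := congrArg (fun f => coeff f 0) e
    have c1 := congrArg (fun f => coeff f 1) e
    simp only [coeff_mul_C, coeff_sub, ← C_neg, coeff_C_mul, coeff_X_zero, coeff_X_one, coeff_C_zero,
      coeff_C_succ] at c0 c1
    constructor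
    · linear_combination -c1
    · linear_combination -c0
  have hpR : ∀ e : ℕ, 0 < e → e < p → (e : K[X]) ≠ 0 := by
    intro e he hep h
    apply hp e he hep
    have : (C (e : K) : K[X]) = 0 := by simpa using h
    exact C_eq_zero.1 this
  have hb1 := hbox.1
  have hb2 := hbox.2.1
  have hall : ∀ Q ∈ T, ev Q P = 0 ∧ ev Q (RR P) = 0 := by
    intro Q hQ
    obtain ⟨h, hh, rfl⟩ := Finset.mem_image.1 hQ
    constructor
    · refine key h hh P hvan ((natDegree_ev hbox h).trans ?_)
      omega
    · refine key h hh _ (fun q hq => lin_RR q P (hvan q hq)) ((natDegree_ev_RR hbox h).trans ?_)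
      omega
  have hpc2 := plane_curve_all p hpR T hTi M hM1
    (by intro Q0 hQ0 α β hβ; convert hk Q0 hQ0 α β hβ) P hsq (by omega) hall
  rw [hTcard] at hpc2
  have hm0 : 0 < m := by
    obtain ⟨h, hh⟩ := hne
    have h1 := hrich h hh
    have h2 := Finset.card_filter_le L1 (fun q => inc h q)
    omega
  have h1 : P.natDegree * degZ P ≤ B * B := Nat.mul_le_mul hb1 hb2
  have h2 : M * (P.natDegree + degZ P) ≤ M * (2 * B) := Nat.mul_le_mul_left _ (by omega)
  have h3 : (8 * B) * B ≤ M * B := Nat.mul_le_mul_right _ hB3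
  nlinarith

end
end Stmt15

open Finset Pointwise

namespace Stmt15

section
variable {K : Type*} [Field K]

lemma inc_comm (h q : K × K × K) : inc h q ↔ inc q h := by
  unfold inc
  constructor <;> intro e <;> linear_combination e

open Classical in
lemma Col.mono {M : ℕ} {L L' : Finset (K × K × K)} (h : Col M L) (hs : L' ⊆ L) : Col M L' := by
  intro h0 hh0 h1 hh1 hne
  exact (Finset.card_le_card (Finset.filter_subset_filter _ hs)).trans
    (h h0 (hs hh0) h1 (hs hh1) hne)

open Classical in
/-- number of incidences -/
noncomputable def Inc (L1 L2 : Finset (K × K × K)) : ℕ :=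
  ∑ h ∈ L2, (L1.filter (fun q => inc h q)).card

open Classical in
lemma Inc_comm (L1 L2 : Finset (K × K × K)) : Inc L1 L2 = Inc L2 L1 := by
  simp only [Inc, Finset.card_filter]
  rw [Finset.sum_comm]
  simp only [inc_comm]

open Classical in
lemma Inc_erase (L1 L2 : Finset (K × K × K)) (h : K × K × K) (hh : h ∈ L2) :
    Inc L1 L2 = Inc L1 (L2.erase h) + (L1.filter (fun q => inc h q)).card := by
  rw [Inc, Inc, Finset.sum_erase_add _ _ hh]

open Classical in
theorem incidence (p M : ℕ) (hp : ∀ e : ℕ, 0 < e → e < p → (e : K) ≠ 0) (hM1 : 1 ≤ M)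
    (hMp : M ≤ p) (n : ℕ) : ∀ (L1 L2 : Finset (K × K × K)),
    L1.card + L2.card ≤ n →
    Set.InjOn Prod.fst (L1 : Set (K × K × K)) →
    Set.InjOn Prod.fst (L2 : Set (K × K × K)) →
    L1.card ≤ M ^ 2 → L2.card ≤ M ^ 2 → Col M L1 → Col M L2 →
    Inc L1 L2 ≤ 49 * M * (L1.card + L2.card) := by
  induction n with
  | zero =>
    intro L1 L2 hn
    have : L2 = ∅ := Finset.card_eq_zero.1 (by omega)
    subst this
    simp [Inc]
  | succ n ih =>
    intro L1 L2 hn i1 i2 c1 c2 col1 col2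
    by_cases a2 : ∃ h ∈ L2, (L1.filter (fun q => inc h q)).card ≤ 49 * M
    · obtain ⟨h, hh, hle⟩ := a2
      rw [Inc_erase L1 L2 h hh]
      have hc := Finset.card_erase_add_one hh
      have := ih L1 (L2.erase h) (by omega) i1 (i2.mono (by simp)) c1 (by omega) col1
        (col2.mono (Finset.erase_subset _ _))
      have e : 49 * M * (L1.card + L2.card) = 49 * M * (L1.card + (L2.erase h).card) + 49 * M := by
        rw [← hc]; ring
      omega
    by_cases a1 : ∃ h ∈ L1, (L2.filter (fun q => inc h q)).card ≤ 49 * M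
    · obtain ⟨h, hh, hle⟩ := a1
      rw [Inc_comm, Inc_erase L2 L1 h hh, Inc_comm]
      have hc := Finset.card_erase_add_one hh
      have := ih (L1.erase h) L2 (by omega) (i1.mono (by simp)) i2 (by omega) c2
        (col1.mono (Finset.erase_subset _ _)) col2
      have e : 49 * M * (L1.card + L2.card) = 49 * M * ((L1.erase h).card + L2.card) + 49 * M := by
        rw [← hc]; ring
      omega
    push Not at a1 a2
    rcases L2.eq_empty_or_nonempty with rfl | hne2
    · simp [Inc]
    rcases L1.eq_empty_or_nonempty with rfl | hne1
    · simp [Inc]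
    rcases le_total L1.card L2.card with hle | hle
    · exact (core p M hp hM1 hMp L1 L2 i1 i2 hle c1 col2 hne2 a2).elim
    · exact (core p M hp hM1 hMp L2 L1 i2 i1 hle c2 col1 hne1 a1).elim
end
end Stmt15

open Finset Pointwise

namespace Stmt15

section
variable {K : Type*} [Field K]

/-- projective change of coordinates -/
noncomputable def tr (c a : K) (q : K × K × K) : K × K × K :=
  ((q.1 + c * q.2.1 + a * q.2.2) / (1 + a * q.2.1), q.2.1 / (1 + a * q.2.1),
    q.2.2 / (1 + a * q.2.1))

lemma tr_inc (c a : K) (h q : K × K × K) (hD : 1 + a * q.2.1 ≠ 0) (hE : 1 + (-a) * h.2.1 ≠ 0) :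
    inc (tr (-c) (-a) h) (tr c a q) ↔ inc h q := by
  have key : ((1 + a * q.2.1) * (1 + (-a) * h.2.1)) *
      ((tr (-c) (-a) h).1 * (tr c a q).2.1 + (tr (-c) (-a) h).2.1 * (tr c a q).1
        + (tr c a q).2.2 + (tr (-c) (-a) h).2.2) = h.1 * q.2.1 + h.2.1 * q.1 + q.2.2 + h.2.2 := by
    simp only [tr]
    generalize hDD : 1 + a * q.2.1 = D at *
    generalize hEE : 1 + (-a) * h.2.1 = E at *
    field_simp
    rw [← hDD, ← hEE]
    ring
  unfold inc
  rw [← key, mul_eq_zero, or_iff_right (mul_ne_zero hD hE)]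

open Classical in
lemma Col.intro (M : ℕ) (L : Finset (K × K × K))
    (H : ∀ h0 ∈ L, ∀ h1 ∈ L, h0 ≠ h1 → ∃ G : Finset (K × K × K), G.card ≤ M ∧ ∀ h ∈ L,
      (h.2.1 - h0.2.1) * (h1.1 - h0.1) = (h1.2.1 - h0.2.1) * (h.1 - h0.1) →
      (h.2.2 - h0.2.2) * (h1.1 - h0.1) = (h1.2.2 - h0.2.2) * (h.1 - h0.1) → h ∈ G) :
    Col M L := by
  intro h0 hh0 h1 hh1 hne
  obtain ⟨G, hG, hs⟩ := H h0 hh0 h1 hh1 hne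
  refine le_trans (Finset.card_le_card ?_) hG
  intro h hh
  obtain ⟨a, b, c⟩ := Finset.mem_filter.1 hh
  exact hs h a b c

lemma tr_col (c a : K) (h h0 h1 : K × K × K) (hD : 1 + a * h.2.1 ≠ 0) (hD0 : 1 + a * h0.2.1 ≠ 0)
    (hD1 : 1 + a * h1.2.1 ≠ 0) (hne : (tr c a h1).1 - (tr c a h0).1 ≠ 0)
    (e1 : ((tr c a h).2.1 - (tr c a h0).2.1) * ((tr c a h1).1 - (tr c a h0).1) =
      ((tr c a h1).2.1 - (tr c a h0).2.1) * ((tr c a h).1 - (tr c a h0).1))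
    (e2 : ((tr c a h).2.2 - (tr c a h0).2.2) * ((tr c a h1).1 - (tr c a h0).1) =
      ((tr c a h1).2.2 - (tr c a h0).2.2) * ((tr c a h).1 - (tr c a h0).1)) :
    ∃ μ, h.1 - h0.1 = μ * (h1.1 - h0.1) ∧ h.2.1 - h0.2.1 = μ * (h1.2.1 - h0.2.1) ∧
      h.2.2 - h0.2.2 = μ * (h1.2.2 - h0.2.2) := by
  obtain ⟨y, x, z⟩ := h
  obtain ⟨y0, x0, z0⟩ := h0
  obtain ⟨y1, x1, z1⟩ := h1
  simp only [tr] at *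
  generalize hl : ((y + c * x + a * z) / (1 + a * x) - (y0 + c * x0 + a * z0) / (1 + a * x0)) /
    ((y1 + c * x1 + a * z1) / (1 + a * x1) - (y0 + c * x0 + a * z0) / (1 + a * x0)) = l
  have f0 : (y + c * x + a * z) / (1 + a * x) - (y0 + c * x0 + a * z0) / (1 + a * x0) =
    l * ((y1 + c * x1 + a * z1) / (1 + a * x1) - (y0 + c * x0 + a * z0) / (1 + a * x0)) := by
    rw [← hl, div_mul_cancel₀ _ hne]
  have f1 : x / (1 + a * x) - x0 / (1 + a * x0) = l * (x1 / (1 + a * x1) - x0 / (1 + a * x0)) := by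
    rw [f0] at e1
    apply mul_right_cancel₀ hne
    linear_combination e1
  have f2 : z / (1 + a * x) - z0 / (1 + a * x0) = l * (z1 / (1 + a * x1) - z0 / (1 + a * x0)) := by
    rw [f0] at e2
    apply mul_right_cancel₀ hne
    linear_combination e2
  have inv : ∀ t, 1 + a * t ≠ 0 → (1 + a * t)⁻¹ = 1 - a * (t / (1 + a * t)) := by
    intro t ht
    field_simp
    ring
  have f3 : (1 + a * x)⁻¹ - (1 + a * x0)⁻¹ = l * ((1 + a * x1)⁻¹ - (1 + a * x0)⁻¹) := by
    rw [inv x hD, inv x0 hD0, inv x1 hD1]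
    linear_combination -a * f1
  have g : ∀ t t0 t1 : K, t / (1 + a * x) - t0 / (1 + a * x0) =
      l * (t1 / (1 + a * x1) - t0 / (1 + a * x0)) →
      t - t0 = (l * (1 + a * x) * (1 + a * x1)⁻¹) * (t1 - t0) := by
    intro t t0 t1 ht
    simp only [div_eq_mul_inv] at ht
    have hx : (1 + a * x) * (1 + a * x)⁻¹ = 1 := mul_inv_cancel₀ hD
    linear_combination (1 + a * x) * ht - t0 * (1 + a * x) * f3 - (t - t0) * hx
  refine ⟨l * (1 + a * x) * (1 + a * x1)⁻¹, ?_, g _ _ _ f1, g _ _ _ f2⟩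
  have g1 := g _ _ _ f0
  have g2 := g _ _ _ f1
  have g3 := g _ _ _ f2
  linear_combination g1 - c * g2 - a * g3

end

section
variable {F : Type*} [Field F]

open Classical in
/-- fibre conditions implying the collinearity bound -/
def Fib (M : ℕ) (L : Finset (F × F × F)) : Prop :=
  (L.image Prod.fst).card ≤ M ∧ (L.image (fun h => h.2.1)).card ≤ M ∧
    ∀ a b, (L.filter (fun h => h.1 = a ∧ h.2.1 = b)).card ≤ M

open Polynomial

/-- the coordinates in the function field -/
noncomputable def up (h : F × F × F) : FractionRing F[X] × FractionRing F[X] × FractionRing F[X] :=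
  (algebraMap F[X] _ (C h.1), algebraMap F[X] _ (C h.2.1), algebraMap F[X] _ (C h.2.2))

/-- generic element -/
noncomputable def th (ε : F) (n : ℕ) : FractionRing F[X] := algebraMap F[X] _ (C ε * X ^ n)

/-- combined map -/
noncomputable def tu (ε : F) (h : F × F × F) :
    FractionRing F[X] × FractionRing F[X] × FractionRing F[X] := tr (th ε 1) (th ε 2) (up h)

lemma den_ne (ε : F) (h : F × F × F) : 1 + th ε 2 * (up h).2.1 ≠ 0 := by
  simp only [th, up]
  rw [← map_mul, ← map_one (algebraMap F[X] (FractionRing F[X])), ← map_add]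
  intro e
  rw [map_eq_zero_iff _ (IsFractionRing.injective _ _)] at e
  have := congrArg (fun f => f.coeff 0) e
  simp [coeff_one] at this

lemma tu_inj (ε : F) (hε : ε ≠ 0) (h h' : F × F × F) (e : (tu ε h).1 = (tu ε h').1) : h = h' := by
  obtain ⟨y, x, z⟩ := h
  obtain ⟨y', x', z'⟩ := h'
  simp only [tu, tr] at e
  rw [div_eq_div_iff (den_ne ε _) (den_ne ε _)] at e
  simp only [th, up] at e
  rw [← map_one (algebraMap F[X] (FractionRing F[X]))] at e
  simp only [← map_mul, ← map_add] at e
  have e := IsFractionRing.injective F[X] (FractionRing F[X]) e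
  have e' : C y + C (ε * x) * X + C (ε * (z + y * x')) * X ^ 2 + C (ε * ε * x * x') * X ^ 3
      + C (ε * ε * z * x') * X ^ 4
     = C y' + C (ε * x') * X + C (ε * (z' + y' * x)) * X ^ 2 + C (ε * ε * x * x') * X ^ 3
      + C (ε * ε * z' * x) * X ^ 4 := by
    simp only [C_mul, C_add]
    linear_combination e
  have c0 := congrArg (fun f => f.coeff 0) e'
  have c1 := congrArg (fun f => f.coeff 1) e'
  have c2 := congrArg (fun f => f.coeff 2) e'
  simp only [coeff_add, coeff_C_mul, coeff_X, coeff_C, coeff_X_pow] at c0 c1 c2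
  norm_num at c0 c1 c2
  have c1 : x = x' := c1.resolve_right hε
  have c2 : z + y * x' = z' + y' * x := c2.resolve_right hε
  rw [c0, c1] at c2
  rw [c0, c1, add_right_cancel c2]

lemma up_inc (h q : F × F × F) : inc (up h) (up q) ↔ inc h q := by
  simp only [inc, up]
  simp only [← map_mul, ← map_add]
  rw [map_eq_zero_iff _ (IsFractionRing.injective _ _), C_eq_zero]

lemma tu_inc (ε : F) (h q : F × F × F) : inc (tu (-ε) h) (tu ε q) ↔ inc h q := by
  have : ∀ n, th (-ε) n = - th ε n := by intro n; simp [th]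
  rw [← up_inc h q, tu, tu, this, this]
  apply tr_inc
  · exact den_ne ε q
  · rw [← this]; exact den_ne (-ε) h

lemma up_col (h h0 h1 : F × F × F) (μ : FractionRing F[X])
    (e1 : (up h).1 - (up h0).1 = μ * ((up h1).1 - (up h0).1))
    (e2 : (up h).2.1 - (up h0).2.1 = μ * ((up h1).2.1 - (up h0).2.1))
    (e3 : (up h).2.2 - (up h0).2.2 = μ * ((up h1).2.2 - (up h0).2.2)) :
    (h.1 - h0.1) * (h1.2.1 - h0.2.1) = (h.2.1 - h0.2.1) * (h1.1 - h0.1) ∧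
    (h.1 - h0.1) * (h1.2.2 - h0.2.2) = (h.2.2 - h0.2.2) * (h1.1 - h0.1) ∧
    (h.2.1 - h0.2.1) * (h1.2.2 - h0.2.2) = (h.2.2 - h0.2.2) * (h1.2.1 - h0.2.1) := by
  have inj : Function.Injective (fun a : F => algebraMap F[X] (FractionRing F[X]) (C a)) :=
    (IsFractionRing.injective _ _).comp C_injective
  simp only [up] at e1 e2 e3
  refine ⟨inj ?_, inj ?_, inj ?_⟩ <;> simp only [C_mul, C_sub, map_mul, map_sub]
  · rw [e1, e2]; ring
  · rw [e1, e3]; ring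
  · rw [e2, e3]; ring

open Classical in
lemma tu_Col (ε : F) (hε : ε ≠ 0) (M : ℕ) (L : Finset (F × F × F)) (hL : Fib M L) :
    Col M (L.image (tu ε)) := by
  obtain ⟨l1, l2, l3⟩ := hL
  apply Col.intro
  intro t0 ht0 t1 ht1 hne
  obtain ⟨h0, hh0, rfl⟩ := Finset.mem_image.1 ht0
  obtain ⟨h1, hh1, rfl⟩ := Finset.mem_image.1 ht1
  have hne01 : h0 ≠ h1 := fun e => hne (by rw [e])
  have hnf : (tu ε h1).1 - (tu ε h0).1 ≠ 0 := by
    intro e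
    exact hne01 (tu_inj ε hε h1 h0 (sub_eq_zero.1 e)).symm
  set G := L.filter (fun h =>
    (h.1 - h0.1) * (h1.2.1 - h0.2.1) = (h.2.1 - h0.2.1) * (h1.1 - h0.1) ∧
    (h.1 - h0.1) * (h1.2.2 - h0.2.2) = (h.2.2 - h0.2.2) * (h1.1 - h0.1) ∧
    (h.2.1 - h0.2.1) * (h1.2.2 - h0.2.2) = (h.2.2 - h0.2.2) * (h1.2.1 - h0.2.1)) with hG
  have hGL : G ⊆ L := Finset.filter_subset _ _
  have hcard : G.card ≤ M := by
    by_cases a1 : h1.1 = h0.1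
    swap
    · refine le_trans ?_ l1
      rw [← Finset.card_image_of_injOn (s := G) (f := Prod.fst)]
      · exact Finset.card_le_card (Finset.image_subset_image hGL)
      · rintro g hg g' hg' e
        have := (Finset.mem_filter.1 hg).2
        have h' := (Finset.mem_filter.1 hg').2
        have a1' := sub_ne_zero.2 a1
        have k2 : g.2.1 = g'.2.1 := by
          apply mul_right_cancel₀ a1'
          have e : g.1 = g'.1 := e
          linear_combination h'.1 - this.1 + (h1.2.1 - h0.2.1) * e
        have k3 : g.2.2 = g'.2.2 := by
          apply mul_right_cancel₀ a1'
          have e : g.1 = g'.1 := e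
          linear_combination h'.2.1 - this.2.1 + (h1.2.2 - h0.2.2) * e
        exact Prod.ext e (Prod.ext k2 k3)
    by_cases a2 : h1.2.1 = h0.2.1
    swap
    · refine le_trans ?_ l2
      rw [← Finset.card_image_of_injOn (s := G) (f := fun h => h.2.1)]
      · exact Finset.card_le_card (Finset.image_subset_image hGL)
      · rintro g hg g' hg' e
        have := (Finset.mem_filter.1 hg).2
        have h' := (Finset.mem_filter.1 hg').2
        have a1' := sub_ne_zero.2 a2
        have e : g.2.1 = g'.2.1 := e
        have k2 : g.1 = g'.1 := by
          apply mul_right_cancel₀ a1'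
          linear_combination this.1 - h'.1 + (h1.1 - h0.1) * e
        have k3 : g.2.2 = g'.2.2 := by
          apply mul_right_cancel₀ a1'
          linear_combination h'.2.2 - this.2.2 + (h1.2.2 - h0.2.2) * e
        exact Prod.ext k2 (Prod.ext e k3)
    have a3 : h1.2.2 - h0.2.2 ≠ 0 := by
      intro e
      exact hne01 (Prod.ext a1.symm (Prod.ext a2.symm (sub_eq_zero.1 e).symm))
    refine le_trans (Finset.card_le_card ?_) (l3 h0.1 h0.2.1)
    intro g hg
    have := (Finset.mem_filter.1 hg).2
    refine Finset.mem_filter.2 ⟨hGL hg, ?_, ?_⟩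
    · apply sub_eq_zero.1
      apply (mul_eq_zero.1 (this.2.1.trans (by rw [a1]; ring))).resolve_right a3
    · apply sub_eq_zero.1
      apply (mul_eq_zero.1 (this.2.2.trans (by rw [a2]; ring))).resolve_right a3
  refine ⟨G.image (tu ε), Finset.card_image_le.trans hcard, ?_⟩
  intro t ht1 e1 e2
  obtain ⟨h, hh, rfl⟩ := Finset.mem_image.1 ht1
  refine Finset.mem_image_of_mem _ (Finset.mem_filter.2 ⟨hh, ?_⟩)
  obtain ⟨μ, m1, m2, m3⟩ := tr_col _ _ (up h) (up h0) (up h1) (den_ne ε h) (den_ne ε h0)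
    (den_ne ε h1) hnf e1 e2
  exact up_col h h0 h1 μ m1 m2 m3

open Classical in
theorem incidence_F (p M : ℕ) (hp : ∀ e : ℕ, 0 < e → e < p → (e : F) ≠ 0) (hM1 : 1 ≤ M)
    (hMp : M ≤ p) (L1 L2 : Finset (F × F × F))
    (c1 : L1.card ≤ M ^ 2) (c2 : L2.card ≤ M ^ 2) (f1 : Fib M L1) (f2 : Fib M L2) :
    Inc L1 L2 ≤ 49 * M * (L1.card + L2.card) := by
  have n1 : (1 : F) ≠ 0 := one_ne_zero
  have n2 : (-1 : F) ≠ 0 := neg_ne_zero.2 one_ne_zero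
  have j1 : Function.Injective (tu (1 : F)) := fun h h' e => tu_inj 1 n1 h h' (by rw [e])
  have j2 : Function.Injective (tu (-1 : F)) := fun h h' e => tu_inj (-1) n2 h h' (by rw [e])
  have hpK : ∀ e : ℕ, 0 < e → e < p → (e : FractionRing F[X]) ≠ 0 := by
    intro e he hep h
    apply hp e he hep
    rw [← map_natCast (algebraMap F[X] (FractionRing F[X])),
      map_eq_zero_iff _ (IsFractionRing.injective _ _), ← map_natCast (C : F →+* F[X]),
      C_eq_zero] at h
    exact h
  have k1 : (L1.image (tu 1)).card = L1.card := Finset.card_image_of_injective _ j1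
  have k2 : (L2.image (tu (-1))).card = L2.card := Finset.card_image_of_injective _ j2
  have inj : ∀ ε : F, ε ≠ 0 → ∀ L : Finset (F × F × F),
      Set.InjOn Prod.fst ((L.image (tu ε) : Finset _) : Set (FractionRing F[X] × FractionRing F[X] × FractionRing F[X])) := by
    intro ε hε L t ht t' ht' e
    rw [Finset.coe_image] at ht ht'
    obtain ⟨h, _, rfl⟩ := ht
    obtain ⟨h', _, rfl⟩ := ht'
    rw [tu_inj ε hε h h' e]
  have := incidence p M hpK hM1 hMp _ (L1.image (tu 1)) (L2.image (tu (-1))) le_rfl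
    (inj _ n1 _) (inj _ n2 _) (by rwa [k1]) (by rwa [k2]) (tu_Col 1 n1 M L1 f1)
    (tu_Col (-1) n2 M L2 f2)
  rw [k1, k2] at this
  refine le_trans (le_of_eq ?_) this
  rw [Inc, Inc, Finset.sum_image (fun _ _ _ _ e => j2 e)]
  refine Finset.sum_congr rfl fun h _ => ?_
  rw [Finset.filter_image, Finset.card_image_of_injective _ j1]
  simp only [tu_inc]

end
end Stmt15

open Finset Pointwise

namespace Stmt15

section
variable {F : Type*} [Field F] [DecidableEq F]

/-- points -/
def fq (d : F × F × F) : F × F × F := (d.2.1, d.1, d.1 ^ 2 + d.2.2 - d.2.1 ^ 2)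

/-- planes -/
def fh (d : F × F × F) : F × F × F := (-2 * d.2.1, 2 * d.1, d.2.1 ^ 2 - d.1 ^ 2 - d.2.2)

/-- the function -/
def gg (d : F × F × F) : F := (d.1 - d.2.1) ^ 2 + d.2.2

lemma fq_inj : Function.Injective (fq (F := F)) := by
  rintro ⟨s, c, b⟩ ⟨s', c', b'⟩ e
  simp only [fq, Prod.mk.injEq] at e
  obtain ⟨rfl, rfl, e⟩ := e
  have : b = b' := by linear_combination e
  rw [this]

lemma fh_inj (h2 : (2 : F) ≠ 0) : Function.Injective (fh (F := F)) := by
  rintro ⟨s, c, b⟩ ⟨s', c', b'⟩ e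
  simp only [fh, Prod.mk.injEq] at e
  obtain ⟨e1, e2, e⟩ := e
  have e1 : c = c' := mul_left_cancel₀ (neg_ne_zero.2 h2) e1
  have e2 : s = s' := mul_left_cancel₀ h2 e2
  subst e1 e2
  have : b = b' := by linear_combination -e
  rw [this]

lemma fib_fq (M : ℕ) (S A Q : Finset F) (hS : S.card ≤ M) (hA : A.card ≤ M) (hQ : Q.card ≤ M) :
    Fib M ((S ×ˢ A ×ˢ Q).image fq) := by
  classical
  refine ⟨?_, ?_, ?_⟩
  · refine le_trans (Finset.card_le_card (t := A) ?_) hA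
    intro t ht
    simp only [Finset.mem_image, Finset.mem_product] at ht
    obtain ⟨_, ⟨d, hd, rfl⟩, rfl⟩ := ht
    exact hd.2.1
  · refine le_trans (Finset.card_le_card (t := S) ?_) hS
    intro t ht
    simp only [Finset.mem_image, Finset.mem_product] at ht
    obtain ⟨_, ⟨d, hd, rfl⟩, rfl⟩ := ht
    exact hd.1
  · intro a b
    refine le_trans (Finset.card_le_card (t := Q.image (fun β => (a, b, b ^ 2 + β - a ^ 2))) ?_)
      (Finset.card_image_le.trans hQ)
    intro t ht
    simp only [Finset.mem_filter, Finset.mem_image, Finset.mem_product] at ht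
    obtain ⟨⟨d, hd, rfl⟩, rfl, rfl⟩ := ht
    exact Finset.mem_image.2 ⟨d.2.2, hd.2.2, rfl⟩

lemma fib_fh (h2 : (2 : F) ≠ 0) (M : ℕ) (S A Q : Finset F) (hS : S.card ≤ M) (hA : A.card ≤ M)
    (hQ : Q.card ≤ M) : Fib M ((S ×ˢ A ×ˢ Q).image fh) := by
  classical
  refine ⟨?_, ?_, ?_⟩
  · refine le_trans (Finset.card_le_card (t := A.image (fun c => -2 * c)) ?_)
      (Finset.card_image_le.trans hA)
    intro t ht
    simp only [Finset.mem_image, Finset.mem_product] at ht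
    obtain ⟨_, ⟨d, hd, rfl⟩, rfl⟩ := ht
    exact Finset.mem_image.2 ⟨d.2.1, hd.2.1, rfl⟩
  · refine le_trans (Finset.card_le_card (t := S.image (fun c => 2 * c)) ?_)
      (Finset.card_image_le.trans hS)
    intro t ht
    simp only [Finset.mem_image, Finset.mem_product] at ht
    obtain ⟨_, ⟨d, hd, rfl⟩, rfl⟩ := ht
    exact Finset.mem_image.2 ⟨d.1, hd.1, rfl⟩
  · intro a b
    refine le_trans (Finset.card_le_card
      (t := Q.image (fun β => (a, b, (a / 2) ^ 2 - (b / 2) ^ 2 - β))) ?_)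
      (Finset.card_image_le.trans hQ)
    intro t ht
    simp only [Finset.mem_filter, Finset.mem_image, Finset.mem_product] at ht
    obtain ⟨⟨d, hd, rfl⟩, rfl, rfl⟩ := ht
    refine Finset.mem_image.2 ⟨d.2.2, hd.2.2, ?_⟩
    simp only [fh, Prod.mk.injEq, true_and]
    field_simp

/-- energy lower bound -/
lemma energy (D : Finset (F × F × F)) (Λ : Finset F) :
    (D.filter (fun d => gg d ∈ Λ)).card ^ 2 ≤
      Λ.card * ((D ×ˢ D).filter (fun t => gg t.1 = gg t.2)).card := by
  have h1 : (D.filter (fun d => gg d ∈ Λ)).card = ∑ l ∈ Λ, (D.filter (fun d => gg d = l)).card := by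
    rw [Finset.card_eq_sum_card_fiberwise (f := gg) (t := Λ)]
    · refine Finset.sum_congr rfl fun l hl => ?_
      rw [Finset.filter_filter]
      congr 1
      ext d
      simp only [Finset.mem_filter]
      constructor
      · rintro ⟨a, b, c⟩; exact ⟨a, c⟩
      · rintro ⟨a, c⟩; exact ⟨a, c ▸ hl, c⟩
    · intro d hd
      exact (Finset.mem_filter.1 hd).2
  rw [h1]
  refine sq_sum_le_card_mul_sum_sq.trans (Nat.mul_le_mul_left _ ?_)
  have h2 : ∀ l ∈ Λ, (D.filter (fun d => gg d = l)).card ^ 2 =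
      ((D.filter (fun d => gg d = l)) ×ˢ (D.filter (fun d => gg d = l))).card := by
    intro l _
    rw [Finset.card_product, sq]
  rw [Finset.sum_congr rfl h2, ← Finset.card_biUnion]
  · refine Finset.card_le_card ?_
    intro t ht
    simp only [Finset.mem_biUnion, Finset.mem_product, Finset.mem_filter] at ht ⊢
    obtain ⟨l, _, ⟨a, b⟩, c, d⟩ := ht
    exact ⟨⟨a, c⟩, b.trans d.symm⟩
  · intro l _ l' _ hne
    rw [Function.onFun, Finset.disjoint_left]
    intro t ht ht'
    simp only [Finset.mem_product, Finset.mem_filter] at ht ht'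
    exact hne (ht.1.2.symm.trans ht'.1.2)

lemma energy_le_Inc (h2 : (2 : F) ≠ 0) (S A Q : Finset F) :
    (((S ×ˢ A ×ˢ Q) ×ˢ (S ×ˢ A ×ˢ Q)).filter (fun t => gg t.1 = gg t.2)).card ≤
      Inc ((S ×ˢ A ×ˢ Q).image fq) ((S ×ˢ A ×ˢ Q).image fh) := by
  classical
  have : Inc ((S ×ˢ A ×ˢ Q).image fq) ((S ×ˢ A ×ˢ Q).image fh) =
      ((((S ×ˢ A ×ˢ Q).image fh) ×ˢ ((S ×ˢ A ×ˢ Q).image fq)).filter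
        (fun t => inc t.1 t.2)).card := by
    rw [Finset.card_filter, Finset.sum_product, Inc]
    refine Finset.sum_congr rfl fun h _ => ?_
    rw [Finset.card_filter]
  rw [this]
  refine Finset.card_le_card_of_injOn
    (fun t => (fh (t.2.1, t.1.2.1, t.2.2.2), fq (t.1.1, t.2.2.1, t.1.2.2))) ?_ ?_
  · rintro ⟨⟨s, c, b⟩, ⟨s', c', b'⟩⟩ ht
    simp only [Finset.coe_filter, Finset.mem_product, Set.mem_setOf_eq] at ht ⊢
    refine ⟨⟨Finset.mem_image_of_mem _ ?_, Finset.mem_image_of_mem _ ?_⟩, ?_⟩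
    · simp only [Finset.mem_product]; tauto
    · simp only [Finset.mem_product]; tauto
    · have e := ht.2
      simp only [gg] at e
      simp only [inc, fh, fq]
      linear_combination e
  · rintro ⟨⟨s, c, b⟩, ⟨s', c', b'⟩⟩ _ ⟨⟨s1, c1, b1⟩, ⟨s1', c1', b1'⟩⟩ _ e
    simp only [Prod.mk.injEq] at e
    have e1 := fh_inj h2 e.1
    have e2 := fq_inj e.2
    simp only [Prod.mk.injEq] at e1 e2 ⊢
    tauto

lemma main_nat (p M : ℕ) (hp : ∀ e : ℕ, 0 < e → e < p → (e : F) ≠ 0) (h2 : (2 : F) ≠ 0)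
    (A : Finset F) (hA : A.Nonempty) (hMp : M ≤ p) (hM : (A + A).card * A.card ^ 2 ≤ M ^ 2)
    (hMS : (A + A).card ≤ M) :
    A.card ^ 4 ≤
      196 * ((A ×ˢ A).image (fun q => q.1 ^ 2 + q.2 ^ 2)).card * M * (A + A).card := by
  classical
  set S := A + A with hS
  set Q := A.image (fun a => a ^ 2) with hQ
  set Λ := (A ×ˢ A).image (fun q => q.1 ^ 2 + q.2 ^ 2) with hΛ
  have hn : 0 < A.card := hA.card_pos
  have hQA : Q.card ≤ A.card := Finset.card_image_le
  have hAQ : A.card ≤ 2 * Q.card := by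
    refine Finset.card_le_mul_card_image A 2 ?_
    intro a ha
    obtain ⟨b, hb, rfl⟩ := Finset.mem_image.1 ha
    refine (Finset.card_le_card (t := {b, -b}) ?_).trans Finset.card_le_two
    intro x hx
    have := (Finset.mem_filter.1 hx).2
    simp only [Finset.mem_insert, Finset.mem_singleton]
    exact sq_eq_sq_iff_eq_or_eq_neg.1 this
  have hAS : A.card ≤ S.card := Finset.card_le_card_add_right hA
  have hM1 : 1 ≤ M := by omega
  have hcard : (S ×ˢ A ×ˢ Q).card = S.card * (A.card * Q.card) := by simp
  have hcM : (S ×ˢ A ×ˢ Q).card ≤ M ^ 2 := by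
    rw [hcard]
    refine le_trans ?_ hM
    rw [sq]
    gcongr
  have k1 : ((S ×ˢ A ×ˢ Q).image fq).card = (S ×ˢ A ×ˢ Q).card :=
    Finset.card_image_of_injective _ fq_inj
  have k2 : ((S ×ˢ A ×ˢ Q).image fh).card = (S ×ˢ A ×ˢ Q).card :=
    Finset.card_image_of_injective _ (fh_inj h2)
  have hI := incidence_F p M hp hM1 hMp ((S ×ˢ A ×ˢ Q).image fq) ((S ×ˢ A ×ˢ Q).image fh)
    (by rwa [k1]) (by rwa [k2]) (fib_fq M S A Q hMS (by omega) (by omega))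
    (fib_fh h2 M S A Q hMS (by omega) (by omega))
  rw [k1, k2, hcard] at hI
  have hE := (energy (S ×ˢ A ×ˢ Q) Λ).trans
    (Nat.mul_le_mul_left _ ((energy_le_Inc h2 S A Q).trans hI))
  have hD : A.card * (A.card * Q.card) ≤ ((S ×ˢ A ×ˢ Q).filter (fun d => gg d ∈ Λ)).card := by
    have : (A ×ˢ A ×ˢ Q).card = A.card * (A.card * Q.card) := by simp
    rw [← this]
    refine Finset.card_le_card_of_injOn (fun t => (t.1 + t.2.1, t.2.1, t.2.2)) ?_ ?_
    · rintro ⟨a, b, β⟩ ht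
      simp only [Finset.coe_product, Set.mem_prod, Finset.mem_coe] at ht
      obtain ⟨ha, hb, hβ⟩ := ht
      obtain ⟨d, hd, rfl⟩ := Finset.mem_image.1 hβ
      simp only [Finset.coe_filter, Finset.mem_product, Set.mem_setOf_eq]
      refine ⟨⟨Finset.add_mem_add ha hb, hb, hβ⟩, ?_⟩
      refine Finset.mem_image.2 ⟨(a, d), Finset.mem_product.2 ⟨ha, hd⟩, ?_⟩
      simp [gg]
    · rintro ⟨a, b, β⟩ _ ⟨a', b', β'⟩ _ e
      simp only [Prod.mk.injEq] at e ⊢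
      obtain ⟨e1, rfl, rfl⟩ := e
      exact ⟨add_right_cancel e1, rfl, rfl⟩
  have hE2 := (Nat.pow_le_pow_left hD 2).trans hE
  have hQ0 : 0 < Q.card := by omega
  have h5 : (A.card * Q.card) * (A.card ^ 3 * Q.card) ≤
      (A.card * Q.card) * (98 * Λ.card * M * S.card) := by
    calc _ = (A.card * (A.card * Q.card)) ^ 2 := by ring
      _ ≤ _ := hE2
      _ = _ := by ring
  have h6 := Nat.le_of_mul_le_mul_left h5 (Nat.mul_pos hn hQ0)
  calc A.card ^ 4 = A.card ^ 3 * A.card := by ring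
    _ ≤ A.card ^ 3 * (2 * Q.card) := Nat.mul_le_mul_left _ hAQ
    _ = 2 * (A.card ^ 3 * Q.card) := by ring
    _ ≤ 2 * (98 * Λ.card * M * S.card) := Nat.mul_le_mul_left _ h6
    _ = _ := by ring

end
end Stmt15

theorem stmt_15 :
    ∃ c : ℝ, 0 < c ∧ ∀ (p : ℕ), p.Prime → 2 < p →
      ∀ A : Finset (ZMod p), (A.card : ℝ) ≤ (p : ℝ) ^ ((5 : ℝ) / 8) →
      c * (A.card : ℝ) ^ ((6 : ℝ) / 5) ≤
        max ((A + A).card : ℝ)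
          (((A ×ˢ A).image (fun q => q.1 ^ 2 + q.2 ^ 2)).card : ℝ) := by
  refine ⟨1 / 11, by norm_num, ?_⟩
  intro p hpp hp2 A hA
  haveI : Fact p.Prime := ⟨hpp⟩
  rcases A.eq_empty_or_nonempty with rfl | hne
  · simp
  by_contra hlt
  push Not at hlt
  set n := A.card with hn
  set σ := (A + A).card with hσ
  set l := ((A ×ˢ A).image (fun q => q.1 ^ 2 + q.2 ^ 2)).card with hl
  set r : ℝ := (n : ℝ) ^ ((6 : ℝ) / 5) with hr
  have hσr : (σ : ℝ) < 1 / 11 * r := (le_max_left _ _).trans_lt hlt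
  have hlr : (l : ℝ) < 1 / 11 * r := (le_max_right _ _).trans_lt hlt
  have hn0 : 0 < n := hne.card_pos
  have hnR : (0 : ℝ) < n := by exact_mod_cast hn0
  have hr0 : 0 < r := Real.rpow_pos_of_pos hnR _
  have hr5 : r ^ 5 = (n : ℝ) ^ 6 := by
    rw [hr, ← Real.rpow_natCast, ← Real.rpow_mul hnR.le, ← Real.rpow_natCast]
    norm_num
  have hrp : r * (n : ℝ) ^ 2 ≤ (p : ℝ) ^ 2 := by
    have e1 : r * (n : ℝ) ^ 2 = (n : ℝ) ^ ((16 : ℝ) / 5) := by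
      rw [hr, ← Real.rpow_natCast, ← Real.rpow_add hnR]
      norm_num
    have e2 : ((p : ℝ) ^ ((5 : ℝ) / 8)) ^ ((16 : ℝ) / 5) = (p : ℝ) ^ 2 := by
      rw [← Real.rpow_mul (Nat.cast_nonneg p), ← Real.rpow_natCast]
      norm_num
    rw [e1, ← e2]
    exact Real.rpow_le_rpow hnR.le hA (by norm_num)
  have hnσ : n ≤ σ := Finset.card_le_card_add_right hne
  have hσn : σ ≤ n ^ 2 := by rw [sq]; exact Finset.card_add_le
  set q := Nat.sqrt (σ * n ^ 2) with hq
  have hqσ : σ ≤ q := by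
    rw [hq, Nat.le_sqrt]
    exact Nat.mul_le_mul_left _ hσn
  have hq1 : q * q ≤ σ * n ^ 2 := Nat.sqrt_le _
  have hq2 : σ * n ^ 2 < (q + 1) * (q + 1) := Nat.lt_succ_sqrt _
  have hM4 : (q + 1) ^ 2 ≤ 4 * (σ * n ^ 2) := by nlinarith
  have hM4R : ((q + 1 : ℕ) : ℝ) ^ 2 ≤ 4 * ((σ : ℝ) * (n : ℝ) ^ 2) := by exact_mod_cast hM4
  have hMp : q + 1 ≤ p := by
    have : ((q + 1 : ℕ) : ℝ) ^ 2 ≤ (p : ℝ) ^ 2 := by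
      refine hM4R.trans (le_trans ?_ hrp)
      have : 0 < (n : ℝ) ^ 2 := by positivity
      nlinarith
    have h3 := (le_abs_self _).trans (abs_le_of_sq_le_sq this (Nat.cast_nonneg p))
    exact_mod_cast h3
  have hpe : ∀ e : ℕ, 0 < e → e < p → (e : ZMod p) ≠ 0 := by
    intro e he hep h
    rw [ZMod.natCast_eq_zero_iff] at h
    exact Nat.not_dvd_of_pos_of_lt he hep h
  have hmain := Stmt15.main_nat p (q + 1) hpe (by exact_mod_cast hpe 2 (by omega) hp2) A hne hMp
    (by rw [sq (q + 1)]; exact hq2.le) (by omega)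
  have hmR : (n : ℝ) ^ 4 ≤ 196 * (l : ℝ) * ((q + 1 : ℕ) : ℝ) * (σ : ℝ) := by exact_mod_cast hmain
  have h8 : ((n : ℝ) ^ 4) ^ 2 ≤ (196 * (l : ℝ) * ((q + 1 : ℕ) : ℝ) * (σ : ℝ)) ^ 2 :=
    pow_le_pow_left₀ (by positivity) hmR 2
  have h9 : (n : ℝ) ^ 2 * (n : ℝ) ^ 6 ≤ (n : ℝ) ^ 2 * (153664 * ((l : ℝ) ^ 2 * (σ : ℝ) ^ 3)) := by
    calc (n : ℝ) ^ 2 * (n : ℝ) ^ 6 = ((n : ℝ) ^ 4) ^ 2 := by ring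
      _ ≤ _ := h8
      _ = (196 * (l : ℝ) * (σ : ℝ)) ^ 2 * ((q + 1 : ℕ) : ℝ) ^ 2 := by ring
      _ ≤ (196 * (l : ℝ) * (σ : ℝ)) ^ 2 * (4 * ((σ : ℝ) * (n : ℝ) ^ 2)) :=
        mul_le_mul_of_nonneg_left hM4R (by positivity)
      _ = _ := by ring
  have h10 := le_of_mul_le_mul_left h9 (by positivity)
  have h11 : (l : ℝ) ^ 2 * (σ : ℝ) ^ 3 ≤ (1 / 11 * r) ^ 2 * (1 / 11 * r) ^ 3 := by
    gcongr
  have h12 : (1 / 11 * r) ^ 2 * (1 / 11 * r) ^ 3 = 1 / 161051 * (n : ℝ) ^ 6 := by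
    rw [← hr5]; ring
  have h13 : 0 < (n : ℝ) ^ 6 := by positivity
  rw [h12] at h11
  nlinarith
end
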